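/- arXiv:1703.10705 — 4 statements merged into one kernel-verified Lean document; each statement's English description precedes it below -/
import Mathlib

section
/- Let f : ℤ² → ℝ ∪ {+∞} be an integrally convex function and α a positive integer. Then the scaled function f^α defined by f^α(x) = f(αx) is integrally convex. -/
open scoped BigOperators

noncomputable section

/-- Integer neighborhood `N(x)` of a real point. -/
def intNbhd {n : ℕ} (x : Fin n → ℝ) : Set (Fin n → ℤ) :=
  {z | ∀ i, |x i - (z i : ℝ)| < 1}

/-- Local convex extension of `f : ℤⁿ → ℝ ∪ {+∞}`. -/
noncomputable def localExt {n : ℕ} (f : (Fin n → ℤ) → EReal) (x : Fin n → ℝ) : EReal :=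
  sInf { v : EReal | ∃ (m : ℕ) (lam : Fin m → ℝ) (y : Fin m → (Fin n → ℤ)),
      (∀ j, 0 ≤ lam j) ∧ (∑ j, lam j) = 1 ∧ (∀ j, y j ∈ intNbhd x) ∧
      (∀ i, (∑ j, lam j * ((y j i : ℝ))) = x i) ∧
      v = ∑ j, (((lam j : ℝ) : EReal) * f (y j)) }

/-- A function is integrally convex if its local convex extension is convex. -/
def IsIntegrallyConvexFn {n : ℕ} (f : (Fin n → ℤ) → EReal) : Prop :=
  ∀ x y : Fin n → ℝ, ∀ t : ℝ, 0 ≤ t → t ≤ 1 →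
    localExt f (fun i => t * x i + (1 - t) * y i) ≤
      ((t : ℝ) : EReal) * localExt f x + (((1 - t : ℝ)) : EReal) * localExt f y

/-- Coercion of an integer point to a real point. -/
def realify {n : ℕ} (z : Fin n → ℤ) : Fin n → ℝ := fun i => (z i : ℝ)

/-- A set `S ⊆ ℤⁿ` is integrally convex. -/
def IsIntegrallyConvexSet {n : ℕ} (S : Set (Fin n → ℤ)) : Prop :=
  ∀ x : Fin n → ℝ, x ∈ convexHull ℝ (realify '' S) →
    x ∈ convexHull ℝ (realify '' (S ∩ intNbhd x))

/-- Real-valued form of a local representation of cost at most `c`. -/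
def ICRep (f : (Fin 2 → ℤ) → EReal) (x : Fin 2 → ℝ) (c : ℝ) : Prop :=
  ∃ (m : ℕ) (lam : Fin m → ℝ) (y : Fin m → (Fin 2 → ℤ)),
      (∀ j, 0 ≤ lam j) ∧ (∑ j, lam j) = 1 ∧ (∀ j, y j ∈ intNbhd x) ∧
      (∀ i, (∑ j, lam j * ((y j i : ℝ))) = x i) ∧
      (∀ j, lam j ≠ 0 → f (y j) ≠ ⊤) ∧ ∑ j, lam j * (f (y j)).toReal ≤ c

lemma ereal_sum_aux {ι : Type*} (s : Finset ι) (a : ι → EReal) (h : ∀ j ∈ s, a j ≠ ⊥) :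
    (∑ j ∈ s, a j) ≠ ⊥ ∧ ((∑ j ∈ s, a j) ≠ ⊤ → (∀ j ∈ s, a j ≠ ⊤) ∧
      ∑ j ∈ s, a j = ((∑ j ∈ s, (a j).toReal : ℝ) : EReal)) := by
  classical
  induction s using Finset.induction_on with
  | empty => simp
  | insert b s hb ih =>
    obtain ⟨h1, h2⟩ := ih (fun j hj => h j (Finset.mem_insert_of_mem hj))
    have hb' := h b (Finset.mem_insert_self _ _)
    rw [Finset.sum_insert hb, Finset.sum_insert hb]
    refine ⟨by simp [EReal.add_eq_bot_iff, h1, hb'], fun ht => ?_⟩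
    have hbt : a b ≠ ⊤ := by
      intro h0; rw [h0] at ht; exact ht (EReal.top_add_of_ne_bot h1)
    have hst : ∑ j ∈ s, a j ≠ ⊤ := by
      intro h0; rw [h0] at ht; exact ht (EReal.add_top_of_ne_bot hb')
    obtain ⟨h3, h4⟩ := h2 hst
    refine ⟨?_, ?_⟩
    · intro j hj
      rcases Finset.mem_insert.1 hj with rfl | hj
      · exact hbt
      · exact h3 j hj
    · rw [h4, EReal.coe_add, EReal.coe_toReal hbt hb']

lemma mul_ne_bot_aux (l : ℝ) (hl : 0 ≤ l) (a : EReal) (ha : a ≠ ⊥) : (l : EReal) * a ≠ ⊥ := by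
  induction a with
  | bot => exact absurd rfl ha
  | coe r => rw [← EReal.coe_mul]; exact EReal.coe_ne_bot _
  | top =>
    rcases hl.eq_or_lt with h | h
    · rw [← h]; simp
    · rw [EReal.coe_mul_top_of_pos h]; simp

lemma rep_of_lt {f : (Fin 2 → ℤ) → EReal} (hbot : ∀ x, f x ≠ ⊥) {x : Fin 2 → ℝ} {c : ℝ}
    (h : localExt f x < (c : EReal)) : ICRep f x c := by
  unfold localExt at h
  obtain ⟨v, ⟨m, lam, y, h0, h1, h2, h3, rfl⟩, hv⟩ := sInf_lt_iff.1 h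
  obtain ⟨-, h5⟩ := ereal_sum_aux Finset.univ (fun j => ((lam j : ℝ) : EReal) * f (y j))
    (fun j _ => mul_ne_bot_aux _ (h0 j) _ (hbot _))
  obtain ⟨h6, h7⟩ := h5 (ne_top_of_lt hv)
  refine ⟨m, lam, y, h0, h1, h2, h3, ?_, ?_⟩
  · intro j hj ht
    apply h6 j (Finset.mem_univ _)
    simp only [ht]
    exact EReal.coe_mul_top_of_pos (lt_of_le_of_ne (h0 j) (Ne.symm hj))
  · rw [h7, EReal.coe_lt_coe_iff] at hv
    simpa [EReal.toReal_mul] using hv.le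

lemma le_of_rep {f : (Fin 2 → ℤ) → EReal} (hbot : ∀ x, f x ≠ ⊥) {x : Fin 2 → ℝ} {c : ℝ}
    (h : ICRep f x c) : localExt f x ≤ (c : EReal) := by
  obtain ⟨m, lam, y, h0, h1, h2, h3, h4, h5⟩ := h
  refine le_trans (sInf_le ⟨m, lam, y, h0, h1, h2, h3, rfl⟩) ?_
  have : ∀ j, ((lam j : ℝ) : EReal) * f (y j) = ((lam j * (f (y j)).toReal : ℝ) : EReal) := by
    intro j
    by_cases hj : lam j = 0
    · simp [hj]
    · rw [EReal.coe_mul, EReal.coe_toReal (h4 j hj) (hbot _)]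
  rw [Finset.sum_congr rfl (fun j _ => this j)]
  have h8 : ∀ s : Finset (Fin m), ∑ j ∈ s, ((lam j * (f (y j)).toReal : ℝ) : EReal)
      = ((∑ j ∈ s, lam j * (f (y j)).toReal : ℝ) : EReal) := by
    intro s
    classical
    induction s using Finset.induction_on with
    | empty => simp
    | insert b s hb ih => rw [Finset.sum_insert hb, Finset.sum_insert hb, ih, EReal.coe_add]
  rw [h8]
  exact_mod_cast h5

lemma localExt_int_le (f : (Fin 2 → ℤ) → EReal) (z : Fin 2 → ℤ) :
    localExt f (fun i => (z i : ℝ)) ≤ f z := by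
  refine sInf_le ⟨1, fun _ => 1, fun _ => z, by simp, by simp, ?_, by simp, by simp⟩
  intro j i; simp

/-- Convexity along a segment between two points of the domain. -/
lemma rep_segment {f : (Fin 2 → ℤ) → EReal} (hbot : ∀ x, f x ≠ ⊥) (hf : IsIntegrallyConvexFn f)
    {z w : Fin 2 → ℤ} (hz : f z ≠ ⊤) (hw : f w ≠ ⊤) {t : ℝ} (h0 : 0 ≤ t) (h1 : t ≤ 1)
    {ε : ℝ} (hε : 0 < ε) :
    ICRep f (fun i => t * (z i : ℝ) + (1 - t) * (w i : ℝ))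
      (t * (f z).toReal + (1 - t) * (f w).toReal + ε) := by
  apply rep_of_lt hbot
  have := hf (fun i => (z i : ℝ)) (fun i => (w i : ℝ)) t h0 h1
  refine lt_of_le_of_lt this ?_
  have e1 : ((t : ℝ) : EReal) * localExt f (fun i => (z i : ℝ)) ≤ ((t * (f z).toReal : ℝ) : EReal) := by
    rw [EReal.coe_mul, EReal.coe_toReal hz (hbot _)]
    exact mul_le_mul_of_nonneg_left (localExt_int_le f z) (by exact_mod_cast h0)
  have e2 : ((1 - t : ℝ) : EReal) * localExt f (fun i => (w i : ℝ)) ≤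
      (((1 - t) * (f w).toReal : ℝ) : EReal) := by
    rw [EReal.coe_mul, EReal.coe_toReal hw (hbot _)]
    exact mul_le_mul_of_nonneg_left (localExt_int_le f w) (by exact_mod_cast (sub_nonneg.2 h1))
  refine lt_of_le_of_lt (add_le_add e1 e2) ?_
  rw [← EReal.coe_add, EReal.coe_lt_coe_iff]
  linarith

/-- A unit axis direction. -/
def IsAxis (d : Fin 2 → ℤ) : Prop := ∃ j, |d j| = 1 ∧ ∀ k, k ≠ j → d k = 0

lemma rep_edge {f : (Fin 2 → ℤ) → EReal} {u d : Fin 2 → ℤ} (hd : IsAxis d) {θ : ℝ}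
    (h0 : 0 ≤ θ) (h1 : θ < 1) {x : Fin 2 → ℝ} (hx : ∀ i, x i = u i + θ * d i) {c : ℝ}
    (h : ICRep f x c) :
    f u ≠ ⊤ ∧ (0 < θ → f (u + d) ≠ ⊤) ∧
      (1 - θ) * (f u).toReal + θ * (f (u + d)).toReal ≤ c := by
  obtain ⟨m, lam, y, g0, g1, g2, g3, g4, g5⟩ := h
  obtain ⟨k, hk, hk'⟩ := hd
  have key : ∀ j, y j = u ∨ y j = u + d := by
    intro j
    have hj := g2 j
    have hoff : ∀ i, i ≠ k → y j i = u i := by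
      intro i hi
      have := hj i
      rw [hx, hk' i hi, abs_lt] at this
      have a1 : ((y j i : ℤ) : ℝ) < ((u i + 1 : ℤ) : ℝ) := by push_cast; push_cast at this; linarith
      have a2 : ((u i : ℤ) : ℝ) < ((y j i + 1 : ℤ) : ℝ) := by push_cast; push_cast at this; linarith
      have a1 := Int.cast_lt.1 a1
      have a2 := Int.cast_lt.1 a2
      omega
    have hon : y j k = u k ∨ y j k = u k + d k := by
      have := hj k
      rw [hx, abs_lt] at this
      rcases (abs_eq (by norm_num)).1 hk with hdk | hdk <;> rw [hdk] at this ⊢ <;>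
        push_cast at this
      · have a1 : ((y j k : ℤ) : ℝ) < ((u k + 2 : ℤ) : ℝ) := by push_cast; linarith
        have a2 : ((u k : ℤ) : ℝ) < ((y j k + 1 : ℤ) : ℝ) := by push_cast; linarith
        have a1 := Int.cast_lt.1 a1
        have a2 := Int.cast_lt.1 a2
        omega
      · have a1 : ((y j k : ℤ) : ℝ) < ((u k + 1 : ℤ) : ℝ) := by push_cast; linarith
        have a2 : ((u k : ℤ) : ℝ) < ((y j k + 2 : ℤ) : ℝ) := by push_cast; linarith
        have a1 := Int.cast_lt.1 a1
        have a2 := Int.cast_lt.1 a2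
        omega
    rcases hon with h | h
    · left; ext i
      by_cases hi : i = k
      · rw [hi, h]
      · exact hoff i hi
    · right; ext i
      by_cases hi : i = k
      · rw [hi, h]; rfl
      · rw [hoff i hi, Pi.add_apply, hk' i hi, add_zero]
  have hdk : (d k : ℝ) ≠ 0 := by
    have : d k ≠ 0 := by intro h; rw [h] at hk; simp at hk
    exact_mod_cast this
  have hud : u + d ≠ u := by
    intro h
    have := congrFun h k
    simp at this
    rw [this] at hdk; simp at hdk
  classical
  set B : ℝ := ∑ j, lam j * (if y j = u then 0 else 1) with hB
  have hA : ∑ j, lam j * (if y j = u then 1 else 0) = 1 - B := by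
    rw [hB, eq_sub_iff_add_eq, ← Finset.sum_add_distrib]
    refine Eq.trans (Finset.sum_congr rfl (fun j _ => ?_)) g1
    split_ifs <;> ring
  have hBθ : B = θ := by
    have e := g3 k
    rw [hx] at e
    have : ∑ j, lam j * ((y j k : ℝ)) = ∑ j, lam j * u k + B * d k := by
      rw [hB, Finset.sum_mul, ← Finset.sum_add_distrib]
      refine Finset.sum_congr rfl (fun j _ => ?_)
      rcases key j with h | h
      · rw [h]; simp
      · rw [h]; simp [hud]; ring
    rw [this, ← Finset.sum_mul, g1] at e
    have : B * (d k : ℝ) = θ * d k := by linarith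
    exact mul_right_cancel₀ hdk this
  rw [hBθ] at hA
  refine ⟨?_, ?_, ?_⟩
  · have : ∃ j ∈ Finset.univ, lam j * (if y j = u then (1 : ℝ) else 0) ≠ 0 :=
      Finset.exists_ne_zero_of_sum_ne_zero (by rw [hA]; linarith)
    obtain ⟨j, -, hj⟩ := this
    by_cases hy : y j = u
    · rw [← hy]; exact g4 j (left_ne_zero_of_mul hj)
    · simp [hy] at hj
  · intro hθ
    have : ∃ j ∈ Finset.univ, lam j * (if y j = u then (0 : ℝ) else 1) ≠ 0 :=
      Finset.exists_ne_zero_of_sum_ne_zero (by rw [← hB, hBθ]; linarith)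
    obtain ⟨j, -, hj⟩ := this
    by_cases hy : y j = u
    · simp [hy] at hj
    · rw [← (key j).resolve_left hy]; exact g4 j (left_ne_zero_of_mul hj)
  · refine le_trans (le_of_eq ?_) g5
    rw [← hA, ← hBθ, hB, Finset.sum_mul, Finset.sum_mul, ← Finset.sum_add_distrib]
    refine Finset.sum_congr rfl (fun j _ => ?_)
    rcases key j with h | h
    · rw [h]; simp
    · rw [h]; simp [hud]

/-- Edge version of convexity along a segment, without `ε`. -/
lemma seg_edge {f : (Fin 2 → ℤ) → EReal} (hbot : ∀ x, f x ≠ ⊥) (hf : IsIntegrallyConvexFn f)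
    {z w u d : Fin 2 → ℤ} (hz : f z ≠ ⊤) (hw : f w ≠ ⊤) {t : ℝ} (h0 : 0 ≤ t) (h1 : t ≤ 1)
    (hd : IsAxis d) {θ : ℝ} (k0 : 0 ≤ θ) (k1 : θ < 1)
    (hx : ∀ i, t * (z i : ℝ) + (1 - t) * (w i : ℝ) = u i + θ * d i) :
    f u ≠ ⊤ ∧ (0 < θ → f (u + d) ≠ ⊤) ∧
      (1 - θ) * (f u).toReal + θ * (f (u + d)).toReal ≤
        t * (f z).toReal + (1 - t) * (f w).toReal := by
  have A := fun (ε : ℝ) (hε : 0 < ε) =>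
    rep_edge hd k0 k1 hx (rep_segment hbot hf hz hw h0 h1 hε)
  exact ⟨(A 1 one_pos).1, (A 1 one_pos).2.1, le_of_forall_pos_le_add (fun ε hε => (A ε hε).2.2)⟩

lemma isAxis_neg {d : Fin 2 → ℤ} (hd : IsAxis d) : IsAxis (-d) := by
  obtain ⟨j, h1, h2⟩ := hd
  exact ⟨j, by simpa using h1, fun k hk => by simpa using h2 k hk⟩

/-- One-dimensional step. -/
lemma step_line {f : (Fin 2 → ℤ) → EReal} (hbot : ∀ x, f x ≠ ⊥) (hf : IsIntegrallyConvexFn f)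
    {z w u v : Fin 2 → ℤ} (hz : f z ≠ ⊤) (hw : f w ≠ ⊤) {K : ℕ} (hK : 1 ≤ K)
    {e : Fin 2 → ℤ}
    (hwz : ∀ i, w i = z i + K * e i) (hu : ∀ i, u i = z i + e i) (hv : ∀ i, v i = w i - e i) :
    f u ≠ ⊤ ∧ f v ≠ ⊤ ∧ (f u).toReal + (f v).toReal ≤ (f z).toReal + (f w).toReal := by
  have hK' : (1 : ℝ) ≤ K := by exact_mod_cast hK
  have hK0 : (K : ℝ) ≠ 0 := by positivity
  have hax : IsAxis (fun i => if i = 0 then 1 else 0) := ⟨0, by simp, by simp⟩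
  have i0 : (0 : ℝ) ≤ 1 / K := by positivity
  have i1 : (1 : ℝ) / K ≤ 1 := by rw [div_le_one (by linarith)]; exact hK'
  have A := seg_edge hbot hf (u := u) hz hw (t := 1 - 1 / K) (by linarith) (by linarith) hax
    (θ := 0) le_rfl one_pos (by
      intro i; rw [hu, hwz]; push_cast; field_simp; ring)
  have B := seg_edge hbot hf (u := v) hz hw (t := 1 / K) (by linarith) (by linarith) hax
    (θ := 0) le_rfl one_pos (by
      intro i; rw [hv, hwz]; push_cast; field_simp; ring)
  refine ⟨A.1, B.1, ?_⟩
  have a := A.2.2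
  have b := B.2.2
  linarith

/-- The basic two-dimensional step. -/
lemma step_two {f : (Fin 2 → ℤ) → EReal} (hbot : ∀ x, f x ≠ ⊥) (hf : IsIntegrallyConvexFn f)
    {z w e d : Fin 2 → ℤ} (hd : IsAxis d) (hz : f z ≠ ⊤) (hw : f w ≠ ⊤) {K L : ℕ} (hK : 1 ≤ K)
    (hL : 1 ≤ L) (hwz : ∀ i, w i = z i + K * e i + L * (e i + d i)) :
    f (z + e) ≠ ⊤ ∧ f (w - e) ≠ ⊤ ∧ f (z + e + d) ≠ ⊤ ∧ f (w - e - d) ≠ ⊤ ∧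
    ((K : ℝ) / (K + L)) * ((f (z + e)).toReal + (f (w - e)).toReal) +
      ((L : ℝ) / (K + L)) * ((f (z + e + d)).toReal + (f (w - e - d)).toReal) ≤
      (f z).toReal + (f w).toReal := by
  have hK' : (1 : ℝ) ≤ K := by exact_mod_cast hK
  have hL' : (1 : ℝ) ≤ L := by exact_mod_cast hL
  have hN : (0 : ℝ) < K + L := by linarith
  have hN0 : (K + L : ℝ) ≠ 0 := hN.ne'
  have i0 : (0 : ℝ) ≤ 1 / (K + L) := by positivity
  have i1 : (1 : ℝ) / (K + L) ≤ 1 := by rw [div_le_one hN]; linarith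
  have j0 : (0 : ℝ) < L / (K + L) := by positivity
  have j1 : (L : ℝ) / (K + L) < 1 := by rw [div_lt_one hN]; linarith
  have j2 : (K : ℝ) / (K + L) = 1 - L / (K + L) := by field_simp; ring
  have A := seg_edge hbot hf (u := z + e) hz hw (t := 1 - 1 / (K + L)) (by linarith) (by linarith) hd
    (θ := L / (K + L)) j0.le j1 (by
      intro i; rw [hwz]; push_cast [Pi.add_apply]; field_simp; ring)
  have B := seg_edge hbot hf (u := w - e) hz hw (t := 1 / (K + L)) (by linarith) (by linarith)
    (isAxis_neg hd) (θ := L / (K + L)) j0.le j1 (by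
      intro i; rw [Pi.sub_apply, hwz]; push_cast [Pi.neg_apply]; field_simp; ring)
  rw [← sub_eq_add_neg] at B
  refine ⟨A.1, B.1, A.2.1 j0, B.2.1 j0, ?_⟩
  rw [j2]
  have a := A.2.2
  have b := B.2.2
  linarith

/-- Parallelogram inequality. -/
lemma parallelogram {f : (Fin 2 → ℤ) → EReal} (hbot : ∀ x, f x ≠ ⊥) (hf : IsIntegrallyConvexFn f)
    {e d : Fin 2 → ℤ} (hd : IsAxis d) (n : ℕ) : ∀ (K L : ℕ), K + L = n → 1 ≤ K → 1 ≤ L →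
    ∀ (z w u v : Fin 2 → ℤ), f z ≠ ⊤ → f w ≠ ⊤ →
    (∀ i, w i = z i + K * e i + L * (e i + d i)) → (∀ i, u i = z i + K * e i) →
    (∀ i, v i = z i + L * (e i + d i)) →
    f u ≠ ⊤ ∧ f v ≠ ⊤ ∧ (f u).toReal + (f v).toReal ≤ (f z).toReal + (f w).toReal := by
  induction n using Nat.strong_induction_on with
  | _ n ih =>
  intro K L hn hK hL z w u v hz hw hwz hu hv
  have S := step_two hbot hf hd hz hw hK hL hwz
  obtain ⟨s1, s2, s3, s4, s5⟩ := S
  by_cases hK2 : 2 ≤ K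
  · obtain ⟨k, rfl⟩ : ∃ k, K = k + 1 := ⟨K - 1, by omega⟩
    obtain ⟨p1, p2, p3⟩ := ih (k + L) (by omega) k L rfl (by omega) hL z (w - e)
      (u - e) v hz s2 (by intro i; rw [Pi.sub_apply, hwz]; push_cast; ring)
      (by intro i; rw [Pi.sub_apply, hu]; push_cast; ring) hv
    obtain ⟨q1, q2, q3⟩ := ih (1 + L) (by omega) 1 L rfl le_rfl hL (u - e) w
      u (w - e) p1 hw (by intro i; rw [Pi.sub_apply, hwz, hu]; push_cast; ring)
      (by intro i; rw [Pi.sub_apply]; push_cast; ring)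
      (by intro i; rw [Pi.sub_apply, Pi.sub_apply, hwz, hu]; push_cast; ring)
    exact ⟨q1, p2, by linarith⟩
  by_cases hL2 : 2 ≤ L
  · obtain ⟨l, rfl⟩ : ∃ l, L = l + 1 := ⟨L - 1, by omega⟩
    obtain ⟨p1, p2, p3⟩ := ih (K + l) (by omega) K l rfl hK (by omega) z (w - e - d)
      u (v - e - d) hz s4 (by intro i; rw [Pi.sub_apply, Pi.sub_apply, hwz]; push_cast; ring)
      hu (by intro i; rw [Pi.sub_apply, Pi.sub_apply, hv]; push_cast; ring)
    obtain ⟨q1, q2, q3⟩ := ih (K + 1) (by omega) K 1 rfl hK le_rfl (v - e - d) w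
      (w - e - d) v p2 hw (by intro i; rw [Pi.sub_apply, Pi.sub_apply, hwz, hv]; push_cast; ring)
      (by intro i; rw [Pi.sub_apply, Pi.sub_apply, Pi.sub_apply, Pi.sub_apply, hwz, hv]; push_cast; ring)
      (by intro i; rw [Pi.sub_apply, Pi.sub_apply]; push_cast; ring)
    exact ⟨p1, q2, by linarith⟩
  obtain rfl : K = 1 := by omega
  obtain rfl : L = 1 := by omega
  have hu' : z + e = u := by ext i; rw [hu]; simp
  have hu2 : w - e - d = u := by
    ext i; rw [Pi.sub_apply, Pi.sub_apply, hwz, hu]; push_cast; ring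
  have hv' : w - e = v := by ext i; rw [Pi.sub_apply, hwz, hv]; push_cast; ring
  have hv2 : z + e + d = v := by ext i; rw [hv]; simp; ring
  rw [hv2, hu2, hu', hv'] at s5
  rw [hu'] at s1
  rw [hv'] at s2
  refine ⟨s1, s2, ?_⟩
  norm_num at s5
  linarith

/-- The swap property: far apart pairs can be brought closer without raising the cost. -/
def SwapProp (g : (Fin 2 → ℤ) → EReal) : Prop :=
  ∀ z w : Fin 2 → ℤ, g z ≠ ⊤ → g w ≠ ⊤ → (∃ i, 2 ≤ |w i - z i|) →
    ∃ u v : Fin 2 → ℤ, g u ≠ ⊤ ∧ g v ≠ ⊤ ∧ (∀ i, u i + v i = z i + w i) ∧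
      (∀ i, min (z i) (w i) ≤ u i ∧ u i ≤ max (z i) (w i)) ∧
      (∀ i, min (z i) (w i) ≤ v i ∧ v i ≤ max (z i) (w i)) ∧
      (g u).toReal + (g v).toReal ≤ (g z).toReal + (g w).toReal ∧
      ∑ k, (u k ^ 2 + v k ^ 2) < ∑ k, (z k ^ 2 + w k ^ 2)

lemma swap_core {f : (Fin 2 → ℤ) → EReal} (hbot : ∀ x, f x ≠ ⊥) (hf : IsIntegrallyConvexFn f)
    (α : ℕ) (hα : 0 < α) (z w : Fin 2 → ℤ) (i j : Fin 2) (hij : i ≠ j)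
    (hz : f (fun k => (α : ℤ) * z k) ≠ ⊤) (hw : f (fun k => (α : ℤ) * w k) ≠ ⊤)
    (K L : ℕ) (hKL : 2 ≤ K + L) (s t : ℤ) (hs : s = 1 ∨ s = -1) (ht : t = 1 ∨ t = -1)
    (hi : w i = z i + (K + L) * s) (hj : w j = z j + L * t) :
    ∃ u v : Fin 2 → ℤ, f (fun k => (α : ℤ) * u k) ≠ ⊤ ∧ f (fun k => (α : ℤ) * v k) ≠ ⊤ ∧
      (∀ i, u i + v i = z i + w i) ∧
      (∀ i, min (z i) (w i) ≤ u i ∧ u i ≤ max (z i) (w i)) ∧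
      (∀ i, min (z i) (w i) ≤ v i ∧ v i ≤ max (z i) (w i)) ∧
      (f (fun k => (α : ℤ) * u k)).toReal + (f (fun k => (α : ℤ) * v k)).toReal ≤
        (f (fun k => (α : ℤ) * z k)).toReal + (f (fun k => (α : ℤ) * w k)).toReal ∧
      ∑ k, (u k ^ 2 + v k ^ 2) < ∑ k, (z k ^ 2 + w k ^ 2) := by
  have hcase : ∀ k : Fin 2, k = i ∨ k = j := by intro k; omega
  have hall : ∀ P : Fin 2 → Prop, P i → P j → ∀ k, P k := by
    intro P h1 h2 k
    rcases hcase k with rfl | rfl <;> assumption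
  have hsum : ∀ F : Fin 2 → ℤ, ∑ k, F k = F i + F j := by
    intro F
    have : (Finset.univ : Finset (Fin 2)) = {i, j} := by
      ext k; simpa using hcase k
    rw [this, Finset.sum_pair hij]
  have hji : j ≠ i := hij.symm
  set e : Fin 2 → ℤ := fun k => if k = i then s else 0 with he
  set d : Fin 2 → ℤ := fun k => if k = j then t else 0 with hd'
  have ei : e i = s := by simp [he]
  have ej : e j = 0 := by simp [he, hji]
  have di : d i = 0 := by simp [hd', hij]
  have dj : d j = t := by simp [hd']
  have hd : IsAxis d := by
    refine ⟨j, ?_, ?_⟩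
    · rw [dj]; rcases ht with rfl | rfl <;> simp
    · intro k hk; simp [hd', hk]
  have hwz : ∀ k, w k = z k + K * e k + L * (e k + d k) := by
    apply hall
    · rw [hi, ei, di]; ring
    · rw [hj, ej, dj]; ring
  rcases Nat.eq_zero_or_pos L with hL | hL
  · subst hL
    have hK : 2 ≤ K := by omega
    obtain ⟨p1, p2, p3⟩ := step_line hbot hf (u := fun k => (α : ℤ) * (z k + e k))
      (v := fun k => (α : ℤ) * (w k - e k)) (e := fun k => α * e k) (K := K) hz hw (by omega)
      (by intro k; simp only [hwz]; push_cast; ring) (by intro k; ring) (by intro k; ring)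
    refine ⟨fun k => z k + e k, fun k => w k - e k, p1, p2, by intro k; ring, ?_, ?_, p3, ?_⟩
    · apply hall
      · simp only [hi, ei]; rcases hs with rfl | rfl <;> push_cast <;> omega
      · simp only [hj, ej]; simp
    · apply hall
      · simp only [hi, ei]; rcases hs with rfl | rfl <;> push_cast <;> omega
      · simp only [hj, ej]; simp
    · simp only [hsum, hi, hj, ei, ej]
      have : (2 : ℤ) ≤ K := by exact_mod_cast hK
      rcases hs with rfl | rfl <;> push_cast <;> nlinarith
  rcases Nat.eq_zero_or_pos K with hK | hK
  · subst hK
    have hL2 : 2 ≤ L := by omega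
    obtain ⟨p1, p2, p3⟩ := step_line hbot hf (u := fun k => (α : ℤ) * (z k + (e k + d k)))
      (v := fun k => (α : ℤ) * (w k - (e k + d k))) (e := fun k => α * (e k + d k)) (K := L)
      hz hw (by omega)
      (by intro k; simp only [hwz]; push_cast; ring) (by intro k; ring) (by intro k; ring)
    refine ⟨fun k => z k + (e k + d k), fun k => w k - (e k + d k), p1, p2, by intro k; ring,
      ?_, ?_, p3, ?_⟩
    · apply hall
      · simp only [hi, ei, di]; rcases hs with rfl | rfl <;> push_cast <;> omega
      · simp only [hj, ej, dj]; rcases ht with rfl | rfl <;> push_cast <;> omega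
    · apply hall
      · simp only [hi, ei, di]; rcases hs with rfl | rfl <;> push_cast <;> omega
      · simp only [hj, ej, dj]; rcases ht with rfl | rfl <;> push_cast <;> omega
    · simp only [hsum, hi, hj, ei, ej, di, dj]
      have : (2 : ℤ) ≤ L := by exact_mod_cast hL2
      rcases hs with rfl | rfl <;> rcases ht with rfl | rfl <;> push_cast <;> nlinarith
  · obtain ⟨p1, p2, p3⟩ := parallelogram hbot hf (e := e) hd (α * K + α * L) (α * K) (α * L) rfl
      (Nat.mul_pos hα hK) (Nat.mul_pos hα hL) _ _ (fun k => (α : ℤ) * (z k + K * e k))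
      (fun k => (α : ℤ) * (z k + L * (e k + d k))) hz hw
      (by intro k; simp only [hwz]; push_cast; ring)
      (by intro k; push_cast; ring) (by intro k; push_cast; ring)
    refine ⟨fun k => z k + K * e k, fun k => z k + L * (e k + d k), p1, p2,
      by intro k; rw [hwz k]; ring, ?_, ?_, p3, ?_⟩
    · apply hall
      · simp only [hi, ei]; rcases hs with rfl | rfl <;> push_cast <;> omega
      · simp only [hj, ej]; simp
    · apply hall
      · simp only [hi, ei, di]; rcases hs with rfl | rfl <;> push_cast <;> omega
      · simp only [hj, ej, dj]; simp
    · simp only [hsum, hi, hj, ei, ej, di, dj]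
      have : (0 : ℤ) < K * L := by exact_mod_cast Nat.mul_pos hK hL
      rcases hs with rfl | rfl <;> push_cast <;> nlinarith

lemma sign_aux (a : ℤ) : ∃ s : ℤ, (s = 1 ∨ s = -1) ∧ a = (a.natAbs : ℤ) * s := by
  rcases le_total 0 a with h | h
  · exact ⟨1, Or.inl rfl, by omega⟩
  · exact ⟨-1, Or.inr rfl, by omega⟩

lemma swap_scaled {f : (Fin 2 → ℤ) → EReal} (hbot : ∀ x, f x ≠ ⊥) (hf : IsIntegrallyConvexFn f)
    (α : ℕ) (hα : 0 < α) : SwapProp (fun x : Fin 2 → ℤ => f (fun i => (α : ℤ) * x i)) := by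
  intro z w hz hw ⟨k, hk⟩
  have : ∃ i j : Fin 2, i ≠ j ∧ (w j - z j).natAbs ≤ (w i - z i).natAbs := by
    rcases le_total (w 1 - z 1).natAbs (w 0 - z 0).natAbs with h | h
    · exact ⟨0, 1, by decide, h⟩
    · exact ⟨1, 0, by decide, h⟩
  obtain ⟨i, j, hij, hle⟩ := this
  have h2 : 2 ≤ (w i - z i).natAbs := by
    rw [Int.abs_eq_natAbs] at hk
    have : k = i ∨ k = j := by omega
    rcases this with rfl | rfl <;> omega
  obtain ⟨s, hs, hs'⟩ := sign_aux (w i - z i)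
  obtain ⟨t, ht, ht'⟩ := sign_aux (w j - z j)
  obtain ⟨K, hK⟩ := Nat.exists_eq_add_of_le' hle
  refine swap_core hbot hf α hα z w i j hij hz hw K (w j - z j).natAbs (by omega) s t hs ht ?_ ?_
  · have : ((K : ℤ) + ((w j - z j).natAbs : ℤ)) = ((w i - z i).natAbs : ℤ) := by rw [hK]; push_cast; ring
    rw [this]; linarith
  · linarith

/-- Any finite convex representation can be made local. -/
lemma reduce {g : (Fin 2 → ℤ) → EReal} (hs : SwapProp g) {ι : Type} [Fintype ι]
    (lam : ι → ℝ) (Y : ι → (Fin 2 → ℤ)) (x : Fin 2 → ℝ) (c : ℝ)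
    (h0 : ∀ k, 0 ≤ lam k) (h1 : ∑ k, lam k = 1)
    (h2 : ∀ i, ∑ k, lam k * (Y k i : ℝ) = x i) (h3 : ∀ k, lam k ≠ 0 → g (Y k) ≠ ⊤)
    (h4 : ∑ k, lam k * (g (Y k)).toReal ≤ c) : ICRep g x c := by
  classical
  set hi : Fin 2 → ℤ := fun i => ∑ k, |Y k i| with hhi
  set B : Finset (Fin 2 → ℤ) := (Finset.Icc (-hi) hi).filter (fun z => g z ≠ ⊤) with hB
  have hYB : ∀ k, lam k ≠ 0 → Y k ∈ B := by
    intro k hk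
    rw [hB, Finset.mem_filter, Finset.mem_Icc]
    have hb : ∀ i, |Y k i| ≤ hi i := fun i =>
      Finset.single_le_sum (f := fun k => |Y k i|) (fun _ _ => abs_nonneg _) (Finset.mem_univ k)
    exact ⟨⟨fun i => (abs_le.1 (hb i)).1, fun i => (abs_le.1 (hb i)).2⟩, h3 k hk⟩
  set S : Set ((Fin 2 → ℤ) → ℝ) := {μ | (∀ z, 0 ≤ μ z) ∧ (∀ z, z ∉ B → μ z = 0) ∧
    ∑ z ∈ B, μ z * 1 = 1 ∧ (∀ i, ∑ z ∈ B, μ z * (z i : ℝ) = x i) ∧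
    ∑ z ∈ B, μ z * (g z).toReal ≤ c} with hS
  have hScl : IsClosed S := by
    simp only [hS, Set.ofPred_and, Set.ofPred_forall]
    refine IsClosed.inter ?_ (IsClosed.inter ?_ (IsClosed.inter ?_ (IsClosed.inter ?_ ?_)))
    · exact isClosed_iInter fun z => isClosed_le continuous_const (continuous_apply z)
    · exact isClosed_iInter fun z => isClosed_iInter fun _ =>
        isClosed_eq (continuous_apply z) continuous_const
    · exact isClosed_eq (by fun_prop) continuous_const
    · exact isClosed_iInter fun i => isClosed_eq (by fun_prop) continuous_const
    · exact isClosed_le (by fun_prop) continuous_const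
  have hSc : IsCompact S := by
    refine IsCompact.of_isClosed_subset
      (isCompact_univ_pi (s := fun _ : Fin 2 → ℤ => Set.Icc (0 : ℝ) 1) fun _ => isCompact_Icc) hScl ?_
    rintro μ ⟨a, b, e, -, -⟩ z -
    refine ⟨a z, ?_⟩
    by_cases hz : z ∈ B
    · rw [← e]
      simp only [mul_one]
      exact Finset.single_le_sum (fun z _ => a z) hz
    · rw [b z hz]; exact zero_le_one
  have hne : S.Nonempty := by
    set μ : (Fin 2 → ℤ) → ℝ := fun z => ∑ k, if Y k = z then lam k else 0 with hμ
    have key : ∀ ψ : (Fin 2 → ℤ) → ℝ, ∑ z ∈ B, μ z * ψ z = ∑ k, lam k * ψ (Y k) := by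
      intro ψ
      simp only [hμ, Finset.sum_mul]
      rw [Finset.sum_comm]
      refine Finset.sum_congr rfl fun k _ => ?_
      by_cases hk : lam k = 0
      · simp [hk]
      · rw [Finset.sum_eq_single (Y k)]
        · simp
        · intro z _ hz; rw [if_neg (Ne.symm hz)]; simp
        · intro h; exact absurd (hYB k hk) h
    refine ⟨μ, ?_, ?_, ?_, ?_, ?_⟩
    · intro z
      refine Finset.sum_nonneg fun k _ => ?_
      split_ifs
      · exact h0 k
      · exact le_rfl
    · intro z hz
      refine Finset.sum_eq_zero fun k _ => ?_
      split_ifs with h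
      · by_contra hk
        exact hz (h ▸ hYB k hk)
      · rfl
    · rw [key (fun _ => 1)]; simpa using h1
    · intro i; rw [key (fun z => (z i : ℝ))]; exact h2 i
    · rw [key (fun z => (g z).toReal)]; exact h4
  obtain ⟨μ, hμS, hmin⟩ := hSc.exists_isMinOn hne
    (f := fun μ => ∑ z ∈ B, μ z * ((∑ k, z k ^ 2 : ℤ) : ℝ)) (by fun_prop)
  obtain ⟨m0, m1, m2, m3, m4⟩ := hμS
  have hBm : ∀ z, μ z ≠ 0 → z ∈ B := fun z hz => by
    by_contra h; exact hz (m1 z h)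
  have hclose : ∀ z w, μ z ≠ 0 → μ w ≠ 0 → ∀ i, |w i - z i| ≤ 1 := by
    intro z w hz hw i
    by_contra hcon
    have hzB := hBm z hz
    have hwB := hBm w hw
    have hzB' := hzB
    have hwB' := hwB
    rw [hB, Finset.mem_filter, Finset.mem_Icc] at hzB' hwB'
    obtain ⟨u, v, gu, gv, q1, q2, q3, q4, q5⟩ := hs z w hzB'.2 hwB'.2 ⟨i, by omega⟩
    have huB : u ∈ B := by
      rw [hB, Finset.mem_filter, Finset.mem_Icc]
      exact ⟨⟨fun k => le_trans (le_min (hzB'.1.1 k) (hwB'.1.1 k)) (q2 k).1,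
        fun k => le_trans (q2 k).2 (max_le (hzB'.1.2 k) (hwB'.1.2 k))⟩, gu⟩
    have hvB : v ∈ B := by
      rw [hB, Finset.mem_filter, Finset.mem_Icc]
      exact ⟨⟨fun k => le_trans (le_min (hzB'.1.1 k) (hwB'.1.1 k)) (q3 k).1,
        fun k => le_trans (q3 k).2 (max_le (hzB'.1.2 k) (hwB'.1.2 k))⟩, gv⟩
    have hzw : z ≠ w := by
      rintro rfl; simp at hcon
    set ε : ℝ := min (μ z) (μ w) with hε
    have hεpos : 0 < ε := lt_min (lt_of_le_of_ne (m0 z) (Ne.symm hz)) (lt_of_le_of_ne (m0 w) (Ne.symm hw))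
    have hεz : ε ≤ μ z := min_le_left _ _
    have hεw : ε ≤ μ w := min_le_right _ _
    set ν : (Fin 2 → ℤ) → ℝ := fun a => μ a + ε * ((if a = u then 1 else 0) +
      (if a = v then 1 else 0) - (if a = z then 1 else 0) - (if a = w then 1 else 0)) with hν
    have key : ∀ ψ : (Fin 2 → ℤ) → ℝ, ∑ a ∈ B, ν a * ψ a =
        ∑ a ∈ B, μ a * ψ a + ε * (ψ u + ψ v - ψ z - ψ w) := by
      intro ψ
      have one : ∀ p ∈ B, ∑ a ∈ B, (if a = p then (1 : ℝ) else 0) * ψ a = ψ p := by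
        intro p hp; simp [hp]
      rw [← one u huB, ← one v hvB, ← one z hzB, ← one w hwB, ← Finset.sum_add_distrib,
        ← Finset.sum_sub_distrib, ← Finset.sum_sub_distrib, Finset.mul_sum, ← Finset.sum_add_distrib]
      refine Finset.sum_congr rfl fun a _ => ?_
      simp only [hν]; ring
    have hνS : ν ∈ S := by
      refine ⟨?_, ?_, ?_, ?_, ?_⟩
      · intro a
        have i1 : (0 : ℝ) ≤ if a = u then 1 else 0 := by split_ifs <;> norm_num
        have i2 : (0 : ℝ) ≤ if a = v then 1 else 0 := by split_ifs <;> norm_num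
        have i3 : 0 ≤ μ a - ε * (if a = z then 1 else 0) - ε * (if a = w then 1 else 0) := by
          by_cases haz : a = z
          · have : a ≠ w := fun h => hzw (haz ▸ h)
            rw [if_pos haz, if_neg this, haz]; linarith
          · by_cases haw : a = w
            · rw [if_neg haz, if_pos haw, haw]; linarith
            · rw [if_neg haz, if_neg haw]; linarith [m0 a]
        simp only [hν]
        nlinarith [mul_nonneg hεpos.le i1, mul_nonneg hεpos.le i2]
      · intro a ha
        have : ∀ p ∈ B, a ≠ p := fun p hp h => ha (h ▸ hp)
        simp [hν, m1 a ha, this u huB, this v hvB, this z hzB, this w hwB]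
      · rw [key (fun _ => 1), m2]; ring
      · intro k
        rw [key (fun a => (a k : ℝ)), m3]
        have : (u k : ℝ) + v k = z k + w k := by exact_mod_cast q1 k
        rw [this]; ring
      · rw [key (fun a => (g a).toReal)]
        nlinarith
    have hm := isMinOn_iff.1 hmin ν hνS
    rw [key (fun a => ((∑ k, a k ^ 2 : ℤ) : ℝ))] at hm
    rw [Finset.sum_add_distrib, Finset.sum_add_distrib] at q5
    have q6 : ((∑ k, u k ^ 2 : ℤ) : ℝ) + ((∑ k, v k ^ 2 : ℤ) : ℝ) <
      ((∑ k, z k ^ 2 : ℤ) : ℝ) + ((∑ k, w k ^ 2 : ℤ) : ℝ) := by exact_mod_cast q5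
    nlinarith
  set B' := B.filter (fun z => μ z ≠ 0) with hB'
  have hsumB : ∀ ψ : (Fin 2 → ℤ) → ℝ, ∑ j, μ (B'.equivFin.symm j).1 * ψ (B'.equivFin.symm j).1
      = ∑ z ∈ B, μ z * ψ z := by
    intro ψ
    rw [Equiv.sum_comp B'.equivFin.symm (fun z : B' => μ z.1 * ψ z.1),
      Finset.sum_coe_sort B' (fun z => μ z * ψ z), hB']
    refine Finset.sum_filter_of_ne fun z _ hz => left_ne_zero_of_mul hz
  refine ⟨B'.card, fun j => μ (B'.equivFin.symm j).1, fun j => (B'.equivFin.symm j).1,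
    fun j => m0 _, ?_, ?_, ?_, ?_, ?_⟩
  · have := hsumB (fun _ => 1)
    rw [m2] at this
    simpa using this
  · intro j
    have hj := (B'.equivFin.symm j).2
    set z : Fin 2 → ℤ := (B'.equivFin.symm j).1
    rw [hB', Finset.mem_filter] at hj
    intro i
    have e1 : x i - z i = ∑ w ∈ B, μ w * ((w i : ℝ) - z i) := by
      simp only [mul_sub, Finset.sum_sub_distrib]
      rw [m3, ← Finset.sum_mul]
      simp only [mul_one] at m2
      rw [m2]; ring
    have e2 : |x i - z i| ≤ ∑ w ∈ B, (μ w * 1 - (if w = z then μ w else 0)) := by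
      rw [e1]
      refine le_trans (Finset.abs_sum_le_sum_abs _ _) (Finset.sum_le_sum fun w _ => ?_)
      by_cases hwz : w = z
      · simp [hwz]
      · rw [if_neg hwz, sub_zero, abs_mul, abs_of_nonneg (m0 w)]
        by_cases hw : μ w = 0
        · simp [hw]
        · refine mul_le_mul_of_nonneg_left ?_ (m0 w)
          exact_mod_cast hclose z w hj.2 hw i
    rw [Finset.sum_sub_distrib, m2, Finset.sum_ite_eq' B z, if_pos hj.1] at e2
    have := lt_of_le_of_ne (m0 z) (Ne.symm hj.2)
    linarith
  · intro i
    rw [hsumB (fun z => (z i : ℝ))]; exact m3 i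
  · intro j hj
    have := hBm _ hj
    rw [hB, Finset.mem_filter] at this
    exact this.2
  · rw [hsumB (fun z => (g z).toReal)]; exact m4

lemma localExt_ne_bot {g : (Fin 2 → ℤ) → EReal} (hbot : ∀ x, g x ≠ ⊥) (x : Fin 2 → ℝ) :
    localExt g x ≠ ⊥ := by
  intro hx
  set B : Finset (Fin 2 → ℤ) := Finset.Icc (fun i => ⌊x i⌋ - 1) (fun i => ⌈x i⌉ + 1) with hB
  set M : ℝ := ∑ z ∈ B, |(g z).toReal| with hM
  obtain ⟨m, lam, y, g0, g1, g2, g3, g4, g5⟩ :=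
    rep_of_lt hbot (x := x) (c := -M - 1) (by rw [hx]; exact EReal.bot_lt_coe _)
  have hy : ∀ j, -M ≤ (g (y j)).toReal := by
    intro j
    have hm : y j ∈ B := by
      rw [hB, Finset.mem_Icc]
      refine ⟨fun i => ?_, fun i => ?_⟩ <;> have := abs_lt.1 (g2 j i)
      · have h : ((⌊x i⌋ : ℤ) : ℝ) < ((y j i + 1 : ℤ) : ℝ) := by
          push_cast; linarith [Int.floor_le (x i)]
        have := Int.cast_lt.1 h
        show ⌊x i⌋ - 1 ≤ y j i
        omega
      · have h : ((y j i : ℤ) : ℝ) < ((⌈x i⌉ + 1 : ℤ) : ℝ) := by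
          push_cast; linarith [Int.le_ceil (x i)]
        exact (Int.cast_lt.1 h).le
    have := Finset.single_le_sum (f := fun z => |(g z).toReal|) (fun _ _ => abs_nonneg _) hm
    have := neg_abs_le (g (y j)).toReal
    linarith
  have : ∑ j, lam j * (-M) ≤ ∑ j, lam j * (g (y j)).toReal :=
    Finset.sum_le_sum fun j _ => mul_le_mul_of_nonneg_left (hy j) (g0 j)
  rw [← Finset.sum_mul, g1] at this
  linarith

lemma convex_of_swap {g : (Fin 2 → ℤ) → EReal} (hbot : ∀ x, g x ≠ ⊥) (hs : SwapProp g) :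
    IsIntegrallyConvexFn g := by
  intro x y t h0 h1
  rcases h0.eq_or_lt with rfl | h0
  · simp
  rcases h1.eq_or_lt with rfl | h1
  · simp
  have hx := localExt_ne_bot hbot x
  have hy := localExt_ne_bot hbot y
  have h1' : 0 < 1 - t := by linarith
  by_cases hxt : localExt g x = ⊤
  · rw [hxt, EReal.coe_mul_top_of_pos h0, EReal.top_add_of_ne_bot (mul_ne_bot_aux _ h1'.le _ hy)]
    exact le_top
  by_cases hyt : localExt g y = ⊤
  · rw [hyt, EReal.coe_mul_top_of_pos h1', EReal.add_top_of_ne_bot (mul_ne_bot_aux _ h0.le _ hx)]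
    exact le_top
  rw [← EReal.coe_toReal hxt hx, ← EReal.coe_toReal hyt hy]
  set a := (localExt g x).toReal with ha
  set b := (localExt g y).toReal with hb
  rw [← EReal.coe_mul, ← EReal.coe_mul, ← EReal.coe_add]
  refine EReal.le_of_forall_lt_iff_le.1 fun c hc => ?_
  rw [EReal.coe_lt_coe_iff] at hc
  set ε : ℝ := c - (t * a + (1 - t) * b) with hε
  have hεpos : 0 < ε := by linarith
  obtain ⟨m, lam, p, p0, p1, -, p3, p4, p5⟩ := rep_of_lt hbot (x := x) (c := a + ε)
    (by rw [← EReal.coe_toReal hxt hx, EReal.coe_lt_coe_iff]; linarith)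
  obtain ⟨m', lam', q, q0, q1, -, q3, q4, q5⟩ := rep_of_lt hbot (x := y) (c := b + ε)
    (by rw [← EReal.coe_toReal hyt hy, EReal.coe_lt_coe_iff]; linarith)
  apply le_of_rep hbot
  have key : ∀ ψ : (Fin 2 → ℤ) → ℝ,
      ∑ k, (Sum.elim (fun j => t * lam j) (fun j => (1 - t) * lam' j) k) * ψ (Sum.elim p q k) =
      t * ∑ j, lam j * ψ (p j) + (1 - t) * ∑ j, lam' j * ψ (q j) := by
    intro ψ
    rw [Fintype.sum_sum_type, Finset.mul_sum, Finset.mul_sum]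
    simp [mul_assoc]
  refine reduce hs (ι := Fin m ⊕ Fin m') (Sum.elim (fun j => t * lam j) (fun j => (1 - t) * lam' j))
    (Sum.elim p q) _ _ ?_ ?_ ?_ ?_ ?_
  · rintro (k | k)
    · exact mul_nonneg h0.le (p0 k)
    · exact mul_nonneg h1'.le (q0 k)
  · have := key (fun _ => 1)
    simp only [mul_one, p1, q1] at this
    rw [this]; ring
  · intro i
    rw [key (fun z => (z i : ℝ)), p3, q3]
  · rintro (k | k) hk
    · exact p4 k (right_ne_zero_of_mul hk)
    · exact q4 k (right_ne_zero_of_mul hk)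
  · rw [key (fun z => (g z).toReal)]
    nlinarith [mul_le_mul_of_nonneg_left p5 h0.le, mul_le_mul_of_nonneg_left q5 h1'.le]

/-- Scaling preserves integral convexity for n = 2. -/
theorem scaling_preserves_integral_convexity_dim2
    (f : (Fin 2 → ℤ) → EReal) (hbot : ∀ x, f x ≠ ⊥)
    (hf : IsIntegrallyConvexFn f) (α : ℕ) (hα : 0 < α) :
    IsIntegrallyConvexFn (fun x : Fin 2 → ℤ => f (fun i => (α : ℤ) * x i)) := by
  exact convex_of_swap (fun x => hbot _) (swap_scaled hbot hf α hα)
end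
end

section
/- Let f : ℤⁿ → ℝ ∪ {+∞} be integrally convex, α a positive integer, and x^α ∈ dom f with f(x^α) ≤ f(x^α + αd) for all d ∈ {−1,0,+1}ⁿ. Then, if f has bounded effective domain, argmin f is nonempty and there exists x* ∈ argmin f with ‖x^α − x*‖_∞ ≤ βₙ(α−1), where β₁=1, β₂=2, and βₙ = ((n+1)/2)·βₙ₋₁ + 1 for n ≥ 3. -/
open scoped BigOperators

noncomputable section

/-- The sequence β from the proximity theorem: β₁ = 1, β₂ = 2,
βₙ = ((n+1)/2)·βₙ₋₁ + 1 for n ≥ 3. -/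
noncomputable def beta : ℕ → ℝ
  | 0 => 0
  | 1 => 1
  | 2 => 2
  | (n + 3) => ((n + 4 : ℝ) / 2) * beta (n + 2) + 1


namespace ICProx

/-- Finite form of integral convexity: effective domain `D`, values `F`. -/
def IC {n : ℕ} (D : Finset (Fin n → ℤ)) (F : (Fin n → ℤ) → ℝ) : Prop :=
  ∀ p ∈ D, ∀ q ∈ D, ∀ t : ℝ, 0 ≤ t → t ≤ 1 → ∀ ε : ℝ, 0 < ε →
    ∃ w : (Fin n → ℤ) → ℝ, (∀ z ∈ D, 0 ≤ w z) ∧ (∑ z ∈ D, w z) = 1 ∧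
      (∀ z ∈ D, w z ≠ 0 → ∀ i, |t * (p i : ℝ) + (1 - t) * (q i : ℝ) - (z i : ℝ)| < 1) ∧
      (∀ i, ∑ z ∈ D, w z * (z i : ℝ) = t * (p i : ℝ) + (1 - t) * (q i : ℝ)) ∧
      ∑ z ∈ D, w z * F z < t * F p + (1 - t) * F q + ε

lemma IC.restrict {n : ℕ} {D : Finset (Fin n → ℤ)} {F : (Fin n → ℤ) → ℝ} (h : IC D F)
    (i : Fin n) : IC (D.filter (fun x => x i = 0)) F := by
  intro p hp q hq t h0 h1 ε hε
  rw [Finset.mem_filter] at hp hq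
  obtain ⟨w, hw0, hw1, hwn, hwb, hwF⟩ := h p hp.1 q hq.1 t h0 h1 ε hε
  have hz : ∀ z ∈ D, w z ≠ 0 → z i = 0 := by
    intro z hz hne
    have := hwn z hz hne i
    rw [hp.2, hq.2] at this
    simp only [Int.cast_zero, mul_zero, add_zero, zero_sub, abs_neg] at this
    have h3 : |z i| < 1 := by exact_mod_cast this
    exact Int.abs_lt_one_iff.1 h3
  have key : ∀ g : (Fin n → ℤ) → ℝ,
      ∑ z ∈ D.filter (fun x => x i = 0), w z * g z = ∑ z ∈ D, w z * g z := by
    intro g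
    apply Finset.sum_subset (Finset.filter_subset _ _)
    intro z hzD hzn
    by_cases hw : w z = 0
    · rw [hw, zero_mul]
    · exact absurd (Finset.mem_filter.2 ⟨hzD, hz z hzD hw⟩) hzn
  refine ⟨w, fun z hz => hw0 z (Finset.mem_filter.1 hz).1, ?_,
    fun z hz => hwn z (Finset.mem_filter.1 hz).1, ?_, ?_⟩
  · have := key (fun _ => 1)
    simpa [hw1] using this
  · intro j
    rw [key (fun z => (z j : ℝ))]
    exact hwb j
  · rw [key F]
    exact hwF

/-- One step between consecutive levels. -/
lemma IC.step {n : ℕ} {D : Finset (Fin n → ℤ)} {F : (Fin n → ℤ) → ℝ} (hIC : IC D F)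
    (i : Fin n) (s : ℤ) (hs : s = 1 ∨ s = -1) (z : Fin n → ℤ) (hz : z ∈ D)
    (hmin : ∀ x ∈ D, x i = z i → F z ≤ F x)
    (q : Fin n → ℤ) (hq : q ∈ D) (h : ℤ) (hh : 1 ≤ h) (hqi : q i - z i = s * h) (a : ℝ)
    (ha : ∀ p ∈ D, p i = z i + s → (∀ l, |p l - z l| ≤ 1) → a ≤ F p) :
    (h : ℝ) * (a - F z) ≤ F q - F z := by
  obtain ⟨l0, -, hl0⟩ := Finset.exists_max_image Finset.univ (fun l => |q l - z l|)
    ⟨i, Finset.mem_univ i⟩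
  set r : ℤ := |q l0 - z l0| with hr
  have hrl : ∀ l, |q l - z l| ≤ r := fun l => hl0 l (Finset.mem_univ l)
  have hhr : h ≤ r := by
    have := hrl i
    rw [hqi, abs_mul] at this
    have h1 : |s| = 1 := by rcases hs with rfl | rfl <;> simp
    rw [h1, one_mul] at this
    exact le_trans (le_abs_self h) this
  have hr1 : 1 ≤ r := le_trans hh hhr
  have hrR : (1 : ℝ) ≤ (r : ℝ) := by exact_mod_cast hr1
  have hrpos : (0 : ℝ) < r := by linarith
  apply le_of_forall_pos_le_add
  intro ε hε
  obtain ⟨w, hw0, hw1, hwn, hwb, hwF⟩ := hIC q hq z hz (1 / (r : ℝ)) (by positivity)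
    (by rw [div_le_one hrpos]; exact hrR) (ε / r) (by positivity)
  have hpt : ∀ l, (1 / (r : ℝ)) * (q l : ℝ) + (1 - 1 / (r : ℝ)) * (z l : ℝ)
      = (z l : ℝ) + ((q l : ℝ) - z l) / r := by
    intro l
    field_simp
    ring
  -- pointwise facts
  have hnear : ∀ p ∈ D, w p ≠ 0 → ∀ l, |p l - z l| ≤ 1 := by
    intro p hp hne l
    have h1 := hwn p hp hne l
    rw [hpt] at h1
    have h2 : |((q l : ℝ) - z l) / r| ≤ 1 := by
      rw [abs_div, abs_of_pos hrpos, div_le_one hrpos]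
      exact_mod_cast hrl l
    rw [abs_lt] at h1
    rw [abs_le] at h2
    have h3 : ((p l - z l : ℤ) : ℝ) < 2 := by push_cast; linarith
    have h4 : (-2 : ℝ) < ((p l - z l : ℤ) : ℝ) := by push_cast; linarith
    have h5 : p l - z l < 2 := by exact_mod_cast h3
    have h6 : -2 < p l - z l := by exact_mod_cast h4
    rw [abs_le]
    constructor <;> linarith
  have hsi : ((q i : ℝ) - z i) = s * h := by exact_mod_cast hqi
  have hhR : (1 : ℝ) ≤ h := by exact_mod_cast hh
  have hlev : ∀ p ∈ D, w p ≠ 0 → p i = z i ∨ p i = z i + s := by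
    intro p hp hne
    have h1 := hwn p hp hne i
    rw [hpt, hsi] at h1
    have h7 := abs_le.1 (hnear p hp hne i)
    have hp1 : 0 < (h : ℝ) / r := by positivity
    have hp2 : (h : ℝ) / r ≤ 1 := by
      rw [div_le_one hrpos]; exact_mod_cast hhr
    rw [abs_lt] at h1
    rw [mul_div_assoc] at h1
    rcases hs with rfl | rfl
    · push_cast at h1
      have h3 : (-1 : ℝ) < ((p i - z i : ℤ) : ℝ) := by push_cast; linarith
      have h4 : -1 < p i - z i := by exact_mod_cast h3
      omega
    · push_cast at h1
      have h3 : ((p i - z i : ℤ) : ℝ) < 1 := by push_cast; linarith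
      have h4 : p i - z i < 1 := by exact_mod_cast h3
      omega
  have hss : (s : ℝ) * s = 1 := by rcases hs with rfl | rfl <;> norm_num
  have hpw : ∀ p ∈ D, w p * (F z + (s * ((p i : ℝ) - z i)) * (a - F z)) ≤ w p * F p := by
    intro p hp
    by_cases hne : w p = 0
    · simp [hne]
    apply mul_le_mul_of_nonneg_left _ (hw0 p hp)
    rcases hlev p hp hne with h1 | h1
    · rw [h1]
      have := hmin p hp h1
      simpa using this
    · have h2 := ha p hp h1 (hnear p hp hne)
      rw [h1]
      push_cast
      have : (s : ℝ) * ((z i : ℝ) + s - z i) = 1 := by rw [add_sub_cancel_left]; exact hss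
      rw [this]
      linarith
  have hsum := Finset.sum_le_sum hpw
  have hL : ∑ p ∈ D, w p * (F z + (s * ((p i : ℝ) - z i)) * (a - F z))
      = F z + ((h : ℝ) / r) * (a - F z) := by
    have e1 : ∀ p ∈ D, w p * (F z + (s * ((p i : ℝ) - z i)) * (a - F z))
        = (F z - s * z i * (a - F z)) * w p + (s * (a - F z)) * (w p * (p i : ℝ)) := by
      intro p _
      ring
    rw [Finset.sum_congr rfl e1, Finset.sum_add_distrib, ← Finset.mul_sum, ← Finset.mul_sum,
      hw1, hwb i, hpt, hsi]
    have : (s : ℝ) * (a - F z) * (z i + s * h / r) =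
      s * z i * (a - F z) + (s * s) * (h / r) * (a - F z) := by ring
    rw [this, hss]
    ring
  rw [hL] at hsum
  have hfin : F z + ((h : ℝ) / r) * (a - F z)
      < 1 / (r : ℝ) * F q + (1 - 1 / (r : ℝ)) * F z + ε / r := lt_of_le_of_lt hsum hwF
  have := mul_lt_mul_of_pos_left hfin hrpos
  have e2 : (r : ℝ) * (F z + ((h : ℝ) / r) * (a - F z)) = r * F z + h * (a - F z) := by
    field_simp
  have e3 : (r : ℝ) * (1 / (r : ℝ) * F q + (1 - 1 / (r : ℝ)) * F z + ε / r)
      = F q + (r - 1) * F z + ε := by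
    field_simp
  rw [e2, e3] at this
  linarith

/-- Minimizers on successive levels can be chosen within distance one per level. -/
lemma IC.path {n : ℕ} {D : Finset (Fin n → ℤ)} {F : (Fin n → ℤ) → ℝ} (hIC : IC D F)
    (i : Fin n) (s : ℤ) (hs : s = 1 ∨ s = -1) (u : Fin n → ℤ) (hu : u ∈ D) (hui : u i = 0)
    (humin : ∀ x ∈ D, x i = 0 → F u ≤ F x)
    (y : Fin n → ℤ) (hy : y ∈ D) (m : ℕ) (hyi : y i = s * m) :
    ∀ j : ℕ, j ≤ m → ∃ z ∈ D, z i = s * j ∧ (∀ l, |z l - u l| ≤ j) ∧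
      ∀ x ∈ D, x i = s * j → F z ≤ F x := by
  intro j
  induction j with
  | zero =>
    intro _
    refine ⟨u, hu, by simp [hui], by simp, ?_⟩
    intro x hx hxi
    exact humin x hx (by simpa using hxi)
  | succ j ih =>
    intro hj
    obtain ⟨z, hz, hzi, hzu, hzmin⟩ := ih (by omega)
    have hmin : ∀ x ∈ D, x i = z i → F z ≤ F x := fun x hx hxi => hzmin x hx (by rw [hxi, hzi])
    let C := D.filter (fun p => p i = z i + s ∧ ∀ l, |p l - z l| ≤ 1)
    have hC : C.Nonempty := by
      by_contra hne
      rw [Finset.not_nonempty_iff_eq_empty] at hne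
      have h1 := hIC.step i s hs z hz hmin y hy (m - j) (by omega)
        (by rw [hyi, hzi]; ring) (F z + |F y - F z| + 1) (by
          intro p hp h1 h2
          have : p ∈ C := Finset.mem_filter.2 ⟨hp, h1, h2⟩
          rw [hne] at this
          simp at this)
      have h2 : (1 : ℝ) ≤ (((m : ℤ) - j : ℤ) : ℝ) := by
        have : (1 : ℤ) ≤ (m : ℤ) - j := by omega
        exact_mod_cast this
      have h3 := le_abs_self (F y - F z)
      have h4 := abs_nonneg (F y - F z)
      nlinarith
    obtain ⟨z', hz', hz'min⟩ := Finset.exists_min_image C F hC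
    have hz'C := Finset.mem_filter.1 hz'
    refine ⟨z', hz'C.1, ?_, ?_, ?_⟩
    · rw [hz'C.2.1, hzi]; push_cast; ring
    · intro l
      have h1 := hz'C.2.2 l
      have h2 := hzu l
      have : z' l - u l = (z' l - z l) + (z l - u l) := by ring
      rw [this]
      push_cast
      exact le_trans (abs_add_le _ _) (by linarith)
    · intro x hx hxi
      have h1 := hIC.step i s hs z hz hmin x hx 1 le_rfl
        (by rw [hxi, hzi]; push_cast; ring) (F z') (by
          intro p hp h1 h2
          exact hz'min p (Finset.mem_filter.2 ⟨hp, h1, h2⟩))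
      push_cast at h1
      linarith

/-- Finite regularization of `F` on `D`. -/
def reg {n : ℕ} (D : Finset (Fin n → ℤ)) (hD : D.Nonempty) (F : (Fin n → ℤ) → ℝ) (R : ℝ)
    (x : Fin n → ℤ) : ℝ :=
  D.inf' hD (fun z => F z + R * ∑ l, |(x l : ℝ) - z l|)

lemma reg_le {n : ℕ} (D : Finset (Fin n → ℤ)) (hD : D.Nonempty) (F : (Fin n → ℤ) → ℝ) (R : ℝ)
    (x z : Fin n → ℤ) (hz : z ∈ D) : reg D hD F R x ≤ F z + R * ∑ l, |(x l : ℝ) - z l| :=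
  Finset.inf'_le (fun z => F z + R * ∑ l, |(x l : ℝ) - z l|) hz

lemma reg_attained {n : ℕ} (D : Finset (Fin n → ℤ)) (hD : D.Nonempty) (F : (Fin n → ℤ) → ℝ)
    (R : ℝ) (x : Fin n → ℤ) :
    ∃ z ∈ D, reg D hD F R x = F z + R * ∑ l, |(x l : ℝ) - z l| :=
  Finset.exists_mem_eq_inf' hD (fun z => F z + R * ∑ l, |(x l : ℝ) - z l|)

/-- Coordinatewise computation: same-side case. -/
lemma coord_same (a b s Z : ℤ) (hab : |a - b| ≤ 1) (hs : |2 * s - Z| ≤ 1)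
    (h : a = b ∨ a + b ≠ Z) :
    |(a : ℝ) - s| = (SignType.sign (a + b - Z) : ℤ) * ((a : ℝ) - s) ∧
    |(b : ℝ) - s| = (SignType.sign (a + b - Z) : ℤ) * ((b : ℝ) - s) := by
  rw [abs_le] at hab hs
  rcases lt_trichotomy (a + b - Z) 0 with h1 | h1 | h1
  · have ha : a ≤ s := by omega
    have hb : b ≤ s := by omega
    have ha' : (a : ℝ) ≤ s := by exact_mod_cast ha
    have hb' : (b : ℝ) ≤ s := by exact_mod_cast hb
    rw [sign_neg h1, abs_of_nonpos (by linarith), abs_of_nonpos (by linarith)]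
    simp
  · have ha : a = s := by omega
    have hb : b = s := by omega
    subst ha hb
    simp
  · have ha : s ≤ a := by omega
    have hb : s ≤ b := by omega
    have ha' : (s : ℝ) ≤ a := by exact_mod_cast ha
    have hb' : (s : ℝ) ≤ b := by exact_mod_cast hb
    rw [sign_pos h1, abs_of_nonneg (by linarith), abs_of_nonneg (by linarith)]
    simp

/-- Splitting inequality for the regularization. -/
lemma reg_split {n : ℕ} {D : Finset (Fin n → ℤ)} (hD : D.Nonempty) {F : (Fin n → ℤ) → ℝ}
    {R : ℝ} (hR : 0 ≤ R) (w : (Fin n → ℤ) → ℝ) (hw0 : ∀ z ∈ D, 0 ≤ w z)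
    (hw1 : ∑ z ∈ D, w z = 1) (θ : (Fin n → ℤ) → ℝ) (hθ0 : ∀ s, 0 ≤ θ s) (hθ1 : ∀ s, θ s ≤ 1)
    (hθ : ∑ s ∈ D, w s * θ s = 1 / 2) (a b Z : Fin n → ℤ)
    (hb : ∀ l, ∑ s ∈ D, w s * (s l : ℝ) = (Z l : ℝ) / 2)
    (hpt : ∀ s ∈ D, w s ≠ 0 → ∀ l, θ s * |(a l : ℝ) - s l| + (1 - θ s) * |(b l : ℝ) - s l|
      = (SignType.sign (a l + b l - Z l) : ℤ) * ((a l : ℝ) + b l - 2 * s l) / 2) :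
    reg D hD F R a + reg D hD F R b ≤
      2 * ∑ s ∈ D, w s * F s + R * ∑ l, |(a l : ℝ) + b l - Z l| := by
  have h1 : ∀ s ∈ D, (w s * θ s) * reg D hD F R a + (w s - w s * θ s) * reg D hD F R b ≤
      w s * F s + R * (w s * ∑ l, ((SignType.sign (a l + b l - Z l) : ℤ) : ℝ)
        * ((a l : ℝ) + b l - 2 * s l) / 2) := by
    intro s hs
    by_cases hne : w s = 0
    · simp [hne]
    have ea := reg_le D hD F R a s hs
    have eb := reg_le D hD F R b s hs
    have w0 := hw0 s hs
    have c1 : 0 ≤ w s * θ s := mul_nonneg w0 (hθ0 s)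
    have c2 : 0 ≤ w s - w s * θ s := by nlinarith [hθ1 s]
    have f1 := mul_le_mul_of_nonneg_left ea c1
    have f2 := mul_le_mul_of_nonneg_left eb c2
    have f3 : ∑ l, ((SignType.sign (a l + b l - Z l) : ℤ) : ℝ)
        * ((a l : ℝ) + b l - 2 * s l) / 2
        = θ s * ∑ l, |(a l : ℝ) - s l| + (1 - θ s) * ∑ l, |(b l : ℝ) - s l| := by
      rw [Finset.mul_sum, Finset.mul_sum, ← Finset.sum_add_distrib]
      exact Finset.sum_congr rfl (fun l _ => (hpt s hs hne l).symm)
    rw [f3]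
    calc _ ≤ _ := add_le_add f1 f2
      _ = _ := by ring
  have h2 := Finset.sum_le_sum h1
  rw [Finset.sum_add_distrib, ← Finset.sum_mul, ← Finset.sum_mul, Finset.sum_sub_distrib, hθ, hw1,
    Finset.sum_add_distrib, ← Finset.mul_sum] at h2
  have h3 : ∑ s ∈ D, w s * ∑ l, ((SignType.sign (a l + b l - Z l) : ℤ) : ℝ)
        * ((a l : ℝ) + b l - 2 * s l) / 2 = (∑ l, |(a l : ℝ) + b l - Z l|) / 2 := by
    simp_rw [Finset.mul_sum]
    rw [Finset.sum_comm, Finset.sum_div]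
    apply Finset.sum_congr rfl
    intro l _
    have e1 : ∀ s ∈ D, w s * (((SignType.sign (a l + b l - Z l) : ℤ) : ℝ)
        * ((a l : ℝ) + b l - 2 * s l) / 2)
        = (((SignType.sign (a l + b l - Z l) : ℤ) : ℝ) * ((a l : ℝ) + b l) / 2) * w s
          - ((SignType.sign (a l + b l - Z l) : ℤ) : ℝ) * (w s * (s l : ℝ)) := by
      intro s _
      ring
    rw [Finset.sum_congr rfl e1, Finset.sum_sub_distrib, ← Finset.mul_sum, ← Finset.mul_sum, hw1,
      hb l]
    have e2 : |(a l : ℝ) + b l - Z l| = ((SignType.sign (a l + b l - Z l) : ℤ) : ℝ)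
        * ((a l : ℝ) + b l - Z l) := by
      have := sign_mul_self (a l + b l - Z l)
      have h4 : (((SignType.sign (a l + b l - Z l) : ℤ) * (a l + b l - Z l) : ℤ) : ℝ)
        = ((|a l + b l - Z l| : ℤ) : ℝ) := by exact_mod_cast this
      push_cast at h4
      rw [← h4]
      push_cast
      rfl
    rw [e2]
    ring
  rw [h3] at h2
  linarith

lemma reg_mid {n : ℕ} {D : Finset (Fin n → ℤ)} (hD : D.Nonempty) {F : (Fin n → ℤ) → ℝ}
    (hIC : IC D F) {R : ℝ} (hR : 0 ≤ R) (p q a b : Fin n → ℤ) (l0 : Fin n)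
    (hsum : ∀ l, p l + q l = a l + b l) (hne : ∀ l, l ≠ l0 → a l = b l)
    (hl0 : |a l0 - b l0| ≤ 1) :
    reg D hD F R a + reg D hD F R b ≤ reg D hD F R p + reg D hD F R q := by
  obtain ⟨z, hz, ez⟩ := reg_attained D hD F R p
  obtain ⟨z', hz', ez'⟩ := reg_attained D hD F R q
  apply le_of_forall_pos_le_add
  intro ε hε
  obtain ⟨w, hw0, hw1, hwn, hwb, hwF⟩ := hIC z hz z' hz' (1 / 2) (by norm_num) (by norm_num)
    (ε / 2) (by linarith)
  let Z : Fin n → ℤ := fun l => z l + z' l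
  have hb : ∀ l, ∑ s ∈ D, w s * (s l : ℝ) = (Z l : ℝ) / 2 := by
    intro l
    rw [hwb l]
    simp only [Z]
    push_cast
    ring
  have hnear : ∀ s ∈ D, w s ≠ 0 → ∀ l, |2 * s l - Z l| ≤ 1 := by
    intro s hs h0 l
    have h1 := abs_lt.1 (hwn s hs h0 l)
    have h3 : ((2 * s l - Z l : ℤ) : ℝ) < 2 := by simp only [Z]; push_cast; linarith
    have h4 : (-2 : ℝ) < ((2 * s l - Z l : ℤ) : ℝ) := by simp only [Z]; push_cast; linarith
    have h5 : 2 * s l - Z l < 2 := by exact_mod_cast h3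
    have h6 : -2 < 2 * s l - Z l := by exact_mod_cast h4
    rw [abs_le]
    omega
  have hab : ∀ l, |a l - b l| ≤ 1 := by
    intro l
    by_cases h : l = l0
    · rw [h]; exact hl0
    · rw [hne l h]; simp
  have main : reg D hD F R a + reg D hD F R b ≤
      2 * ∑ s ∈ D, w s * F s + R * ∑ l, |(a l : ℝ) + b l - Z l| := by
    by_cases hc : a l0 = b l0 ∨ a l0 + b l0 ≠ Z l0
    · refine reg_split hD hR w hw0 hw1 (fun _ => 1 / 2) (by intro; norm_num)
        (by intro; norm_num) ?_ a b Z hb ?_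
      · rw [← Finset.sum_mul, hw1]; norm_num
      · intro s hs h0 l
        have h1 : a l = b l ∨ a l + b l ≠ Z l := by
          by_cases h : l = l0
          · rw [h]; exact hc
          · exact Or.inl (hne l h)
        obtain ⟨e1, e2⟩ := coord_same (a l) (b l) (s l) (Z l) (hab l) (hnear s hs h0 l) h1
        rw [e1, e2]
        ring
    · push Not at hc
      obtain ⟨hc1, hc2⟩ := hc
      have hval : ∀ s ∈ D, w s ≠ 0 → s l0 = a l0 ∨ s l0 = b l0 := by
        intro s hs h0
        have h1 := abs_le.1 (hnear s hs h0 l0)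
        have h2 := abs_le.1 hl0
        omega
      refine reg_split hD hR w hw0 hw1 (fun s => if s l0 = a l0 then 1 else 0) ?_ ?_ ?_ a b Z hb ?_
      · intro s; split_ifs <;> norm_num
      · intro s; split_ifs <;> norm_num
      · have e1 : ∀ s ∈ D, w s * (s l0 : ℝ)
            = (b l0 : ℝ) * w s + ((a l0 : ℝ) - b l0) * (w s * if s l0 = a l0 then 1 else 0) := by
          intro s hs
          by_cases h0 : w s = 0
          · simp [h0]
          rcases hval s hs h0 with h | h
          · rw [if_pos h, h]; ring
          · rw [if_neg (by rw [h]; exact fun h' => hc1 h'.symm), h]; ring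
        have h1 := hb l0
        rw [Finset.sum_congr rfl e1, Finset.sum_add_distrib, ← Finset.mul_sum, ← Finset.mul_sum,
          hw1, ← hc2] at h1
        push_cast at h1
        have h2 : ((a l0 : ℝ) - b l0) ≠ 0 := by
          rw [sub_ne_zero]; exact_mod_cast hc1
        apply mul_left_cancel₀ h2
        linarith
      · intro s hs h0 l
        by_cases h : l = l0
        · subst h
          have : a l + b l - Z l = 0 := by omega
          rw [this]
          rcases hval s hs h0 with h | h
          · rw [if_pos h, h]; simp
          · rw [if_neg (by rw [h]; exact fun h' => hc1 h'.symm), h]; simp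
        · obtain ⟨e1, e2⟩ := coord_same (a l) (b l) (s l) (Z l) (hab l) (hnear s hs h0 l)
            (Or.inl (hne l h))
          rw [e1, e2, hne l h]
          ring
  have htri : ∑ l, |(a l : ℝ) + b l - Z l| ≤ ∑ l, |(p l : ℝ) - z l| + ∑ l, |(q l : ℝ) - z' l| := by
    rw [← Finset.sum_add_distrib]
    apply Finset.sum_le_sum
    intro l _
    have h1 : (p l : ℝ) + q l = a l + b l := by exact_mod_cast hsum l
    have h2 : (a l : ℝ) + b l - Z l = ((p l : ℝ) - z l) + ((q l : ℝ) - z' l) := by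
      simp only [Z]; push_cast; linarith
    rw [h2]
    exact abs_add_le _ _
  have := mul_le_mul_of_nonneg_left htri hR
  rw [ez, ez']
  linarith

/-- The parallelogram inequality. -/
lemma reg_chain {n : ℕ} {D : Finset (Fin n → ℤ)} (hD : D.Nonempty) {F : (Fin n → ℤ) → ℝ}
    (hIC : IC D F) {R : ℝ} (hR : 0 ≤ R) (hn : 0 < n) (σ : Fin n → ℤ) (T : ℕ) :
    ∀ x e : Fin n → ℤ, ∑ l, |e l| ≤ (T : ℤ) →
      reg D hD F R (x + σ) + reg D hD F R (x + (T : ℤ) • σ + e) ≤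
      reg D hD F R x + reg D hD F R (x + (T : ℤ) • σ + e + σ) := by
  induction T with
  | zero =>
    intro x e he
    have h0 : ∀ l, e l = 0 := by
      intro l
      have h1 : |e l| ≤ ∑ l, |e l| :=
        Finset.single_le_sum (f := fun l => |e l|) (fun i _ => abs_nonneg _) (Finset.mem_univ l)
      have h2 : |e l| ≤ 0 := le_trans h1 (by simpa using he)
      exact abs_nonpos_iff.1 h2
    have : e = 0 := funext h0
    subst this
    simp [add_comm]
  | succ T ih =>
    intro x e he
    have hc : ∃ (c : Fin n → ℤ) (l0 : Fin n), (∀ l, l ≠ l0 → c l = 0) ∧ |c l0| ≤ 1 ∧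
        ∑ l, |(e - c) l| ≤ (T : ℤ) := by
      by_cases h : ∀ l, e l = 0
      · exact ⟨0, ⟨0, hn⟩, by simp, by simp, by simp [h]⟩
      · push Not at h
        obtain ⟨l0, hl0⟩ := h
        refine ⟨Pi.single l0 (SignType.sign (e l0) : ℤ), l0, ?_, ?_, ?_⟩
        · intro l hl
          simp [hl]
        · rw [Pi.single_eq_same]
          rcases lt_or_gt_of_ne hl0 with h1 | h1
          · simp [sign_neg h1]
          · simp [sign_pos h1]
        · rw [← Finset.add_sum_erase _ _ (Finset.mem_univ l0)] at he ⊢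
          have h2 : ∑ l ∈ Finset.univ.erase l0,
              |(e - (Pi.single l0 (SignType.sign (e l0) : ℤ) : Fin n → ℤ)) l|
              = ∑ l ∈ Finset.univ.erase l0, |e l| := by
            apply Finset.sum_congr rfl
            intro l hl
            simp [Finset.ne_of_mem_erase hl]
          rw [h2]
          have h3 : |(e - (Pi.single l0 (SignType.sign (e l0) : ℤ) : Fin n → ℤ)) l0| = |e l0| - 1 := by
            rw [Pi.sub_apply, Pi.single_eq_same]
            rcases lt_or_gt_of_ne hl0 with h1 | h1
            · rw [sign_neg h1, abs_of_neg h1, abs_of_nonpos (by simp; omega)]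
              simp; ring
            · rw [sign_pos h1, abs_of_pos h1, abs_of_nonneg (by simp; omega)]
              simp
          rw [h3]
          push_cast at he
          linarith
    obtain ⟨c, l0, hc0, hc1, hcs⟩ := hc
    have h1 := ih x (e - c) hcs
    have h2 := reg_mid hD hIC hR (x + (T : ℤ) • σ + (e - c))
      (x + ((T + 1 : ℕ) : ℤ) • σ + e + σ) (x + (T : ℤ) • σ + (e - c) + σ)
      (x + ((T + 1 : ℕ) : ℤ) • σ + e) l0
      (by intro l; simp only [Pi.add_apply, Pi.sub_apply]; ring)
      (by
        intro l hl
        have := hc0 l hl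
        simp only [Pi.add_apply, Pi.sub_apply, Pi.smul_apply, smul_eq_mul, this]
        push_cast; ring)
      (by
        have : (x + (T : ℤ) • σ + (e - c) + σ) l0 - (x + ((T + 1 : ℕ) : ℤ) • σ + e) l0
          = - c l0 := by
          simp only [Pi.add_apply, Pi.sub_apply, Pi.smul_apply, smul_eq_mul]
          push_cast; ring
        rw [this, abs_neg]
        exact hc1)
    linarith

lemma reg_chain' {n : ℕ} {D : Finset (Fin n → ℤ)} (hD : D.Nonempty) {F : (Fin n → ℤ) → ℝ}
    (hIC : IC D F) {R : ℝ} (hR : 0 ≤ R) (hn : 0 < n) (σ : Fin n → ℤ) (T : ℕ)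
    (e : Fin n → ℤ) (he : ∑ l, |e l| ≤ (T : ℤ)) (α : ℕ) :
      reg D hD F R ((α : ℤ) • σ) + reg D hD F R ((T : ℤ) • σ + e) ≤
      reg D hD F R 0 + reg D hD F R ((T : ℤ) • σ + e + (α : ℤ) • σ) := by
  induction α with
  | zero => simp
  | succ α ih =>
    have h1 := reg_chain hD hIC hR hn σ T ((α : ℤ) • σ) e he
    have e1 : (α : ℤ) • σ + σ = ((α + 1 : ℕ) : ℤ) • σ := by
      push_cast; rw [add_smul, one_smul]
    have e2 : (α : ℤ) • σ + (T : ℤ) • σ + e = (T : ℤ) • σ + e + (α : ℤ) • σ := by abel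
    have e3 : (α : ℤ) • σ + (T : ℤ) • σ + e + σ = (T : ℤ) • σ + e + ((α + 1 : ℕ) : ℤ) • σ := by
      rw [← e1]; abel
    rw [e3, e2, e1] at h1
    linarith

lemma reg_sum_ge_one {n : ℕ} (x z : Fin n → ℤ) (h : x ≠ z) :
    (1 : ℝ) ≤ ∑ l, |(x l : ℝ) - z l| := by
  obtain ⟨l, hl⟩ := Function.ne_iff.1 h
  have h1 : |(x l : ℝ) - z l| ≤ ∑ l, |(x l : ℝ) - z l| :=
    Finset.single_le_sum (f := fun l => |(x l : ℝ) - z l|) (fun i _ => abs_nonneg _)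
      (Finset.mem_univ l)
  have h2 : (1 : ℤ) ≤ |x l - z l| := Int.one_le_abs (sub_ne_zero.2 hl)
  have h3 : (1 : ℝ) ≤ |(x l : ℝ) - z l| := by exact_mod_cast h2
  linarith

lemma key_contra {n : ℕ} (hn : 0 < n) {D : Finset (Fin n → ℤ)} {F : (Fin n → ℤ) → ℝ}
    (hIC : IC D F) (h0 : (0 : Fin n → ℤ) ∈ D) (α : ℕ)
    (hloc : ∀ d : Fin n → ℤ, (∀ i, |d i| ≤ 1) → (α : ℤ) • d ∈ D → F 0 ≤ F ((α : ℤ) • d))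
    (y : Fin n → ℤ) (hmin : ∀ x ∈ D, F y ≤ F x) (hy : y ∈ D) (hlt : F y < F 0)
    (σ : Fin n → ℤ) (hσ : ∀ i, |σ i| ≤ 1) (T : ℕ) (e : Fin n → ℤ) (he : ∑ l, |e l| ≤ (T : ℤ))
    (hye : y = (T : ℤ) • σ + e + (α : ℤ) • σ)
    (hnot : (T : ℤ) • σ + e ∈ D → F y < F ((T : ℤ) • σ + e)) : False := by
  have hD : D.Nonempty := ⟨0, h0⟩
  have hR : 0 ≤ F 0 - F y := by linarith
  have h1 := reg_chain' hD hIC hR hn σ T e he α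
  rw [← hye] at h1
  have h2 := reg_le D hD F (F 0 - F y) 0 0 h0
  have h3 := reg_le D hD F (F 0 - F y) y y hy
  simp only [sub_self, abs_zero, Finset.sum_const_zero, mul_zero, add_zero] at h2 h3
  have h4 : F y < reg D hD F (F 0 - F y) ((T : ℤ) • σ + e) := by
    obtain ⟨z, hz, ez⟩ := reg_attained D hD F (F 0 - F y) ((T : ℤ) • σ + e)
    rw [ez]
    by_cases h : (T : ℤ) • σ + e = z
    · rw [← h]
      simp only [sub_self, abs_zero, Finset.sum_const_zero, mul_zero, add_zero]
      exact hnot (h ▸ hz)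
    · have := reg_sum_ge_one _ _ h
      have := hmin z hz
      nlinarith
  have h5 : F 0 ≤ reg D hD F (F 0 - F y) ((α : ℤ) • σ) := by
    obtain ⟨z, hz, ez⟩ := reg_attained D hD F (F 0 - F y) ((α : ℤ) • σ)
    rw [ez]
    by_cases h : (α : ℤ) • σ = z
    · rw [← h]
      simp only [sub_self, abs_zero, Finset.sum_const_zero, mul_zero, add_zero]
      exact hloc σ hσ (h ▸ hz)
    · have := reg_sum_ge_one _ _ h
      have := hmin z hz
      nlinarith
  linarith

lemma no_center {n : ℕ} (hn : 0 < n) {D : Finset (Fin n → ℤ)} {F : (Fin n → ℤ) → ℝ}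
    (hIC : IC D F) (h0 : (0 : Fin n → ℤ) ∈ D) (α : ℕ) (hα : 0 < α)
    (hloc : ∀ d : Fin n → ℤ, (∀ i, |d i| ≤ 1) → (α : ℤ) • d ∈ D → F 0 ≤ F ((α : ℤ) • d))
    (A : Finset (Fin n)) (hA : ∀ x ∈ D, ∀ l, l ∉ A → x l = 0)
    (y : Fin n → ℤ) (hmin : ∀ x ∈ D, F y ≤ F x) (hy : y ∈ D) (hlt : F y < F 0)
    (M : ℤ) (hM : 0 < M) (hyM : ∀ l, |y l| ≤ M)
    (hbest : ∀ x ∈ D, F x ≤ F y → ∃ l, M ≤ |x l|)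
    (c : ℤ) : ¬ (∑ l ∈ A, |(|y l| - c)| ≤ c - α) := by
  intro hs
  have hc0 : 0 ≤ c - α := le_trans (Finset.sum_nonneg (fun _ _ => abs_nonneg _)) hs
  have hge : ∀ l ∈ A, (α : ℤ) ≤ |y l| := by
    intro l hl
    have h1 : |(|y l| - c)| ≤ ∑ l ∈ A, |(|y l| - c)| :=
      Finset.single_le_sum (f := fun l => |(|y l| - c)|) (fun i _ => abs_nonneg _) hl
    have h2 := neg_abs_le (|y l| - c)
    omega
  let σ : Fin n → ℤ := fun l => (SignType.sign (y l) : ℤ)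
  have hσ1 : ∀ l ∈ A, (σ l = 1 ∧ |y l| = y l) ∨ (σ l = -1 ∧ |y l| = - y l) := by
    intro l hl
    have h1 := hge l hl
    rcases lt_trichotomy (y l) 0 with h | h | h
    · right; simp [σ, sign_neg h, abs_of_neg h]
    · rw [h] at h1; simp at h1; omega
    · left; simp [σ, sign_pos h, abs_of_pos h]
  have hσ0 : ∀ l, l ∉ A → σ l = 0 := by
    intro l hl
    simp [σ, hA y hy l hl]
  obtain ⟨T, hT⟩ := Int.eq_ofNat_of_zero_le hc0
  have hsub : (T : ℤ) • σ + (y - c • σ) = y - (α : ℤ) • σ := by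
    have : c = T + α := by omega
    rw [this]; funext l
    simp only [Pi.add_apply, Pi.sub_apply, Pi.smul_apply, smul_eq_mul]; ring
  refine key_contra hn hIC h0 α hloc y hmin hy hlt σ ?_ T (y - c • σ) ?_ ?_ ?_
  · intro l
    by_cases hl : l ∈ A
    · rcases hσ1 l hl with ⟨h, _⟩ | ⟨h, _⟩ <;> rw [h] <;> norm_num
    · rw [hσ0 l hl]; norm_num
  · rw [← hT]
    refine le_trans (le_of_eq ?_) hs
    symm
    rw [← Finset.sum_subset (Finset.subset_univ A)]
    · apply Finset.sum_congr rfl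
      intro l hl
      simp only [Pi.sub_apply, Pi.smul_apply, smul_eq_mul]
      rcases hσ1 l hl with ⟨h, h'⟩ | ⟨h, h'⟩
      · rw [h, h', mul_one]
      · rw [h, h', ← abs_neg]; congr 1; ring
    · intro l _ hl
      simp [hσ0 l hl, hA y hy l hl]
  · rw [hsub]; simp
  · rw [hsub]
    intro hmem
    by_contra hcon
    obtain ⟨l, hl⟩ := hbest _ hmem (not_lt.1 hcon)
    simp only [Pi.sub_apply, Pi.smul_apply, smul_eq_mul] at hl
    by_cases hlA : l ∈ A
    · have h1 := hge l hlA
      have h2 := hyM l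
      rcases hσ1 l hlA with ⟨h, h'⟩ | ⟨h, h'⟩
      · rw [h, abs_of_nonneg (by omega)] at hl; omega
      · rw [h, abs_of_nonpos (by omega)] at hl; omega
    · rw [hσ0 l hlA, hA y hy l hlA] at hl
      simp at hl; omega

lemma beta_nonneg : ∀ k : ℕ, 0 ≤ beta k
  | 0 => by simp [beta]
  | 1 => by simp [beta]
  | 2 => by simp [beta]
  | (n + 3) => by
    have := beta_nonneg (n + 2)
    rw [beta]; positivity

theorem core {n : ℕ} (hn : 0 < n) (α : ℕ) (hα : 0 < α) (F : (Fin n → ℤ) → ℝ) :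
    ∀ k : ℕ, ∀ A : Finset (Fin n), A.card = k → ∀ D : Finset (Fin n → ℤ), IC D F →
      (0 : Fin n → ℤ) ∈ D → (∀ x ∈ D, ∀ l, l ∉ A → x l = 0) →
      (∀ d : Fin n → ℤ, (∀ i, |d i| ≤ 1) → (α : ℤ) • d ∈ D → F 0 ≤ F ((α : ℤ) • d)) →
      ∃ y ∈ D, (∀ x ∈ D, F y ≤ F x) ∧ ∀ l, |(y l : ℝ)| ≤ beta k * ((α : ℝ) - 1) := by
  intro k
  have hα1 : (0 : ℝ) ≤ (α : ℝ) - 1 := by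
    have : (1 : ℝ) ≤ α := by exact_mod_cast hα
    linarith
  have hbnn : 0 ≤ beta k * ((α : ℝ) - 1) := mul_nonneg (beta_nonneg k) hα1
  induction k with
  | zero =>
    intro A hA D hIC h0 hsupp hloc
    refine ⟨0, h0, ?_, by intro l; simpa using hbnn⟩
    intro x hx
    have : x = 0 := by
      funext l
      apply hsupp x hx l
      rw [Finset.card_eq_zero.1 hA]; simp
    rw [this]
  | succ k ih =>
    intro A hA D hIC h0 hsupp hloc
    obtain ⟨y0, hy0, hy0min⟩ := Finset.exists_min_image D F ⟨0, h0⟩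
    let N : (Fin n → ℤ) → ℕ := fun x => Finset.univ.sup (fun l => (x l).natAbs)
    obtain ⟨y, hyf, hybest⟩ := Finset.exists_min_image (D.filter (fun x => F x ≤ F y0)) N
      ⟨y0, Finset.mem_filter.2 ⟨hy0, le_rfl⟩⟩
    rw [Finset.mem_filter] at hyf
    obtain ⟨hy, hyle⟩ := hyf
    have hmin : ∀ x ∈ D, F y ≤ F x := fun x hx => le_trans hyle (hy0min x hx)
    have hNne : ∀ x : Fin n → ℤ, ∃ l, N x = (x l).natAbs := by
      intro x
      obtain ⟨l, _, hl⟩ := Finset.exists_mem_eq_sup (Finset.univ : Finset (Fin n))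
        ⟨⟨0, hn⟩, Finset.mem_univ _⟩ (fun l => (x l).natAbs)
      exact ⟨l, hl⟩
    have hNle : ∀ x : Fin n → ℤ, ∀ l, |x l| ≤ (N x : ℤ) := by
      intro x l
      have : (x l).natAbs ≤ N x := Finset.le_sup (f := fun l => (x l).natAbs) (Finset.mem_univ l)
      rw [Int.abs_eq_natAbs]
      exact_mod_cast this
    have hbest : ∀ x ∈ D, F x ≤ F y → ∃ l, (N y : ℤ) ≤ |x l| := by
      intro x hx hxy
      have h1 := hybest x (Finset.mem_filter.2 ⟨hx, le_trans hxy hyle⟩)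
      obtain ⟨l, hl⟩ := hNne x
      exact ⟨l, by rw [Int.abs_eq_natAbs]; omega⟩
    suffices hNb : (N y : ℝ) ≤ beta (k + 1) * ((α : ℝ) - 1) by
      refine ⟨y, hy, hmin, ?_⟩
      intro l
      have : |(y l : ℝ)| ≤ (N y : ℝ) := by exact_mod_cast hNle y l
      linarith
    rcases Nat.eq_zero_or_pos (N y) with hM0 | hMpos
    · rw [hM0]; simpa using hbnn
    have hlt : F y < F 0 := by
      by_contra hcon
      obtain ⟨l, hl⟩ := hbest 0 h0 (not_lt.1 hcon)
      simp at hl; omega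
    have hMz : (0 : ℤ) < (N y : ℤ) := by exact_mod_cast hMpos
    have hnc := no_center hn hIC h0 α hα hloc A hsupp y hmin hy hlt (N y) hMz (hNle y) hbest
    -- maximal and minimal coordinates
    obtain ⟨l0, hl0⟩ := hNne y
    have hl0A : l0 ∈ A := by
      by_contra h
      rw [hsupp y hy l0 h] at hl0
      simp at hl0; omega
    obtain ⟨i, hiA, hi⟩ := Finset.exists_min_image A (fun l => |y l|) ⟨l0, hl0A⟩
    -- inequalities (A) and (B)
    have hAi : (A.card : ℤ) * (N y) - ∑ l ∈ A, |y l| ≥ N y - α + 1 := by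
      have h1 := hnc (N y)
      have h2 : ∑ l ∈ A, |(|y l| - (N y : ℤ))| = (A.card : ℤ) * (N y) - ∑ l ∈ A, |y l| := by
        have : ∀ l ∈ A, |(|y l| - (N y : ℤ))| = (N y : ℤ) - |y l| := by
          intro l _
          have := hNle y l
          rw [abs_of_nonpos (by omega)]; ring
        rw [Finset.sum_congr rfl this, Finset.sum_sub_distrib]
        simp
      rw [h2] at h1
      omega
    have hBi : ∑ l ∈ A, |y l| - (A.card : ℤ) * |y i| ≥ |y i| - α + 1 := by
      have h1 := hnc |y i|
      have h2 : ∑ l ∈ A, |(|y l| - |y i|)| = ∑ l ∈ A, |y l| - (A.card : ℤ) * |y i| := by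
        have : ∀ l ∈ A, |(|y l| - |y i|)| = |y l| - |y i| := by
          intro l hl
          have : |y i| ≤ |y l| := hi l hl
          rw [abs_of_nonneg (by omega)]
        rw [Finset.sum_congr rfl this, Finset.sum_sub_distrib]
        simp
      rw [h2] at h1
      omega
    have hSi : (N y : ℤ) + k * |y i| ≤ ∑ l ∈ A, |y l| := by
      rw [← Finset.add_sum_erase _ _ hl0A]
      have h1 : ((A.erase l0).card) • |y i| ≤ ∑ l ∈ A.erase l0, |y l| :=
        Finset.card_nsmul_le_sum _ _ _ (fun l hl => hi l (Finset.mem_of_mem_erase hl))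
      rw [Finset.card_erase_of_mem hl0A, hA] at h1
      simp only [Nat.add_sub_cancel, nsmul_eq_mul] at h1
      have : |y l0| = (N y : ℤ) := by rw [Int.abs_eq_natAbs]; omega
      linarith
    -- path
    have hk0 : 0 ≤ beta k * ((α : ℝ) - 1) := mul_nonneg (beta_nonneg k) hα1
    obtain ⟨u, hu, humin, hub⟩ := ih hk0 (A.erase i)
      (by rw [Finset.card_erase_of_mem hiA, hA]; simp) (D.filter (fun x => x i = 0))
      (hIC.restrict i) (Finset.mem_filter.2 ⟨h0, rfl⟩)
      (by
        intro x hx l hl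
        rw [Finset.mem_filter] at hx
        by_cases h : l = i
        · rw [h]; exact hx.2
        · exact hsupp x hx.1 l (fun h' => hl (Finset.mem_erase.2 ⟨h, h'⟩)))
      (fun d hd hd' => hloc d hd (Finset.mem_filter.1 hd').1)
    rw [Finset.mem_filter] at hu
    have hpath : ∃ z ∈ D, (∀ l, |z l - u l| ≤ |y i|) ∧ F z ≤ F y := by
      have hs : ∃ s : ℤ, (s = 1 ∨ s = -1) ∧ y i = s * ((y i).natAbs : ℤ) := by
        rcases le_total 0 (y i) with h | h
        · exact ⟨1, Or.inl rfl, by omega⟩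
        · exact ⟨-1, Or.inr rfl, by omega⟩
      obtain ⟨s, hs, hys⟩ := hs
      obtain ⟨z, hz, _, hzl, hzm⟩ := hIC.path i s hs u hu.1 hu.2
        (fun x hx hxi => humin x (Finset.mem_filter.2 ⟨hx, hxi⟩)) y hy (y i).natAbs hys
        (y i).natAbs le_rfl
      refine ⟨z, hz, ?_, hzm y hy hys⟩
      intro l
      have := hzl l
      rwa [Int.natCast_natAbs] at this
    obtain ⟨z, hz, hzl, hzF⟩ := hpath
    obtain ⟨l, hl⟩ := hbest z hz hzF
    have hMb : (N y : ℝ) ≤ beta k * ((α : ℝ) - 1) + (|y i| : ℤ) := by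
      have h1 : (N y : ℤ) ≤ |u l| + |y i| := by
        have h2 := hzl l
        have h3 : |z l| ≤ |z l - u l| + |u l| := by
          have := abs_add_le (z l - u l) (u l)
          simpa using this
        omega
      have h4 : (N y : ℝ) ≤ |(u l : ℝ)| + (|y i| : ℤ) := by exact_mod_cast h1
      have := hub l
      linarith
    have hA' : ((k : ℝ) + 1) * (N y) - ((∑ l ∈ A, |y l| : ℤ) : ℝ) ≥ N y - α + 1 := by
      rw [hA] at hAi; exact_mod_cast hAi
    have hB' : ((∑ l ∈ A, |y l| : ℤ) : ℝ) - ((k : ℝ) + 1) * (|y i| : ℤ) ≥ (|y i| : ℤ) - α + 1 := by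
      rw [hA] at hBi; exact_mod_cast hBi
    have hS' : (N y : ℝ) + k * (|y i| : ℤ) ≤ ((∑ l ∈ A, |y l| : ℤ) : ℝ) := by exact_mod_cast hSi
    generalize ((∑ l ∈ A, |y l| : ℤ) : ℝ) = S at *
    generalize ((|y i| : ℤ) : ℝ) = m at *
    generalize (N y : ℝ) = M at *
    match k with
    | 0 => simp [beta] at *; linarith
    | 1 => simp [beta] at *; linarith
    | (k + 2) =>
      rw [beta]
      generalize beta (k + 2) = b at *
      push_cast at hA' hB'
      have hk : (0 : ℝ) ≤ k := Nat.cast_nonneg k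
      have h1 : ((k : ℝ) + 2 + 1) * (M - m) ≤ ((k : ℝ) + 2 + 1) * (b * ((α : ℝ) - 1)) :=
        mul_le_mul_of_nonneg_left (by linarith) (by linarith)
      nlinarith

lemma localExt_le {n : ℕ} (f : (Fin n → ℤ) → EReal) (p : Fin n → ℤ) :
    localExt f (fun i => (p i : ℝ)) ≤ f p := by
  apply sInf_le
  refine ⟨1, fun _ => 1, fun _ => p, by simp, by simp, ?_, by simp, by simp⟩
  intro _ i
  simp

lemma ereal_coe_mul_le {t : ℝ} (ht : 0 ≤ t) {a b : EReal} (h : a ≤ b) :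
    (t : EReal) * a ≤ (t : EReal) * b :=
  mul_le_mul_of_nonneg_left h (by exact_mod_cast ht)

lemma exists_comb {n : ℕ} (f : (Fin n → ℤ) → EReal) (hbot : ∀ x, f x ≠ ⊥)
    (hf : IsIntegrallyConvexFn f) (p q : Fin n → ℤ) (hp : f p ≠ ⊤) (hq : f q ≠ ⊤)
    (t : ℝ) (h0 : 0 ≤ t) (h1 : t ≤ 1) (ε : ℝ) (hε : 0 < ε) :
    ∃ (m : ℕ) (lam : Fin m → ℝ) (y : Fin m → (Fin n → ℤ)),
      (∀ j, 0 ≤ lam j) ∧ (∑ j, lam j) = 1 ∧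
      (∀ j i, |t * (p i : ℝ) + (1 - t) * (q i : ℝ) - (y j i : ℝ)| < 1) ∧
      (∀ i, (∑ j, lam j * ((y j i : ℝ))) = t * (p i : ℝ) + (1 - t) * (q i : ℝ)) ∧
      (∀ j, lam j ≠ 0 → f (y j) ≠ ⊤) ∧
      ∑ j, lam j * (f (y j)).toReal < t * (f p).toReal + (1 - t) * (f q).toReal + ε := by
  have hle := hf (fun i => (p i : ℝ)) (fun i => (q i : ℝ)) t h0 h1
  have hle2 : (t : EReal) * localExt f (fun i => (p i : ℝ)) +
      (((1 - t : ℝ)) : EReal) * localExt f (fun i => (q i : ℝ)) ≤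
      ((t * (f p).toReal + (1 - t) * (f q).toReal : ℝ) : EReal) := by
    rw [EReal.coe_add, EReal.coe_mul, EReal.coe_mul, EReal.coe_toReal hp (hbot p),
      EReal.coe_toReal hq (hbot q)]
    exact add_le_add (ereal_coe_mul_le h0 (localExt_le f p))
      (ereal_coe_mul_le (by linarith) (localExt_le f q))
  have hlt : localExt f (fun i => t * (p i : ℝ) + (1 - t) * (q i : ℝ)) <
      ((t * (f p).toReal + (1 - t) * (f q).toReal + ε : ℝ) : EReal) :=
    lt_of_le_of_lt (le_trans hle hle2) (by
      rw [EReal.coe_lt_coe_iff]; linarith)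
  unfold localExt at hlt
  obtain ⟨v, ⟨m, lam, y, hl0, hl1, hyn, hyb, hv⟩, hvlt⟩ := sInf_lt_iff.1 hlt
  have hterm_bot : ∀ j, (lam j : EReal) * f (y j) ≠ ⊥ := by
    intro j
    by_cases hz : lam j = 0
    · rw [hz]; simp
    by_cases htop : f (y j) = ⊤
    · rw [htop, EReal.coe_mul_top_of_pos (lt_of_le_of_ne (hl0 j) (Ne.symm hz))]; simp
    · rw [← EReal.coe_toReal htop (hbot _), ← EReal.coe_mul]
      exact EReal.coe_ne_bot _
  have hsum_bot : ∀ s : Finset (Fin m), ∑ j ∈ s, (lam j : EReal) * f (y j) ≠ ⊥ := by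
    intro s
    induction s using Finset.induction_on with
    | empty => simp
    | insert a s ha ih =>
      rw [Finset.sum_insert ha]
      intro h
      rcases EReal.add_eq_bot_iff.1 h with h | h
      · exact hterm_bot a h
      · exact ih h
  have hfin : ∀ j, lam j ≠ 0 → f (y j) ≠ ⊤ := by
    intro j hj htop
    have : v = ⊤ := by
      rw [hv, ← Finset.add_sum_erase _ _ (Finset.mem_univ j), htop,
        EReal.coe_mul_top_of_pos (lt_of_le_of_ne (hl0 j) (Ne.symm hj)),
        EReal.top_add_of_ne_bot (hsum_bot _)]
    rw [this] at hvlt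
    exact absurd hvlt not_top_lt
  refine ⟨m, lam, y, hl0, hl1, fun j i => hyn j i, hyb, hfin, ?_⟩
  have hveq : v = ((∑ j, lam j * (f (y j)).toReal : ℝ) : EReal) := by
    have hcs : ∀ s : Finset (Fin m), ∑ j ∈ s, (lam j : EReal) * f (y j)
        = ((∑ j ∈ s, lam j * (f (y j)).toReal : ℝ) : EReal) := by
      intro s
      induction s using Finset.induction_on with
      | empty => simp
      | insert a s ha ih =>
        rw [Finset.sum_insert ha, Finset.sum_insert ha, ih, EReal.coe_add]
        congr 1
        by_cases hz : lam a = 0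
        · rw [hz]; simp
        · rw [EReal.coe_mul, EReal.coe_toReal (hfin a hz) (hbot _)]
    rw [hv]
    exact hcs _
  rw [hveq] at hvlt
  exact EReal.coe_lt_coe_iff.1 hvlt

lemma IC_of {n : ℕ} (f : (Fin n → ℤ) → EReal) (hbot : ∀ x, f x ≠ ⊥)
    (hf : IsIntegrallyConvexFn f) (xa : Fin n → ℤ) (D : Finset (Fin n → ℤ))
    (hD : ∀ x, x ∈ D ↔ f (x + xa) ≠ ⊤) : IC D (fun x => (f (x + xa)).toReal) := by
  classical
  intro p hp q hq t h0 h1 ε hε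
  obtain ⟨m, lam, y, hl0, hl1, hyn, hyb, hfin, hlt⟩ := exists_comb f hbot hf (p + xa) (q + xa)
    ((hD p).1 hp) ((hD q).1 hq) t h0 h1 ε hε
  let w : (Fin n → ℤ) → ℝ := fun z => ∑ j, if y j - xa = z then lam j else 0
  have key : ∀ g : (Fin n → ℤ) → ℝ, ∑ z ∈ D, w z * g z = ∑ j, lam j * g (y j - xa) := by
    intro g
    simp only [w, Finset.sum_mul]
    rw [Finset.sum_comm]
    apply Finset.sum_congr rfl
    intro j _
    by_cases hz : lam j = 0
    · simp [hz]
    have hmem : y j - xa ∈ D := by rw [hD]; simpa using hfin j hz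
    rw [Finset.sum_eq_single_of_mem _ hmem]
    · simp
    · intro z _ hne
      rw [if_neg (Ne.symm hne), zero_mul]
  refine ⟨w, ?_, ?_, ?_, ?_, ?_⟩
  · intro z _
    apply Finset.sum_nonneg
    intro j _
    split_ifs
    · exact hl0 j
    · exact le_rfl
  · have := key (fun _ => 1)
    simpa [hl1] using this
  · intro z _ hwz i
    obtain ⟨j, _, hj⟩ := Finset.exists_ne_zero_of_sum_ne_zero hwz
    have hj2 : y j - xa = z := by
      by_contra h
      rw [if_neg h] at hj; exact hj rfl
    have h3 := hyn j i
    rw [← hj2]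
    simp only [Pi.add_apply, Pi.sub_apply, Int.cast_add, Int.cast_sub] at h3 ⊢
    convert h3 using 2
    ring
  · intro i
    rw [key (fun z => (z i : ℝ))]
    simp only [Pi.sub_apply, Int.cast_sub, mul_sub, Finset.sum_sub_distrib]
    rw [hyb i, ← Finset.sum_mul, hl1]
    simp only [Pi.add_apply, Int.cast_add]
    ring
  · rw [key]
    simpa using hlt

end ICProx

/-- Proximity theorem for integrally convex functions in n variables. -/
theorem integrally_convex_proximity {n : ℕ} (hn : 1 ≤ n)
    (f : (Fin n → ℤ) → EReal) (hbot : ∀ x, f x ≠ ⊥)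
    (hf : IsIntegrallyConvexFn f)
    (hbdd : ∃ M : ℤ, ∀ x, f x ≠ ⊤ → ∀ i, |x i| ≤ M)
    (α : ℕ) (hα : 0 < α)
    (xa : Fin n → ℤ) (hdom : f xa ≠ ⊤)
    (hloc : ∀ d : Fin n → ℤ, (∀ i, |d i| ≤ 1) →
      f xa ≤ f (fun i => xa i + (α : ℤ) * d i)) :
    ∃ xstar : Fin n → ℤ, (∀ w, f xstar ≤ f w) ∧
      ∀ i, (|xa i - xstar i| : ℝ) ≤ beta n * ((α : ℝ) - 1) := by
  classical
  obtain ⟨B, hB⟩ := hbdd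
  have hfinite : {x : Fin n → ℤ | f (x + xa) ≠ ⊤}.Finite := by
    apply Set.Finite.subset (Set.finite_Icc (fun i => -B - xa i) (fun i => B - xa i))
    intro x hx
    have h1 := hB _ hx
    constructor
    · intro i
      have := abs_le.1 (h1 i)
      simp only [Pi.add_apply] at this
      simp only
      omega
    · intro i
      have := abs_le.1 (h1 i)
      simp only [Pi.add_apply] at this
      simp only
      omega
  have hD : ∀ x, x ∈ hfinite.toFinset ↔ f (x + xa) ≠ ⊤ := by
    intro x
    rw [Set.Finite.mem_toFinset, Set.mem_setOf_eq]
  obtain ⟨y, hy, hmin, hyb⟩ := ICProx.core (by omega) α hα (fun x => (f (x + xa)).toReal) n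
    Finset.univ (by simp) hfinite.toFinset (ICProx.IC_of f hbot hf xa _ hD)
    (by rw [hD]; simpa using hdom) (by simp)
    (by
      intro d hd hmem
      rw [hD] at hmem
      have h1 := hloc d hd
      have h2 : (fun i => xa i + (α : ℤ) * d i) = (α : ℤ) • d + xa := by
        funext i
        simp [add_comm]
      rw [h2] at h1
      simp only [zero_add]
      exact EReal.toReal_le_toReal h1 (hbot _) hmem)
  refine ⟨y + xa, ?_, ?_⟩
  · intro w
    by_cases hw : f w = ⊤
    · rw [hw]; exact le_top
    have hw' : w - xa ∈ hfinite.toFinset := by rw [hD]; simpa using hw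
    have h1 := hmin _ hw'
    simp only [sub_add_cancel] at h1
    rw [← EReal.coe_toReal hw (hbot w), ← EReal.coe_toReal ((hD y).1 hy) (hbot _)]
    exact_mod_cast h1
  · intro i
    have h1 := hyb i
    have h2 : ((xa i : ℝ) - ((y + xa) i : ℤ)) = -(y i : ℝ) := by
      simp
    rw [h2, abs_neg]
    exact h1
end
end

section
/- Let f : ℤⁿ → ℝ ∪ {+∞} be a function with integrally convex effective domain. Then f is integrally convex if and only if for every x, y ∈ dom f with ‖x − y‖_∞ = 2, the local convex extension satisfies f̃((x+y)/2) ≤ (f(x) + f(y))/2. -/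
open scoped BigOperators

noncomputable section

/-- `w` is a system of convex weights supported on `T` with barycenter `u`. -/
def CRep {n : ℕ} (T : Finset (Fin n → ℤ)) (u : Fin n → ℝ) (w : (Fin n → ℤ) → ℝ) : Prop :=
  (∀ z, 0 ≤ w z) ∧ (∀ z, z ∉ T → w z = 0) ∧ ∑ z ∈ T, w z = 1 ∧
    ∀ i, ∑ z ∈ T, w z * (z i : ℝ) = u i

theorem sum_change {n : ℕ} {T T' : Finset (Fin n → ℤ)} {w : (Fin n → ℤ) → ℝ}
    (h : ∀ z, z ∉ T → w z = 0) (h' : ∀ z, z ∉ T' → w z = 0) (φ : (Fin n → ℤ) → ℝ) :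
    ∑ z ∈ T', w z * φ z = ∑ z ∈ T, w z * φ z := by
  classical
  rw [Finset.sum_subset (Finset.subset_union_left : T' ⊆ T' ∪ T),
    Finset.sum_subset (Finset.subset_union_right : T ⊆ T' ∪ T)]
  · intro z _ hz; rw [h z hz, zero_mul]
  · intro z _ hz; rw [h' z hz, zero_mul]

theorem CRep.change {n : ℕ} {T T' : Finset (Fin n → ℤ)} {u : Fin n → ℝ}
    {w : (Fin n → ℤ) → ℝ} (h : CRep T u w) (h' : ∀ z, z ∉ T' → w z = 0) : CRep T' u w := by
  refine ⟨h.1, h', ?_, fun i => ?_⟩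
  · have := sum_change h.2.1 h' (fun _ => 1)
    simp only [mul_one] at this
    rw [this, h.2.2.1]
  · rw [sum_change h.2.1 h' (fun z => (z i : ℝ)), h.2.2.2 i]

theorem CRep.mono {n : ℕ} {T T' : Finset (Fin n → ℤ)} {u : Fin n → ℝ}
    {w : (Fin n → ℤ) → ℝ} (h : CRep T u w) (hT : T ⊆ T') : CRep T' u w :=
  h.change fun z hz => h.2.1 z fun hz' => hz (hT hz')

theorem CRep.comb {n : ℕ} {T : Finset (Fin n → ℤ)} {u v : Fin n → ℝ}
    {w w' : (Fin n → ℤ) → ℝ} (h : CRep T u w) (h' : CRep T v w') {a b : ℝ}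
    (ha : 0 ≤ a) (hb : 0 ≤ b) (hab : a + b = 1) :
    CRep T (fun i => a * u i + b * v i) (fun z => a * w z + b * w' z) := by
  refine ⟨fun z => ?_, fun z hz => ?_, ?_, fun i => ?_⟩
  · have := h.1 z; have := h'.1 z; positivity
  · simp [h.2.1 z hz, h'.2.1 z hz]
  · rw [Finset.sum_add_distrib, ← Finset.mul_sum, ← Finset.mul_sum, h.2.2.1, h'.2.2.1]; linarith
  · beta_reduce
    rw [← h.2.2.2 i, ← h'.2.2.2 i, Finset.mul_sum, Finset.mul_sum, ← Finset.sum_add_distrib]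
    exact Finset.sum_congr rfl fun z _ => by ring

theorem sum_comb {n : ℕ} (T : Finset (Fin n → ℤ)) (w w' φ : (Fin n → ℤ) → ℝ) (a b : ℝ) :
    ∑ z ∈ T, (a * w z + b * w' z) * φ z
      = a * ∑ z ∈ T, w z * φ z + b * ∑ z ∈ T, w' z * φ z := by
  rw [Finset.mul_sum, Finset.mul_sum, ← Finset.sum_add_distrib]
  exact Finset.sum_congr rfl fun z _ => by ring

theorem CRep.isCompact {n : ℕ} (T : Finset (Fin n → ℤ)) (u : Fin n → ℝ) :
    IsCompact {w | CRep T u w} := by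
  refine IsCompact.of_isClosed_subset
    (isCompact_univ_pi (fun _ : (Fin n → ℤ) => (isCompact_Icc : IsCompact (Set.Icc (0:ℝ) 1)))) ?_ ?_
  · have hc : ∀ z : Fin n → ℤ, Continuous fun w : (Fin n → ℤ) → ℝ => w z :=
      fun z => continuous_apply z
    have h1 : IsClosed {w : (Fin n → ℤ) → ℝ | ∀ z, 0 ≤ w z} := by
      rw [Set.ofPred_forall]
      exact isClosed_iInter fun z => isClosed_le continuous_const (hc z)
    have h2 : IsClosed {w : (Fin n → ℤ) → ℝ | ∀ z, z ∉ T → w z = 0} := by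
      simp only [Set.ofPred_forall]
      exact isClosed_iInter fun z => isClosed_iInter fun _ => isClosed_eq (hc z) continuous_const
    have h3 : IsClosed {w : (Fin n → ℤ) → ℝ | ∑ z ∈ T, w z = 1} :=
      isClosed_eq (by fun_prop) continuous_const
    have h4 : IsClosed {w : (Fin n → ℤ) → ℝ | ∀ i, ∑ z ∈ T, w z * (z i : ℝ) = u i} := by
      rw [Set.ofPred_forall]
      exact isClosed_iInter fun z => isClosed_eq (by fun_prop) continuous_const
    exact h1.inter (h2.inter (h3.inter h4))
  · intro w hw z _
    refine ⟨hw.1 z, ?_⟩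
    by_cases hz : z ∈ T
    · rw [← hw.2.2.1]
      exact Finset.single_le_sum (fun z _ => hw.1 z) hz
    · rw [hw.2.1 z hz]; exact zero_le_one

theorem box_finite {n : ℕ} (u : Fin n → ℝ) :
    {z : Fin n → ℤ | ∀ i, |u i - (z i : ℝ)| ≤ 1}.Finite := by
  refine (Set.finite_Icc (fun i => ⌊u i⌋ - 2) (fun i => ⌈u i⌉ + 2)).subset ?_
  intro z hz
  refine ⟨fun i => ?_, fun i => ?_⟩
  · have := abs_le.1 (hz i)
    have h2 := Int.floor_le (u i)
    have : ((⌊u i⌋ - 2 : ℤ) : ℝ) ≤ (z i : ℝ) := by push_cast; linarith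
    exact_mod_cast this
  · have := abs_le.1 (hz i)
    have h2 := Int.le_ceil (u i)
    have : (z i : ℝ) ≤ ((⌈u i⌉ + 2 : ℤ) : ℝ) := by push_cast; linarith
    exact_mod_cast this

def bigBox {n : ℕ} (f : (Fin n → ℤ) → EReal) (u : Fin n → ℝ) : Finset (Fin n → ℤ) :=
  ((box_finite u).subset
    (fun _ h => h.2 : {z : Fin n → ℤ | f z ≠ ⊤ ∧ ∀ i, |u i - (z i : ℝ)| ≤ 1} ⊆ _)).toFinset

theorem mem_bigBox {n : ℕ} {f : (Fin n → ℤ) → EReal} {u : Fin n → ℝ} {z : Fin n → ℤ} :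
    z ∈ bigBox f u ↔ f z ≠ ⊤ ∧ ∀ i, |u i - (z i : ℝ)| ≤ 1 := by
  simp [bigBox]

def smallBox {n : ℕ} (f : (Fin n → ℤ) → EReal) (u : Fin n → ℝ) : Finset (Fin n → ℤ) :=
  ((box_finite u).subset
    (fun _ h i => (h.2 i).le :
      {z : Fin n → ℤ | f z ≠ ⊤ ∧ z ∈ intNbhd u} ⊆ _)).toFinset

theorem mem_smallBox {n : ℕ} {f : (Fin n → ℤ) → EReal} {u : Fin n → ℝ} {z : Fin n → ℤ} :
    z ∈ smallBox f u ↔ f z ≠ ⊤ ∧ z ∈ intNbhd u := by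
  simp [smallBox]

theorem coe_sum_EReal {ι : Type*} (s : Finset ι) (g : ι → ℝ) :
    ((∑ j ∈ s, g j : ℝ) : EReal) = ∑ j ∈ s, ((g j : ℝ) : EReal) := by
  classical
  induction s using Finset.induction_on with
  | empty => simp
  | insert a s ha ih => rw [Finset.sum_insert ha, Finset.sum_insert ha, EReal.coe_add, ih]

theorem localExt_le {n : ℕ} {f : (Fin n → ℤ) → EReal} (hbot : ∀ x, f x ≠ ⊥)
    {u : Fin n → ℝ} {w : (Fin n → ℤ) → ℝ} (h : CRep (smallBox f u) u w) :
    localExt f u ≤ ((∑ z ∈ smallBox f u, w z * (f z).toReal : ℝ) : EReal) := by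
  refine sInf_le ?_
  have key : ∀ φ : (Fin n → ℤ) → ℝ, ∑ j, φ ((smallBox f u).equivFin.symm j : Fin n → ℤ)
      = ∑ z ∈ smallBox f u, φ z := by
    intro φ
    rw [← Finset.sum_coe_sort (smallBox f u)]
    exact Equiv.sum_comp (smallBox f u).equivFin.symm (fun z => φ (z : Fin n → ℤ))
  refine ⟨(smallBox f u).card, fun j => w ((smallBox f u).equivFin.symm j),
    fun j => ((smallBox f u).equivFin.symm j : Fin n → ℤ), fun j => h.1 _, ?_, ?_, ?_, ?_⟩
  · rw [key w, h.2.2.1]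
  · intro j
    exact (mem_smallBox.1 ((smallBox f u).equivFin.symm j).2).2
  · intro i
    rw [key (fun z => w z * (z i : ℝ)), h.2.2.2 i]
  · rw [← key (fun z => w z * (f z).toReal), coe_sum_EReal]
    refine Finset.sum_congr rfl fun j _ => ?_
    have hj := (mem_smallBox.1 ((smallBox f u).equivFin.symm j).2).1
    rw [EReal.coe_mul, EReal.coe_toReal hj (hbot _)]

theorem rep_of_mem {n : ℕ} {f : (Fin n → ℤ) → EReal} (hbot : ∀ x, f x ≠ ⊥)
    {u : Fin n → ℝ} {m : ℕ} {lam : Fin m → ℝ} {y : Fin m → (Fin n → ℤ)}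
    (h0 : ∀ j, 0 ≤ lam j) (h1 : (∑ j, lam j) = 1) (h2 : ∀ j, y j ∈ intNbhd u)
    (h3 : ∀ i, (∑ j, lam j * ((y j i : ℝ))) = u i)
    (hv : ∑ j, (((lam j : ℝ) : EReal) * f (y j)) ≠ ⊤) :
    ∃ w, CRep (smallBox f u) u w ∧
      ∑ j, (((lam j : ℝ) : EReal) * f (y j))
        = ((∑ z ∈ smallBox f u, w z * (f z).toReal : ℝ) : EReal) := by
  classical
  have hnb : ∀ j, ((lam j : ℝ) : EReal) * f (y j) ≠ ⊥ := by
    intro j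
    rw [ne_eq, EReal.mul_eq_bot]
    simp [hbot, (h0 j).not_gt]
  have hfin : ∀ j, lam j ≠ 0 → f (y j) ≠ ⊤ := by
    intro j hj hf
    apply hv
    have hpos : 0 < lam j := lt_of_le_of_ne (h0 j) (Ne.symm hj)
    rw [← Finset.add_sum_erase _ _ (Finset.mem_univ j), hf, EReal.coe_mul_top_of_pos hpos]
    apply EReal.top_add_of_ne_bot
    have : ∀ s : Finset (Fin m), ∑ j ∈ s, ((lam j : ℝ) : EReal) * f (y j) ≠ ⊥ := by
      intro s
      induction s using Finset.induction_on with
      | empty => simp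
      | insert a s ha ih =>
        rw [Finset.sum_insert ha, ne_eq, EReal.add_eq_bot_iff]
        simp only [not_or]
        exact ⟨hnb a, ih⟩
    exact this _
  have hmem : ∀ j, lam j ≠ 0 → y j ∈ smallBox f u := fun j hj => mem_smallBox.2 ⟨hfin j hj, h2 j⟩
  have key : ∀ φ : (Fin n → ℤ) → ℝ,
      ∑ z ∈ smallBox f u, (∑ j, if y j = z then lam j else 0) * φ z = ∑ j, lam j * φ (y j) := by
    intro φ
    simp only [Finset.sum_mul]
    rw [Finset.sum_comm]
    refine Finset.sum_congr rfl fun j _ => ?_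
    by_cases hj : lam j = 0
    · simp [hj]
    · simp only [ite_mul, zero_mul]
      rw [Finset.sum_ite_eq, if_pos (hmem j hj)]
  refine ⟨fun z => ∑ j, if y j = z then lam j else 0, ⟨?_, ?_, ?_, ?_⟩, ?_⟩
  · intro z
    exact Finset.sum_nonneg fun j _ => by split_ifs <;> simp [h0]
  · intro z hz
    refine Finset.sum_eq_zero fun j _ => ?_
    split_ifs with hj
    · by_contra hne
      exact hz (hj ▸ hmem j hne)
    · rfl
  · have := key (fun _ => 1)
    simpa [h1] using this
  · intro i
    rw [key (fun z => (z i : ℝ)), h3 i]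
  · rw [key (fun z => (f z).toReal), coe_sum_EReal]
    refine Finset.sum_congr rfl fun j _ => ?_
    by_cases hj : lam j = 0
    · simp [hj]
    · rw [EReal.coe_mul, EReal.coe_toReal (hfin j hj) (hbot _)]

theorem exists_rep {n : ℕ} {f : (Fin n → ℤ) → EReal} (hbot : ∀ x, f x ≠ ⊥)
    {u : Fin n → ℝ} (h : localExt f u ≠ ⊤) :
    ∃ w, CRep (smallBox f u) u w ∧
      localExt f u = ((∑ z ∈ smallBox f u, w z * (f z).toReal : ℝ) : EReal) := by
  have hne : {w | CRep (smallBox f u) u w}.Nonempty := by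
    obtain ⟨v, ⟨m, lam, y, h0, h1, h2, h3, rfl⟩, hv⟩ := sInf_lt_iff.1 (lt_top_iff_ne_top.2 h)
    obtain ⟨w, hw, -⟩ := rep_of_mem hbot h0 h1 h2 h3 hv.ne
    exact ⟨w, hw⟩
  obtain ⟨w, hw, hmin⟩ := (CRep.isCompact (smallBox f u) u).exists_isMinOn hne
    (f := fun w => ∑ z ∈ smallBox f u, w z * (f z).toReal) (by fun_prop)
  refine ⟨w, hw, le_antisymm (localExt_le hbot hw) ?_⟩
  refine le_sInf ?_
  rintro v ⟨m, lam, y, h0, h1, h2, h3, rfl⟩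
  by_cases hv : ∑ j, (((lam j : ℝ) : EReal) * f (y j)) = ⊤
  · rw [hv]; exact le_top
  · obtain ⟨w', hw', he⟩ := rep_of_mem hbot h0 h1 h2 h3 hv
    rw [he]
    exact EReal.coe_le_coe_iff.2 (hmin hw')

theorem rep_of_hull {n : ℕ} {f : (Fin n → ℤ) → EReal} {u : Fin n → ℝ}
    (h : u ∈ convexHull ℝ (realify '' ({x : Fin n → ℤ | f x ≠ ⊤} ∩ intNbhd u))) :
    ∃ w, CRep (smallBox f u) u w := by
  classical
  have : convexHull ℝ (realify '' ({x : Fin n → ℤ | f x ≠ ⊤} ∩ intNbhd u)) ⊆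
      {v | ∃ w, CRep (smallBox f u) v w} := by
    refine convexHull_min ?_ ?_
    · rintro _ ⟨z, hz, rfl⟩
      have hz' : z ∈ smallBox f u := mem_smallBox.2 hz
      refine ⟨fun x => if z = x then 1 else 0, ?_, ?_, ?_, ?_⟩
      · intro x; beta_reduce; split_ifs <;> simp
      · intro x hx
        beta_reduce
        rw [if_neg]; rintro rfl; exact hx hz'
      · rw [Finset.sum_ite_eq, if_pos hz']
      · intro i
        simp only [ite_mul, zero_mul]
        rw [Finset.sum_ite_eq, if_pos hz']; simp [realify]
    · rintro v ⟨w, hw⟩ v' ⟨w', hw'⟩ a b ha hb hab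
      exact ⟨_, hw.comb hw' ha hb hab⟩
  exact this h

theorem CRep.mem_hull {n : ℕ} {T : Finset (Fin n → ℤ)} {u : Fin n → ℝ}
    {w : (Fin n → ℤ) → ℝ} (h : CRep T u w) {S : Set (Fin n → ℤ)} (hS : ∀ z ∈ T, z ∈ S) :
    u ∈ convexHull ℝ (realify '' S) := by
  have : u = ∑ z ∈ T, w z • realify z := by
    ext i
    simp [realify, h.2.2.2 i]
  rw [this]
  exact (convex_convexHull ℝ _).sum_mem (fun z _ => h.1 z) h.2.2.1
    fun z hz => subset_convexHull ℝ _ ⟨z, hS z hz, rfl⟩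

theorem mid_int {a b z : ℤ} (hab : |a - b| ≤ 2) (hz : |((a : ℝ) + b) / 2 - z| < 1) :
    (z - a) * (z - b) ≤ 0 ∧ (|a - b| = 2 → (z - a) * (z - b) ≤ -1) ∧
      min a b ≤ z ∧ z ≤ max a b := by
  have h1 : ((2 * z : ℤ) : ℝ) < ((a + b + 2 : ℤ) : ℝ) := by
    have := (abs_lt.1 hz).1; push_cast; linarith
  have h2 : ((a + b - 2 : ℤ) : ℝ) < ((2 * z : ℤ) : ℝ) := by
    have := (abs_lt.1 hz).2; push_cast; linarith
  have h1 := Int.cast_lt.1 h1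
  have h2 := Int.cast_lt.1 h2
  obtain ⟨h3, h4⟩ := abs_le.1 hab
  obtain ⟨k, rfl⟩ : ∃ k, a = b + k := ⟨a - b, by ring⟩
  obtain ⟨l, rfl⟩ : ∃ l, z = b + l := ⟨z - b, by ring⟩
  have hk1 : -2 ≤ k := by linarith
  have hk2 : k ≤ 2 := by linarith
  have hl1 : -2 ≤ l := by linarith
  have hl2 : l ≤ 2 := by linarith
  interval_cases k <;> interval_cases l <;> first | (exfalso; omega) | skip
  all_goals refine ⟨by ring_nf; norm_num, ?_, by omega, by omega⟩
  all_goals ring_nf; norm_num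

/-- The discrete midpoint condition at distance two. -/
def MidCond {n : ℕ} (f : (Fin n → ℤ) → EReal) : Prop :=
  ∀ x y : Fin n → ℤ, f x ≠ ⊤ → f y ≠ ⊤ →
        (∀ i, |x i - y i| ≤ 2) → (∃ i, |x i - y i| = 2) →
        localExt f (fun i => ((x i : ℝ) + (y i : ℝ)) / 2) +
          localExt f (fun i => ((x i : ℝ) + (y i : ℝ)) / 2) ≤ f x + f y

theorem box_diam {n : ℕ} {f : (Fin n → ℤ) → EReal} {u : Fin n → ℝ} {y y' : Fin n → ℤ}
    (hy : y ∈ bigBox f u) (hy' : y' ∈ bigBox f u) (i : Fin n) : |y i - y' i| ≤ 2 := by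
  have h1 := abs_le.1 ((mem_bigBox.1 hy).2 i)
  have h2 := abs_le.1 ((mem_bigBox.1 hy').2 i)
  have : ((|y i - y' i| : ℤ) : ℝ) ≤ ((2 : ℤ) : ℝ) := by
    push_cast
    rw [abs_le]; constructor <;> linarith
  exact Int.cast_le.1 this

/-- Exchange step: data of a local representation of the midpoint. -/
theorem mid_rep {n : ℕ} {f : (Fin n → ℤ) → EReal} (hbot : ∀ x, f x ≠ ⊥) (hmid : MidCond f)
    {u : Fin n → ℝ} {y y' : Fin n → ℤ} (hy : y ∈ bigBox f u) (hy' : y' ∈ bigBox f u)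
    (hex : ∃ i, |y i - y' i| = 2) :
    ∃ μ, CRep (bigBox f u) (fun i => ((y i : ℝ) + (y' i : ℝ)) / 2) μ ∧
      2 * (∑ z ∈ bigBox f u, μ z * (f z).toReal) ≤ (f y).toReal + (f y').toReal ∧
      2 * (∑ z ∈ bigBox f u, μ z * ∑ i, (z i : ℝ) ^ 2) + 1
        ≤ ∑ i, (y i : ℝ) ^ 2 + ∑ i, (y' i : ℝ) ^ 2 := by
  have hd := box_diam hy hy'
  have hfy := (mem_bigBox.1 hy).1
  have hfy' := (mem_bigBox.1 hy').1
  have hc := hmid y y' hfy hfy' hd hex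
  set m : Fin n → ℝ := fun i => ((y i : ℝ) + (y' i : ℝ)) / 2 with hm
  rw [← EReal.coe_toReal hfy (hbot y), ← EReal.coe_toReal hfy' (hbot y'), ← EReal.coe_add] at hc
  have hne : localExt f m ≠ ⊤ := by
    intro h
    rw [h] at hc
    simp at hc
    exact EReal.coe_ne_top _ (by exact_mod_cast hc)
  obtain ⟨μ, hμ, hval⟩ := exists_rep hbot hne
  have hsub : smallBox f m ⊆ bigBox f u := by
    intro z hz
    obtain ⟨hz1, hz2⟩ := mem_smallBox.1 hz
    refine mem_bigBox.2 ⟨hz1, fun i => ?_⟩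
    obtain ⟨-, -, h3, h4⟩ := mid_int (hd i) (hz2 i)
    have h1 := abs_le.1 ((mem_bigBox.1 hy).2 i)
    have h2 := abs_le.1 ((mem_bigBox.1 hy').2 i)
    rw [abs_le]
    constructor
    · rcases le_max_iff.1 h4 with h | h
      · have : (z i : ℝ) ≤ y i := by exact_mod_cast h
        linarith
      · have : (z i : ℝ) ≤ y' i := by exact_mod_cast h
        linarith
    · rcases min_le_iff.1 h3 with h | h
      · have : (y i : ℝ) ≤ z i := by exact_mod_cast h
        linarith
      · have : (y' i : ℝ) ≤ z i := by exact_mod_cast h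
        linarith
  have hμ' := hμ.mono hsub
  refine ⟨μ, hμ', ?_, ?_⟩
  · rw [sum_change hμ.2.1 hμ'.2.1]
    rw [hval, ← EReal.coe_add, EReal.coe_le_coe_iff] at hc
    linarith
  · obtain ⟨k, hk⟩ := hex
    -- pointwise inequality, coordinate by coordinate
    have hpt : ∀ z ∈ bigBox f u, μ z * ∑ i, (((z i : ℝ) - y i) * ((z i : ℝ) - y' i)) ≤
        μ z * (-1) := by
      intro z _
      by_cases hz : z ∈ smallBox f m
      · refine mul_le_mul_of_nonneg_left ?_ (hμ.1 z)
        have hz2 := (mem_smallBox.1 hz).2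
        rw [← Finset.add_sum_erase _ _ (Finset.mem_univ k)]
        have h1 : ((z k : ℝ) - y k) * ((z k : ℝ) - y' k) ≤ -1 := by
          have := (mid_int (hd k) (hz2 k)).2.1 hk
          exact_mod_cast this
        have h2 : ∑ i ∈ Finset.univ.erase k, (((z i : ℝ) - y i) * ((z i : ℝ) - y' i)) ≤ 0 := by
          refine Finset.sum_nonpos fun i _ => ?_
          have := (mid_int (hd i) (hz2 i)).1
          exact_mod_cast this
        linarith
      · rw [hμ.2.1 z hz]; simp
    have hs := Finset.sum_le_sum hpt
    rw [← Finset.sum_mul, hμ'.2.2.1] at hs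
    have e1 : ∑ z ∈ bigBox f u, μ z * ∑ i, (((z i : ℝ) - y i) * ((z i : ℝ) - y' i))
        = ∑ z ∈ bigBox f u, μ z * ∑ i, (z i : ℝ) ^ 2
          - ∑ i, (y i + y' i : ℝ) * m i + ∑ i, (y i : ℝ) * y' i := by
      have : ∀ z : Fin n → ℤ, μ z * ∑ i, (((z i : ℝ) - y i) * ((z i : ℝ) - y' i))
          = μ z * ∑ i, (z i : ℝ) ^ 2 - ∑ i, (y i + y' i : ℝ) * (μ z * z i)
            + μ z * ∑ i, (y i : ℝ) * y' i := by
        intro z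
        rw [Finset.mul_sum, Finset.mul_sum, Finset.mul_sum, ← Finset.sum_sub_distrib,
          ← Finset.sum_add_distrib]
        exact Finset.sum_congr rfl fun i _ => by ring
      simp only [this]
      rw [Finset.sum_add_distrib, Finset.sum_sub_distrib, ← Finset.sum_mul, hμ'.2.2.1,
        Finset.sum_comm, one_mul]
      congr 2
      refine Finset.sum_congr rfl fun i _ => ?_
      rw [← Finset.mul_sum, hμ'.2.2.2 i]
    rw [e1] at hs
    have e2 : 2 * ∑ i, (y i + y' i : ℝ) * m i
        = ∑ i, (y i : ℝ) ^ 2 + ∑ i, (y' i : ℝ) ^ 2 + 2 * ∑ i, (y i : ℝ) * y' i := by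
      rw [Finset.mul_sum, Finset.mul_sum, ← Finset.sum_add_distrib, ← Finset.sum_add_distrib]
      exact Finset.sum_congr rfl fun i _ => by simp only [hm]; ring
    linarith

/-- Any representation of `u` in the closed box dominates the local convex extension. -/
theorem localExt_le_big {n : ℕ} {f : (Fin n → ℤ) → EReal} (hbot : ∀ x, f x ≠ ⊥)
    (hmid : MidCond f) {u : Fin n → ℝ} {w : (Fin n → ℤ) → ℝ} (h : CRep (bigBox f u) u w) :
    localExt f u ≤ ((∑ z ∈ bigBox f u, w z * (f z).toReal : ℝ) : EReal) := by
  classical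
  set T := bigBox f u with hT
  obtain ⟨w0, hw0, hmin0⟩ := (CRep.isCompact T u).exists_isMinOn ⟨w, h⟩
    (f := fun w => ∑ z ∈ T, w z * (f z).toReal) (by fun_prop)
  have hK : IsCompact ({w | CRep T u w} ∩
      {w | ∑ z ∈ T, w z * (f z).toReal ≤ ∑ z ∈ T, w0 z * (f z).toReal}) :=
    (CRep.isCompact T u).inter_right (isClosed_le (by fun_prop) continuous_const)
  obtain ⟨v, ⟨hv, hv0⟩, hmin⟩ := hK.exists_isMinOn ⟨w0, hw0, Set.mem_ofPred_eq ▸ le_rfl⟩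
    (f := fun w => ∑ z ∈ T, w z * ∑ i, (z i : ℝ) ^ 2) (by fun_prop)
  have hv' : CRep T u v := hv
  have hsupp : ∀ z, z ∉ smallBox f u → v z = 0 := by
    intro y hyn
    by_contra hvy
    have hyT : y ∈ T := by by_contra hc; exact hvy (hv'.2.1 y hc)
    have hyT' := mem_bigBox.1 hyT
    have : ∃ i, |u i - (y i : ℝ)| = 1 := by
      by_contra hc
      push Not at hc
      exact hyn (mem_smallBox.2 ⟨hyT'.1, fun i => lt_of_le_of_ne (hyT'.2 i) (hc i)⟩)
    obtain ⟨i, hi⟩ := this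
    have hypos : 0 < v y := lt_of_le_of_ne (hv'.1 y) (Ne.symm hvy)
    -- find an opposite point
    have hsum : ∑ z ∈ T, v z * ((u i - y i) * (u i - z i)) = 0 := by
      have : ∀ z : Fin n → ℤ, v z * ((u i - y i) * (u i - z i))
          = (u i - y i) * (v z * u i - v z * z i) := fun z => by ring
      simp only [this]
      rw [← Finset.mul_sum, Finset.sum_sub_distrib, ← Finset.sum_mul, hv'.2.2.1, hv'.2.2.2 i]
      ring
    have hsq : (u i - y i) * (u i - y i) = 1 := by
      rw [← abs_mul_abs_self, hi]; norm_num
    obtain ⟨y', hy'T, hneg⟩ : ∃ y' ∈ T, v y' * ((u i - y i) * (u i - y' i)) < 0 := by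
      by_contra hc
      push Not at hc
      have := (Finset.sum_eq_zero_iff_of_nonneg hc).1 hsum y hyT
      rw [hsq] at this
      linarith
    have hy'pos : 0 < v y' := by
      refine lt_of_le_of_ne (hv'.1 y') fun hc => ?_
      rw [← hc] at hneg; simp at hneg
    have hneg' : (u i - y i) * (u i - y' i) < 0 := by
      by_contra hc
      push Not at hc
      exact absurd hneg (not_lt.2 (mul_nonneg hy'pos.le hc))
    have hyy : |y i - y' i| = 2 := by
      have hle := box_diam hyT hy'T i
      refine le_antisymm hle ?_
      have h1 : (1 : ℝ) < |(y i : ℝ) - y' i| := by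
        rcases (abs_eq (by norm_num : (0:ℝ) ≤ 1)).1 hi with h1 | h1
        · rw [h1] at hneg'
          rw [lt_abs]; right; linarith
        · rw [h1] at hneg'
          rw [lt_abs]; left; linarith
      have h2 : ((1 : ℤ) : ℝ) < ((|y i - y' i| : ℤ) : ℝ) := by push_cast; exact h1
      have := Int.cast_lt.1 h2
      omega
    have hne : y ≠ y' := by
      rintro rfl
      simp at hyy
    obtain ⟨μ, hμ, hμc, hμψ⟩ := mid_rep hbot hmid hyT hy'T ⟨i, hyy⟩
    set α := min (v y) (v y') with hα
    have hαpos : 0 < α := lt_min hypos hy'pos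
    let v' : (Fin n → ℤ) → ℝ := fun z =>
      v z + α * (2 * μ z - (if y = z then 1 else 0) - (if y' = z then 1 else 0))
    have hL : ∀ φ : (Fin n → ℤ) → ℝ, ∑ z ∈ T, v' z * φ z
        = ∑ z ∈ T, v z * φ z + α * (2 * (∑ z ∈ T, μ z * φ z) - φ y - φ y') := by
      intro φ
      have e : ∀ z, v' z * φ z = v z * φ z + α * (2 * (μ z * φ z)
          - (if y = z then φ z else 0) - (if y' = z then φ z else 0)) := by
        intro z
        simp only [v']
        split_ifs <;> ring
      simp only [e]
      rw [Finset.sum_add_distrib, ← Finset.mul_sum, Finset.sum_sub_distrib,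
        Finset.sum_sub_distrib, ← Finset.mul_sum, Finset.sum_ite_eq, Finset.sum_ite_eq,
        if_pos hyT, if_pos hy'T]
    have hrep : CRep T u v' := by
      refine ⟨fun z => ?_, fun z hz => ?_, ?_, fun j => ?_⟩
      · have h1 := hv'.1 z
        have h2 : 0 ≤ α * μ z := mul_nonneg hαpos.le (hμ.1 z)
        have h3 : α ≤ v y := min_le_left _ _
        have h4 : α ≤ v y' := min_le_right _ _
        simp only [v']
        by_cases hz : y = z
        · have hz' : y' ≠ z := fun h => hne (hz.trans h.symm)
          rw [if_pos hz, if_neg hz']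
          rw [hz] at h3
          linarith
        · by_cases hz' : y' = z
          · rw [if_neg hz, if_pos hz']
            rw [hz'] at h4
            linarith
          · rw [if_neg hz, if_neg hz']
            linarith
      · have h1 : y ≠ z := fun h => hz (h ▸ hyT)
        have h2 : y' ≠ z := fun h => hz (h ▸ hy'T)
        simp [v', h1, h2, hv'.2.1 z hz, hμ.2.1 z hz]
      · have := hL (fun _ => 1)
        simp only [mul_one] at this
        rw [this, hv'.2.2.1, hμ.2.2.1]
        ring
      · rw [hL (fun z => (z j : ℝ)), hv'.2.2.2 j, hμ.2.2.2 j]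
        ring
    have hcost : ∑ z ∈ T, v' z * (f z).toReal ≤ ∑ z ∈ T, w0 z * (f z).toReal := by
      refine le_trans ?_ hv0
      rw [hL (fun z => (f z).toReal)]
      have : α * (2 * (∑ z ∈ T, μ z * (f z).toReal) - (f y).toReal - (f y').toReal) ≤ 0 :=
        mul_nonpos_of_nonneg_of_nonpos hαpos.le (by linarith)
      linarith
    have hcon : ∑ z ∈ T, v z * ∑ i, (z i : ℝ) ^ 2 ≤ ∑ z ∈ T, v' z * ∑ i, (z i : ℝ) ^ 2 :=
      hmin ⟨hrep, hcost⟩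
    rw [hL (fun z => ∑ i, (z i : ℝ) ^ 2)] at hcon
    have : α * (2 * (∑ z ∈ T, μ z * ∑ i, (z i : ℝ) ^ 2) - ∑ i, (y i : ℝ) ^ 2
        - ∑ i, (y' i : ℝ) ^ 2) < 0 := mul_neg_of_pos_of_neg hαpos (by linarith)
    linarith
  refine (localExt_le hbot (hv'.change hsupp)).trans ?_
  rw [EReal.coe_le_coe_iff, sum_change hv'.2.1 hsupp]
  exact le_trans hv0 (hmin0 h)

/-- Convexity along short segments. -/
theorem localExt_comb_le {n : ℕ} {f : (Fin n → ℤ) → EReal} (hbot : ∀ x, f x ≠ ⊥)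
    (hmid : MidCond f) {p q : Fin n → ℝ} {a b : ℝ} (ha : 0 ≤ a) (hb : 0 ≤ b) (hab : a + b = 1)
    (hp : localExt f p ≠ ⊤) (hq : localExt f q ≠ ⊤)
    (hpB : ∀ z ∈ intNbhd p, ∀ i, |(a * p i + b * q i) - (z i : ℝ)| ≤ 1)
    (hqB : ∀ z ∈ intNbhd q, ∀ i, |(a * p i + b * q i) - (z i : ℝ)| ≤ 1) :
    localExt f (fun i => a * p i + b * q i) ≤
      ((a * (localExt f p).toReal + b * (localExt f q).toReal : ℝ) : EReal) := by
  obtain ⟨w, hw, hwv⟩ := exists_rep hbot hp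
  obtain ⟨w', hw', hwv'⟩ := exists_rep hbot hq
  set u : Fin n → ℝ := fun i => a * p i + b * q i with hu
  have h1 : smallBox f p ⊆ bigBox f u := fun z hz =>
    mem_bigBox.2 ⟨(mem_smallBox.1 hz).1, hpB z (mem_smallBox.1 hz).2⟩
  have h2 : smallBox f q ⊆ bigBox f u := fun z hz =>
    mem_bigBox.2 ⟨(mem_smallBox.1 hz).1, hqB z (mem_smallBox.1 hz).2⟩
  have k1 := hw.mono h1
  have k2 := hw'.mono h2
  refine (localExt_le_big hbot hmid (k1.comb k2 ha hb hab)).trans (le_of_eq ?_)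
  rw [sum_comb, hwv, hwv', EReal.toReal_coe, EReal.toReal_coe, sum_change hw.2.1 k1.2.1,
    sum_change hw'.2.1 k2.2.1]

theorem eventually_nbhd_sub_box {n : ℕ} (u : Fin n → ℝ) :
    ∀ᶠ v in nhds u, ∀ z ∈ intNbhd v, ∀ i, |u i - (z i : ℝ)| ≤ 1 := by
  have h : ∀ i, ∀ᶠ v : Fin n → ℝ in nhds u, v i < ⌊u i⌋ + 1 ∧ ⌈u i⌉ - 1 < v i := by
    intro i
    have hc : Continuous fun v : Fin n → ℝ => v i := continuous_apply i
    refine (hc.continuousAt.eventually_lt continuousAt_const (Int.lt_floor_add_one (u i))).and ?_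
    refine continuousAt_const.eventually_lt hc.continuousAt ?_
    have := Int.ceil_lt_add_one (u i)
    linarith
  filter_upwards [Filter.eventually_all.2 h] with v hv z hz i
  obtain ⟨h1, h2⟩ := hv i
  have h3 := abs_lt.1 (hz i)
  have h4 : ((z i : ℤ) : ℝ) < ((⌊u i⌋ + 2 : ℤ) : ℝ) := by push_cast; linarith
  have h5 : ((⌈u i⌉ - 2 : ℤ) : ℝ) < ((z i : ℤ) : ℝ) := by push_cast; linarith
  have h4 := Int.cast_lt.1 h4
  have h5 := Int.cast_lt.1 h5
  have h6 : ((z i : ℤ) : ℝ) ≤ ((⌊u i⌋ + 1 : ℤ) : ℝ) := Int.cast_le.2 (by omega)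
  have h7 : ((⌈u i⌉ - 1 : ℤ) : ℝ) ≤ ((z i : ℤ) : ℝ) := Int.cast_le.2 (by omega)
  push_cast at h6 h7
  have h8 := Int.floor_le (u i)
  have h9 := Int.le_ceil (u i)
  rw [abs_le]; constructor <;> linarith

theorem eventually_nbhd_sub_nbhd {n : ℕ} (u : Fin n → ℝ) :
    ∀ᶠ v in nhds u, ∀ z ∈ intNbhd u, ∀ i, |v i - (z i : ℝ)| ≤ 1 := by
  have hfin : (intNbhd u).Finite := (box_finite u).subset fun z hz i => (hz i).le
  rw [Filter.eventually_all_finite hfin]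
  intro z hz
  rw [Filter.eventually_all]
  intro i
  have hc : Continuous fun v : Fin n → ℝ => |v i - (z i : ℝ)| := by fun_prop
  filter_upwards [hc.continuousAt.eventually_lt continuousAt_const (hz i)] with v hv
  exact hv.le

/-- A one-dimensional local-to-global principle. -/
theorem conv1d (g : ℝ → ℝ) (husc : UpperSemicontinuousOn g (Set.Icc 0 1))
    (hloc : ∀ s ∈ Set.Ioo (0:ℝ) 1, ∀ᶠ ε in nhds (0:ℝ), 2 * g s ≤ g (s + ε) + g (s - ε))
    {t : ℝ} (ht : t ∈ Set.Icc (0:ℝ) 1) : g t ≤ (1 - t) * g 0 + t * g 1 := by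
  by_contra hcon
  push Not at hcon
  set D := g t - ((1 - t) * g 0 + t * g 1) with hD
  have hDpos : 0 < D := by linarith
  let l : ℝ → ℝ := fun s => D * (s ^ 2 - s) - ((1 - s) * g 0 + s * g 1)
  have hlc : Continuous l := by fun_prop
  have hk : UpperSemicontinuousOn (fun s => g s + l s) (Set.Icc 0 1) :=
    husc.add hlc.continuousOn.upperSemicontinuousOn
  obtain ⟨s, hs, hmax⟩ := hk.exists_isMaxOn ⟨t, ht⟩ isCompact_Icc
  have hst : g t + l t ≤ g s + l s := hmax ht
  have htpos : 0 < g t + l t := by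
    have : g t + l t = D * (t ^ 2 - t + 1) := by simp only [l]; rw [hD]; ring
    rw [this]
    apply mul_pos hDpos
    nlinarith [sq_nonneg (t - 1 / 2)]
  have hs0 : s ≠ 0 := by
    rintro rfl
    simp [l] at hst htpos; linarith
  have hs1 : s ≠ 1 := by
    rintro rfl
    simp [l] at hst htpos; linarith
  have hsI : s ∈ Set.Ioo (0:ℝ) 1 :=
    ⟨lt_of_le_of_ne hs.1 (Ne.symm hs0), lt_of_le_of_ne hs.2 hs1⟩
  have hev : ∀ᶠ ε in nhds (0:ℝ), 2 * g s ≤ g (s + ε) + g (s - ε) ∧ ε < s ∧ ε < 1 - s :=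
    (hloc s hsI).and ((Filter.Tendsto.eventually_lt_const hsI.1 Filter.tendsto_id).and
      (Filter.Tendsto.eventually_lt_const (sub_pos.2 hsI.2) Filter.tendsto_id))
  obtain ⟨ε, ⟨h1, h2, h3⟩, hε⟩ :=
    ((hev.filter_mono nhdsWithin_le_nhds).and (self_mem_nhdsWithin (s := Set.Ioi (0:ℝ)))).exists
  have hε : 0 < ε := hε
  have m1 : g (s + ε) + l (s + ε) ≤ g s + l s := hmax ⟨by linarith [hs.1], by linarith⟩
  have m2 : g (s - ε) + l (s - ε) ≤ g s + l s := hmax ⟨by linarith, by linarith [hs.2]⟩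
  have : l (s + ε) + l (s - ε) = 2 * l s + 2 * D * ε ^ 2 := by simp only [l]; ring
  have : 0 < D * ε ^ 2 := by positivity
  linarith

theorem seg_usc {n : ℕ} {f : (Fin n → ℤ) → EReal} (hbot : ∀ x, f x ≠ ⊥)
    (hmid : MidCond f) {u v : Fin n → ℝ}
    (hfin : ∀ θ ∈ Set.Icc (0:ℝ) 1, localExt f (fun i => (1 - θ) * u i + θ * v i) ≠ ⊤)
    {M : ℝ} (hM : (localExt f u).toReal < M) :
    ∀ᶠ θ in nhds (0:ℝ), 0 ≤ θ →
      (localExt f (fun i => (1 - θ) * u i + θ * v i)).toReal < M := by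
  have hu : localExt f u ≠ ⊤ := by
    have := hfin 0 ⟨le_refl _, zero_le_one⟩
    simpa using this
  have hc : Continuous fun θ : ℝ => (fun i => (1 - θ) * u i + θ * v i) := by fun_prop
  have hc0 : Filter.Tendsto (fun θ : ℝ => (fun i => (1 - θ) * u i + θ * v i)) (nhds 0)
      (nhds u) := by
    have := hc.tendsto 0
    simpa using this
  have hev := (hc0.eventually (eventually_nbhd_sub_box u)).and
    ((hc0.eventually (eventually_nbhd_sub_nbhd u)).and
      (Filter.Tendsto.eventually_lt_const (zero_lt_one' ℝ) Filter.tendsto_id))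
  obtain ⟨δ, ⟨h1, h2, h3⟩, hδ⟩ :=
    ((hev.filter_mono nhdsWithin_le_nhds).and (self_mem_nhdsWithin (s := Set.Ioi (0:ℝ)))).exists
  have hδ : 0 < δ := hδ
  have h3 : δ < 1 := h3
  set q : Fin n → ℝ := fun i => (1 - δ) * u i + δ * v i with hq
  have hqf : localExt f q ≠ ⊤ := hfin δ ⟨hδ.le, h3.le⟩
  have hcb : Continuous fun θ : ℝ =>
      (1 - θ / δ) * (localExt f u).toReal + θ / δ * (localExt f q).toReal := by fun_prop
  have hlt : ∀ᶠ θ in nhds (0:ℝ),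
      (1 - θ / δ) * (localExt f u).toReal + θ / δ * (localExt f q).toReal < M :=
    hcb.continuousAt.eventually_lt continuousAt_const (by simpa using hM)
  filter_upwards [hlt, Filter.Tendsto.eventually_lt_const hδ Filter.tendsto_id] with θ hθ1 hθ2 hθ0
  have hθ2 : θ < δ := hθ2
  have ha1 : θ / δ ≤ 1 := (div_le_one hδ).2 hθ2.le
  have ha0 : 0 ≤ θ / δ := div_nonneg hθ0 hδ.le
  have hmix : ∀ A B z : ℝ, |A - z| ≤ 1 → |B - z| ≤ 1 →
      |((1 - θ / δ) * A + θ / δ * B) - z| ≤ 1 := by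
    intro A B z hA hB
    rw [abs_le] at *
    constructor <;> nlinarith
  have key := localExt_comb_le hbot hmid (p := u) (q := q) (sub_nonneg.2 ha1) ha0 (by ring)
    hu hqf (fun z hz i => hmix _ _ _ (hz i).le (h2 z hz i))
    (fun z hz i => hmix _ _ _ (h1 z hz i) (hz i).le)
  have heq : (fun i => (1 - θ / δ) * u i + θ / δ * q i)
      = (fun i => (1 - θ) * u i + θ * v i) := by
    ext i
    simp only [hq]
    field_simp
    ring
  rw [heq] at key
  have hf := hfin θ ⟨hθ0, by linarith⟩
  obtain ⟨w, -, hwv⟩ := exists_rep hbot hf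
  rw [hwv, EReal.coe_le_coe_iff] at key
  rw [hwv, EReal.toReal_coe]
  linarith

theorem mid_loc {n : ℕ} {f : (Fin n → ℤ) → EReal} (hbot : ∀ x, f x ≠ ⊥)
    (hmid : MidCond f) {u p q : Fin n → ℝ} (hpq : ∀ i, 2 * u i = p i + q i)
    (hu : localExt f u ≠ ⊤) (hp : localExt f p ≠ ⊤) (hq : localExt f q ≠ ⊤)
    (hpB : ∀ z ∈ intNbhd p, ∀ i, |u i - (z i : ℝ)| ≤ 1)
    (hqB : ∀ z ∈ intNbhd q, ∀ i, |u i - (z i : ℝ)| ≤ 1) :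
    2 * (localExt f u).toReal ≤ (localExt f p).toReal + (localExt f q).toReal := by
  have heq : u = fun i => (1 / 2 : ℝ) * p i + (1 / 2 : ℝ) * q i := by
    ext i; linarith [hpq i]
  have hi : ∀ i, (1 / 2 : ℝ) * p i + (1 / 2 : ℝ) * q i = u i := fun i => by linarith [hpq i]
  have key := localExt_comb_le hbot hmid (p := p) (q := q) (a := 1 / 2) (b := 1 / 2)
    (by norm_num) (by norm_num) (by norm_num) hp hq
    (by simpa only [hi] using hpB) (by simpa only [hi] using hqB)
  rw [← heq] at key
  obtain ⟨w, -, hwv⟩ := exists_rep hbot hu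
  rw [hwv, EReal.coe_le_coe_iff] at key
  rw [hwv, EReal.toReal_coe]
  linarith

theorem convex_of_mid {n : ℕ} {f : (Fin n → ℤ) → EReal} (hbot : ∀ x, f x ≠ ⊥)
    (hdom : IsIntegrallyConvexSet {x : Fin n → ℤ | f x ≠ ⊤}) (hmid : MidCond f) :
    IsIntegrallyConvexFn f := by
  have hnb : ∀ u, localExt f u ≠ ⊥ := by
    intro u h
    obtain ⟨w, -, hwv⟩ := exists_rep (u := u) hbot (by rw [h]; exact bot_ne_top)
    rw [hwv] at h
    exact EReal.coe_ne_bot _ h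
  intro x y t ht0 ht1
  rcases ht0.eq_or_lt with rfl | ht0'
  · simp
  rcases ht1.eq_or_lt with rfl | ht1'
  · simp
  have ht1'' : 0 < 1 - t := by linarith
  have hmb : ∀ (r : ℝ) (u : Fin n → ℝ), 0 < r → ((r : ℝ) : EReal) * localExt f u ≠ ⊥ := by
    intro r u hr
    rw [ne_eq, EReal.mul_eq_bot]
    simp [hnb, hr.le.not_gt]
  by_cases hx : localExt f x = ⊤
  · rw [hx, EReal.coe_mul_top_of_pos ht0', EReal.top_add_of_ne_bot (hmb _ _ ht1'')]
    exact le_top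
  by_cases hy : localExt f y = ⊤
  · rw [hy, EReal.coe_mul_top_of_pos ht1'', EReal.add_top_of_ne_bot (hmb _ _ ht0')]
    exact le_top
  -- everything is finite on the segment
  let p : ℝ → Fin n → ℝ := fun s i => s * x i + (1 - s) * y i
  have hfin : ∀ s ∈ Set.Icc (0:ℝ) 1, localExt f (p s) ≠ ⊤ := by
    intro s hs
    obtain ⟨w, hw, -⟩ := exists_rep hbot hx
    obtain ⟨w', hw', -⟩ := exists_rep hbot hy
    have h1 := hw.mem_hull (S := {x : Fin n → ℤ | f x ≠ ⊤}) fun z hz => (mem_smallBox.1 hz).1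
    have h2 := hw'.mem_hull (S := {x : Fin n → ℤ | f x ≠ ⊤}) fun z hz => (mem_smallBox.1 hz).1
    have h3 : p s ∈ convexHull ℝ (realify '' {x : Fin n → ℤ | f x ≠ ⊤}) :=
      (convex_convexHull ℝ _) h1 h2 hs.1 (sub_nonneg.2 hs.2) (by ring)
    obtain ⟨w'', hw''⟩ := rep_of_hull (hdom _ h3)
    exact ne_top_of_le_ne_top (EReal.coe_ne_top _) (localExt_le hbot hw'')
  have hpc : Continuous p := by
    refine continuous_pi fun i => ?_
    fun_prop
  have hp0 : p 0 = y := by ext i; simp [p]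
  have hp1 : p 1 = x := by ext i; simp [p]
  have hpp : ∀ s r θ : ℝ, (fun i => (1 - θ) * p s i + θ * p r i) = p (s + θ * (r - s)) := by
    intro s r θ
    ext i
    simp only [p]
    ring
  have husc : UpperSemicontinuousOn (fun s => (localExt f (p s)).toReal) (Set.Icc 0 1) := by
    intro s hs M hM
    have hseg : ∀ r ∈ Set.Icc (0:ℝ) 1, ∀ᶠ θ in nhds (0:ℝ), 0 ≤ θ →
        (localExt f (p (s + θ * (r - s)))).toReal < M := by
      intro r hr
      have := seg_usc hbot hmid (u := p s) (v := p r) (M := M) (by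
        intro θ hθ
        rw [hpp]
        apply hfin
        constructor
        · nlinarith [mul_nonneg (sub_nonneg.2 hθ.2) hs.1, mul_nonneg hθ.1 hr.1]
        · nlinarith [mul_nonneg (sub_nonneg.2 hθ.2) (sub_nonneg.2 hs.2),
            mul_nonneg hθ.1 (sub_nonneg.2 hr.2)]) hM
      simpa only [hpp] using this
    have hR : Filter.Tendsto (fun τ : ℝ => (τ - s) / (1 - s)) (nhds s) (nhds 0) := by
      have : Continuous (fun τ : ℝ => (τ - s) / (1 - s)) := by fun_prop
      simpa using this.tendsto s
    have hL : Filter.Tendsto (fun τ : ℝ => (s - τ) / s) (nhds s) (nhds 0) := by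
      have : Continuous (fun τ : ℝ => (s - τ) / s) := by fun_prop
      simpa using this.tendsto s
    have eR := (hR.eventually (hseg 1 ⟨zero_le_one, le_refl _⟩)).filter_mono
      (nhdsWithin_le_nhds (s := Set.Icc (0:ℝ) 1))
    have eL := (hL.eventually (hseg 0 ⟨le_refl _, zero_le_one⟩)).filter_mono
      (nhdsWithin_le_nhds (s := Set.Icc (0:ℝ) 1))
    filter_upwards [eR, eL, self_mem_nhdsWithin] with τ h1 h2 hτ
    rcases le_total s τ with hle | hle
    · have h3 := h1 (div_nonneg (sub_nonneg.2 hle) (sub_nonneg.2 hs.2))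
      have : s + (τ - s) / (1 - s) * (1 - s) = τ := by
        rcases hs.2.eq_or_lt with h | h
        · have : τ = 1 := le_antisymm hτ.2 (h ▸ hle)
          simp [h, this]
        · rw [div_mul_cancel₀ _ (by linarith)]; ring
      rwa [this] at h3
    · have h3 := h2 (div_nonneg (sub_nonneg.2 hle) hs.1)
      have : s + (s - τ) / s * (0 - s) = τ := by
        rcases hs.1.eq_or_lt with h | h
        · have : τ = 0 := le_antisymm (h ▸ hle) hτ.1
          simp [← h, this]
        · have : (s - τ) / s * s = s - τ := div_mul_cancel₀ _ h.ne'
          linarith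
      rwa [this] at h3
  have hloc : ∀ s ∈ Set.Ioo (0:ℝ) 1, ∀ᶠ ε in nhds (0:ℝ),
      2 * (localExt f (p s)).toReal ≤
        (localExt f (p (s + ε))).toReal + (localExt f (p (s - ε))).toReal := by
    intro s hs
    have t1 : Filter.Tendsto (fun ε : ℝ => p (s + ε)) (nhds 0) (nhds (p s)) := by
      have : Continuous (fun ε : ℝ => p (s + ε)) := by fun_prop
      simpa using this.tendsto 0
    have t2 : Filter.Tendsto (fun ε : ℝ => p (s - ε)) (nhds 0) (nhds (p s)) := by
      have : Continuous (fun ε : ℝ => p (s - ε)) := by fun_prop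
      simpa using this.tendsto 0
    have hsm : ∀ᶠ ε : ℝ in nhds 0, |ε| < min s (1 - s) := by
      have : Continuous (fun ε : ℝ => |ε|) := continuous_abs
      exact this.continuousAt.eventually_lt continuousAt_const
        (by simpa using ⟨hs.1, hs.2⟩)
    filter_upwards [t1.eventually (eventually_nbhd_sub_box (p s)),
      t2.eventually (eventually_nbhd_sub_box (p s)), hsm] with ε h1 h2 h3
    obtain ⟨h4, h5⟩ := lt_min_iff.1 h3
    have h6 := abs_lt.1 h4
    have h7 := abs_lt.1 h5
    refine mid_loc hbot hmid (fun i => by simp only [p]; ring) (hfin s ⟨hs.1.le, hs.2.le⟩)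
      (hfin _ ⟨by linarith, by linarith⟩) (hfin _ ⟨by linarith, by linarith⟩) h1 h2
  have hfinal := conv1d (fun s => (localExt f (p s)).toReal) husc hloc (t := t) ⟨ht0, ht1⟩
  simp only [hp0, hp1] at hfinal
  change localExt f (p t) ≤ _
  rw [← EReal.coe_toReal (hfin t ⟨ht0, ht1⟩) (hnb _), ← EReal.coe_toReal hx (hnb _),
    ← EReal.coe_toReal hy (hnb _), ← EReal.coe_mul, ← EReal.coe_mul, ← EReal.coe_add,
    EReal.coe_le_coe_iff]
  linarith

theorem localExt_int_le_s12 {n : ℕ} (f : (Fin n → ℤ) → EReal) (x : Fin n → ℤ) :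
    localExt f (realify x) ≤ f x := by
  refine sInf_le ⟨1, fun _ => 1, fun _ => x, ?_, ?_, ?_, ?_, ?_⟩
  · intro j; exact zero_le_one
  · simp
  · intro j i; simp [realify]
  · intro i; simp [realify]
  · simp

theorem mid_of_convex {n : ℕ} {f : (Fin n → ℤ) → EReal} (hbot : ∀ x, f x ≠ ⊥)
    (h : IsIntegrallyConvexFn f) : MidCond f := by
  intro x y hx hy _ _
  have key := h (realify x) (realify y) (1 / 2) (by norm_num) (by norm_num)
  have heq : (fun i => (1 / 2 : ℝ) * realify x i + (1 - 1 / 2) * realify y i)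
      = fun i => ((x i : ℝ) + (y i : ℝ)) / 2 := by
    ext i; simp only [realify]; ring
  rw [heq] at key
  have hp : (0 : EReal) ≤ ((1 / 2 : ℝ) : EReal) := by exact_mod_cast (by norm_num : (0:ℝ) ≤ 1 / 2)
  have hp' : (0 : EReal) ≤ ((1 - 1 / 2 : ℝ) : EReal) := by
    exact_mod_cast (by norm_num : (0:ℝ) ≤ 1 - 1 / 2)
  have k2 := key.trans (add_le_add (mul_le_mul_of_nonneg_left (localExt_int_le_s12 f x) hp)
    (mul_le_mul_of_nonneg_left (localExt_int_le_s12 f y) hp'))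
  refine (add_le_add k2 k2).trans (le_of_eq ?_)
  rw [← EReal.coe_toReal hx (hbot x), ← EReal.coe_toReal hy (hbot y)]
  norm_cast
  ring

/-- Local characterization of integral convexity of a function whose
effective domain is an integrally convex set. -/
theorem integral_convexity_local_characterization {n : ℕ}
    (f : (Fin n → ℤ) → EReal) (hbot : ∀ x, f x ≠ ⊥)
    (hdom : IsIntegrallyConvexSet {x : Fin n → ℤ | f x ≠ ⊤}) :
    IsIntegrallyConvexFn f ↔
      ∀ x y : Fin n → ℤ, f x ≠ ⊤ → f y ≠ ⊤ →
        (∀ i, |x i - y i| ≤ 2) → (∃ i, |x i - y i| = 2) →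
        localExt f (fun i => ((x i : ℝ) + (y i : ℝ)) / 2) +
          localExt f (fun i => ((x i : ℝ) + (y i : ℝ)) / 2) ≤ f x + f y :=
  ⟨mid_of_convex hbot, convex_of_mid hbot hdom⟩
end
end

section
/- Let f : ℤⁿ → ℝ ∪ {+∞} be integrally convex with dom f a bounded subset of ℤ₊ⁿ containing the origin, and suppose f(0) ≤ f(α·𝟙_A) for all A ⊆ {1,…,n}, where α is a positive integer. If x* ∈ argmin f is f-minimal (i.e., the unique minimizer of f restricted to the interval [0, x*]) and x₁* ≥ x₂* ≥ ⋯ ≥ xₙ*, then ∑_{i=1}^{n−1}(x_i* − xₙ*) ≥ xₙ* − α + 1 and ∑_{i=2}^{n}(x₁* − x_i*) ≥ x₁* − α + 1; consequently xₙ* ≤ ((n−1)/(n+1))·x₁* + 2(α−1)/(n+1). -/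
open scoped BigOperators

noncomputable section

lemma localExt_realify_le {n : ℕ} (f : (Fin n → ℤ) → EReal) (a : Fin n → ℤ) :
    localExt f (realify a) ≤ f a := by
  apply sInf_le
  refine ⟨1, fun _ => 1, fun _ => a, by simp, by simp, ?_, ?_, by simp⟩
  · intro j i
    simp [realify]
  · intro i
    simp [realify]

lemma sum_ne_bot_aux {ι : Type*} (s : Finset ι) (g : ι → EReal) (hg : ∀ j ∈ s, g j ≠ ⊥) :
    ∑ j ∈ s, g j ≠ ⊥ := by
  classical
  induction s using Finset.induction_on with
  | empty => simp
  | insert a s ha ih =>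
    rw [Finset.sum_insert ha]
    intro h
    rcases EReal.add_eq_bot_iff.1 h with h | h
    · exact hg a (by simp) h
    · exact ih (fun j hj => hg j (by simp [hj])) h

lemma sum_coe_aux {ι : Type*} (s : Finset ι) (g : ι → ℝ) :
    ∑ j ∈ s, ((g j : ℝ) : EReal) = ((∑ j ∈ s, g j : ℝ) : EReal) := by
  classical
  induction s using Finset.induction_on with
  | empty => simp
  | insert a s ha ih =>
    rw [Finset.sum_insert ha, Finset.sum_insert ha, ih, EReal.coe_add]

lemma mid_combo {n : ℕ} (f : (Fin n → ℤ) → EReal) (hbot : ∀ x, f x ≠ ⊥)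
    (hf : IsIntegrallyConvexFn f) (a b : Fin n → ℤ) (ha : f a ≠ ⊤) (hb : f b ≠ ⊤)
    (ε : ℝ) (hε : 0 < ε) :
    ∃ (m : ℕ) (lam : Fin m → ℝ) (y : Fin m → (Fin n → ℤ)),
      (∀ j, 0 ≤ lam j) ∧ (∑ j, lam j) = 1 ∧
      (∀ j i, |((a i : ℝ) + b i) / 2 - (y j i : ℝ)| < 1) ∧
      (∀ i, (∑ j, lam j * ((y j i : ℝ))) = ((a i : ℝ) + b i) / 2) ∧
      (∀ j, lam j ≠ 0 → f (y j) ≠ ⊤) ∧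
      ∑ j, lam j * (f (y j)).toReal < ((f a).toReal + (f b).toReal) / 2 + ε := by
  have h := hf (realify a) (realify b) (1/2) (by norm_num) (by norm_num)
  have h2 : (((1/2 : ℝ)) : EReal) * localExt f (realify a) +
      (((1 - 1/2 : ℝ)) : EReal) * localExt f (realify b) ≤
      ((((f a).toReal + (f b).toReal) / 2 : ℝ) : EReal) := by
    have e : ((((f a).toReal + (f b).toReal) / 2 : ℝ) : EReal) =
        (((1/2 : ℝ)) : EReal) * f a + (((1 - 1/2 : ℝ)) : EReal) * f b := by
      conv_rhs => rw [← EReal.coe_toReal ha (hbot a), ← EReal.coe_toReal hb (hbot b)]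
      rw [← EReal.coe_mul, ← EReal.coe_mul, ← EReal.coe_add]
      congr 1
      ring
    rw [e]
    apply add_le_add
    · exact mul_le_mul_of_nonneg_left (localExt_realify_le f a) (by exact_mod_cast (by norm_num : (0:ℝ) ≤ 1/2))
    · exact mul_le_mul_of_nonneg_left (localExt_realify_le f b) (by exact_mod_cast (by norm_num : (0:ℝ) ≤ 1 - 1/2))
  have h3 : localExt f (fun i => (1/2) * realify a i + (1 - 1/2) * realify b i) <
      ((((f a).toReal + (f b).toReal) / 2 + ε : ℝ) : EReal) :=
    lt_of_le_of_lt (h.trans h2) (by exact_mod_cast (by linarith))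
  have hmid : (fun i => (1/2) * realify a i + (1 - 1/2) * realify b i) =
      (fun i => ((a i : ℝ) + b i) / 2) := by
    funext i
    simp only [realify]
    ring
  rw [hmid] at h3
  obtain ⟨v, ⟨m, lam, y, h0, h1, hN, hx, hv⟩, hlt⟩ := sInf_lt_iff.1 h3
  have hnb : ∀ j, ((lam j : ℝ) : EReal) * f (y j) ≠ ⊥ := by
    intro j hj
    rcases eq_or_lt_of_le (h0 j) with h | h
    · rw [← h] at hj
      simp at hj
    · rcases EReal.mul_eq_bot _ _ |>.1 hj with h' | h' | h' | h'
      · simp at h'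
      · exact hbot _ h'.2
      · simp at h'
      · have := h'.1
        have h5 : lam j < 0 := by exact_mod_cast this
        linarith
  have hnt : ∀ j, lam j ≠ 0 → f (y j) ≠ ⊤ := by
    intro j hj ht
    have hp : 0 < lam j := lt_of_le_of_ne (h0 j) (Ne.symm hj)
    have hs : v = ⊤ := by
      rw [hv, ← Finset.add_sum_erase _ _ (Finset.mem_univ j), ht, EReal.coe_mul_top_of_pos hp]
      exact EReal.top_add_of_ne_bot (sum_ne_bot_aux _ _ (fun k _ => hnb k))
    rw [hs] at hlt
    simp at hlt
  refine ⟨m, lam, y, h0, h1, hN, hx, hnt, ?_⟩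
  have : v = ((∑ j, lam j * (f (y j)).toReal : ℝ) : EReal) := by
    rw [hv, ← sum_coe_aux]
    apply Finset.sum_congr rfl
    intro j _
    by_cases hj : lam j = 0
    · simp [hj]
    · rw [EReal.coe_mul, EReal.coe_toReal (hnt j hj) (hbot _)]
  rw [this] at hlt
  exact_mod_cast hlt

lemma abs_linear {m : ℕ} (lam : Fin m → ℝ) (c : Fin m → ℤ) (x : ℝ) (k : ℤ)
    (h1 : ∑ j, lam j = 1) (hN : ∀ j, |x - (c j : ℝ)| < 1)
    (hx : ∑ j, lam j * (c j : ℝ) = x) :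
    ∑ j, lam j * |(k : ℝ) - c j| = |(k : ℝ) - x| := by
  rcases le_total (k : ℝ) x with h | h
  · rw [abs_of_nonpos (by linarith)]
    have : ∀ j, lam j * |(k : ℝ) - c j| = lam j * (c j : ℝ) - lam j * k := by
      intro j
      have h2 := (abs_lt.1 (hN j)).2
      have h3 : k < c j + 1 := by
        have : (k : ℝ) < (c j : ℝ) + 1 := by linarith
        exact_mod_cast this
      have h4 : (k : ℝ) ≤ c j := by exact_mod_cast (by omega : k ≤ c j)
      have h5 := abs_of_nonpos (by linarith : (k : ℝ) - c j ≤ 0)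
      rw [h5]
      ring
    simp only [this]
    rw [Finset.sum_sub_distrib, ← Finset.sum_mul, h1, hx]
    ring
  · rw [abs_of_nonneg (by linarith)]
    have : ∀ j, lam j * |(k : ℝ) - c j| = lam j * k - lam j * (c j : ℝ) := by
      intro j
      have h2 := (abs_lt.1 (hN j)).1
      have h3 : c j < k + 1 := by
        have : (c j : ℝ) < (k : ℝ) + 1 := by linarith
        exact_mod_cast this
      have h4 : (c j : ℝ) ≤ k := by exact_mod_cast (by omega : c j ≤ k)
      have h5 := abs_of_nonneg (by linarith : 0 ≤ (k : ℝ) - c j)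
      rw [h5]
      ring
    simp only [this]
    rw [Finset.sum_sub_distrib, ← Finset.sum_mul, h1, hx]
    ring

/-- `ℓ¹` distance of integer points. -/
def dist1 {n : ℕ} (x y : Fin n → ℤ) : ℝ := ∑ k, |(x k : ℝ) - y k|

/-- The abstract regularised midpoint inequality. -/
lemma reg_mid {n : ℕ} (f : (Fin n → ℤ) → EReal) (hbot : ∀ x, f x ≠ ⊥)
    (hf : IsIntegrallyConvexFn f) (M : ℝ) (hM : 0 ≤ M) (h : (Fin n → ℤ) → ℝ)
    (hle : ∀ x w, f w ≠ ⊤ → h x ≤ (f w).toReal + M * dist1 x w)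
    (hex : ∀ x, ∃ w, f w ≠ ⊤ ∧ h x = (f w).toReal + M * dist1 x w)
    (u v p q : Fin n → ℤ) (huv : ∀ k, u k + v k = p k + q k)
    (i : Fin n) (hpq : ∀ k, k ≠ i → p k = q k) (hi : q i = p i ∨ q i = p i + 1) :
    h p + h q ≤ h u + h v := by
  obtain ⟨a, ha, hua⟩ := hex u
  obtain ⟨b, hb, hvb⟩ := hex v
  apply le_of_forall_pos_le_add
  intro ε hε
  obtain ⟨m, lam, y, h0, h1, hN, hx, hnt, hlt⟩ := mid_combo f hbot hf a b ha hb (ε/2) (by linarith)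
  -- the key bound
  have hlin : ∀ (k : Fin n) (t : ℤ), ∑ j, lam j * |(t : ℝ) - y j k| =
      |(t : ℝ) - ((a k : ℝ) + b k) / 2| := fun k t =>
    abs_linear lam (fun j => y j k) _ t h1 (fun j => hN j k) (hx k)
  have htri : ∑ k, |((p k : ℝ) + q k) / 2 - ((a k : ℝ) + b k) / 2| ≤
      (dist1 u a + dist1 v b) / 2 := by
    unfold dist1
    rw [← Finset.sum_add_distrib, Finset.sum_div]
    apply Finset.sum_le_sum
    intro k _
    have e : ((p k : ℝ) + q k) = (u k : ℝ) + v k := by exact_mod_cast (huv k).symm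
    rw [e]
    have := abs_add_le (((u k : ℝ) - a k) / 2) (((v k : ℝ) - b k) / 2)
    rw [abs_div, abs_div] at this
    norm_num at this
    calc _ = |((u k : ℝ) - a k) / 2 + ((v k : ℝ) - b k) / 2| := by congr 1; ring
      _ ≤ _ := by linarith
  -- weights on p for each j
  have hweights : ∃ θ : Fin m → ℝ, (∀ j, 0 ≤ θ j ∧ θ j ≤ 1) ∧ ∑ j, lam j * θ j = 1/2 ∧
      ∑ j, lam j * (θ j * |(p i : ℝ) - y j i| + (1 - θ j) * |(q i : ℝ) - y j i|) ≤
        |((p i : ℝ) + q i) / 2 - ((a i : ℝ) + b i) / 2| := by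
    by_cases hA : q i = p i ∨ ∃ t : ℤ, a i + b i = 2 * t
    · refine ⟨fun _ => 1/2, fun _ => by norm_num, by rw [← Finset.sum_mul, h1]; norm_num, ?_⟩
      have : ∀ j, lam j * ((1/2) * |(p i : ℝ) - y j i| + (1 - 1/2) * |(q i : ℝ) - y j i|) =
          (lam j * |(p i : ℝ) - y j i|) * (1/2) + (lam j * |(q i : ℝ) - y j i|) * (1/2) := by
        intro j; ring
      simp only [this]
      rw [Finset.sum_add_distrib, ← Finset.sum_mul, ← Finset.sum_mul, hlin, hlin]
      by_cases hqp : q i = p i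
      · rw [hqp]
        apply le_of_eq
        rw [show ((p i : ℝ) + p i) / 2 = p i by ring]
        ring
      · have hq : q i = p i + 1 := by tauto
        obtain ⟨t, ht⟩ : ∃ t : ℤ, a i + b i = 2 * t := by tauto
        have ht' : (a i : ℝ) + b i = 2 * t := by exact_mod_cast ht
        rw [ht', hq]
        push_cast
        rcases le_or_gt t (p i) with hc | hc
        · have : (t : ℝ) ≤ p i := by exact_mod_cast hc
          rw [abs_of_nonneg (by linarith), abs_of_nonneg (by linarith), abs_of_nonneg (by linarith)]
          linarith
        · have : (p i : ℝ) + 1 ≤ t := by exact_mod_cast hc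
          rw [abs_of_nonpos (by linarith), abs_of_nonpos (by linarith), abs_of_nonpos (by linarith)]
          linarith
    · push Not at hA
      have hq : q i = p i + 1 := by tauto
      obtain ⟨t, ht⟩ : ∃ t : ℤ, a i + b i = 2 * t + 1 := by
        rcases Int.even_or_odd' (a i + b i) with ⟨t, h | h⟩
        · exact absurd h (hA.2 t)
        · exact ⟨t, h⟩
      have ht' : ((a i : ℝ) + b i) / 2 = t + 1/2 := by
        have : (a i : ℝ) + b i = 2 * t + 1 := by exact_mod_cast ht
        linarith
      have hy : ∀ j, y j i = t ∨ y j i = t + 1 := by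
        intro j
        have := abs_lt.1 (hN j i)
        rw [ht'] at this
        have h6 : (y j i : ℝ) < ((t + 2 : ℤ) : ℝ) := by push_cast; linarith
        have h7 : ((t - 1 : ℤ) : ℝ) < (y j i : ℝ) := by push_cast; linarith
        have h6' : y j i < t + 2 := by exact_mod_cast h6
        have h7' : t - 1 < y j i := by exact_mod_cast h7
        omega
      refine ⟨fun j => (t : ℝ) + 1 - y j i, ?_, ?_, ?_⟩
      · intro j
        dsimp only
        rcases hy j with h | h <;> rw [h] <;> push_cast <;> constructor <;> linarith
      · have : ∀ j, lam j * ((t : ℝ) + 1 - y j i) = lam j * ((t : ℝ) + 1) - lam j * y j i := by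
          intro j; ring
        simp only [this]
        rw [Finset.sum_sub_distrib, ← Finset.sum_mul, h1, hx, ht']
        ring
      · have : ∀ j, lam j * (((t : ℝ) + 1 - y j i) * |(p i : ℝ) - y j i| +
            (1 - ((t : ℝ) + 1 - y j i)) * |(q i : ℝ) - y j i|) = lam j * |(p i : ℝ) - t| := by
          intro j
          rw [hq]
          rcases hy j with h | h <;> rw [h] <;> push_cast
          · ring
          · rw [show (p i : ℝ) + 1 - (t + 1) = p i - t by ring]
            ring
        simp only [this]
        rw [← Finset.sum_mul, h1, ht', hq]
        push_cast
        apply le_of_eq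
        rw [one_mul]
        congr 1
        ring
  obtain ⟨θ, hθ, hθs, hθi⟩ := hweights
  -- total distances
  have hdist : ∑ j, lam j * (θ j * dist1 p (y j) + (1 - θ j) * dist1 q (y j)) ≤
      (dist1 u a + dist1 v b) / 2 := by
    refine le_trans ?_ htri
    have e : ∀ j, lam j * (θ j * dist1 p (y j) + (1 - θ j) * dist1 q (y j)) =
        ∑ k, lam j * (θ j * |(p k : ℝ) - y j k| + (1 - θ j) * |(q k : ℝ) - y j k|) := by
      intro j
      unfold dist1
      rw [← Finset.mul_sum, Finset.sum_add_distrib, Finset.mul_sum, Finset.mul_sum]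
    simp only [e]
    rw [Finset.sum_comm]
    apply Finset.sum_le_sum
    intro k _
    by_cases hk : k = i
    · subst hk
      exact hθi
    · rw [← hpq k hk, show ((p k : ℝ) + p k) / 2 = p k by ring, ← hlin k (p k)]
      apply le_of_eq
      apply Finset.sum_congr rfl
      intro j _
      ring
  have hkey : (h p + h q) / 2 ≤ ∑ j, lam j * (f (y j)).toReal +
      M * ∑ j, lam j * (θ j * dist1 p (y j) + (1 - θ j) * dist1 q (y j)) := by
    have e : (h p + h q) / 2 = ∑ j, lam j * (θ j * h p + (1 - θ j) * h q) := by
      have : ∀ j, lam j * (θ j * h p + (1 - θ j) * h q) =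
          (lam j * θ j) * h p + (lam j - lam j * θ j) * h q := by intro j; ring
      simp only [this]
      rw [Finset.sum_add_distrib, ← Finset.sum_mul, ← Finset.sum_mul, Finset.sum_sub_distrib,
        hθs, h1]
      ring
    rw [e, Finset.mul_sum, ← Finset.sum_add_distrib]
    apply Finset.sum_le_sum
    intro j _
    by_cases hj : lam j = 0
    · simp [hj]
    · have hp := mul_le_mul_of_nonneg_left (hle p (y j) (hnt j hj)) (hθ j).1
      have hq := mul_le_mul_of_nonneg_left (hle q (y j) (hnt j hj)) (sub_nonneg.2 (hθ j).2)
      calc _ ≤ lam j * (θ j * ((f (y j)).toReal + M * dist1 p (y j)) +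
            (1 - θ j) * ((f (y j)).toReal + M * dist1 q (y j))) :=
            mul_le_mul_of_nonneg_left (add_le_add hp hq) (h0 j)
        _ = _ := by ring
  have := mul_le_mul_of_nonneg_left hdist hM
  rw [hua, hvb]
  linarith

lemma dist1_nonneg {n : ℕ} (x y : Fin n → ℤ) : 0 ≤ dist1 x y :=
  Finset.sum_nonneg fun _ _ => abs_nonneg _

lemma dist1_self {n : ℕ} (x : Fin n → ℤ) : dist1 x x = 0 := by
  simp [dist1]

lemma one_le_dist1 {n : ℕ} (x y : Fin n → ℤ) (hxy : x ≠ y) : 1 ≤ dist1 x y := by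
  obtain ⟨k, hk⟩ := Function.ne_iff.1 hxy
  have h1 : |(x k : ℝ) - y k| ≤ dist1 x y :=
    Finset.single_le_sum (f := fun k => |(x k : ℝ) - y k|) (fun _ _ => abs_nonneg _)
      (Finset.mem_univ k)
  have h2 : 1 ≤ |x k - y k| := Int.one_le_abs (sub_ne_zero.2 hk)
  have h3 : (1 : ℝ) ≤ |(x k : ℝ) - y k| := by exact_mod_cast h2
  linarith

/-- Existence of the regularisation. -/
lemma exists_reg {n : ℕ} (f : (Fin n → ℤ) → EReal)
    (hpos : ∀ x, f x ≠ ⊤ → ∀ i, 0 ≤ x i)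
    (hbdd : ∃ M : ℤ, ∀ x, f x ≠ ⊤ → ∀ i, x i ≤ M)
    (h0 : f 0 ≠ ⊤) (M : ℝ) :
    ∃ h : (Fin n → ℤ) → ℝ,
      (∀ x w, f w ≠ ⊤ → h x ≤ (f w).toReal + M * dist1 x w) ∧
      (∀ x, ∃ w, f w ≠ ⊤ ∧ h x = (f w).toReal + M * dist1 x w) := by
  obtain ⟨B, hB⟩ := hbdd
  have hfin : {w | f w ≠ ⊤}.Finite := by
    apply (Set.finite_Icc (0 : Fin n → ℤ) (fun _ => B)).subset
    intro w hw
    exact ⟨fun i => hpos w hw i, fun i => hB w hw i⟩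
  have hne : {w | f w ≠ ⊤}.Nonempty := ⟨0, h0⟩
  have key : ∀ x, ∃ w, f w ≠ ⊤ ∧ ∀ w', f w' ≠ ⊤ →
      (f w).toReal + M * dist1 x w ≤ (f w').toReal + M * dist1 x w' := by
    intro x
    obtain ⟨w, hw, hm⟩ := Set.exists_min_image _ (fun w => (f w).toReal + M * dist1 x w) hfin hne
    exact ⟨w, hw, fun w' hw' => hm w' hw'⟩
  choose W hW1 hW2 using key
  exact ⟨fun x => (f (W x)).toReal + M * dist1 x (W x), fun x w hw => hW2 x w hw,
    fun x => ⟨W x, hW1 x, rfl⟩⟩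

/-- Iterating the descent property along a cone. -/
lemma cone_iter {n : ℕ} (G : (Fin n → ℤ) → Prop) (σ : ℤ)
    (s : Finset (Fin n)) (c : Fin n → ℕ)
    (hs : ∀ z, ∀ i ∈ s, G z → G (fun k => z k - 1 - if k = i then σ else 0))
    (z : Fin n → ℤ) (hz : G z) :
    G (fun k => z k - (∑ i ∈ s, (c i : ℤ)) - if k ∈ s then σ * c k else 0) := by
  induction s using Finset.induction_on with
  | empty => simpa using hz
  | insert a s ha ih =>
    have h1 := ih (fun z i hi => hs z i (by simp [hi]))
    have h2 : ∀ (m : ℕ) (z : Fin n → ℤ), G z → G (fun k => z k - m - if k = a then σ * m else 0) := by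
      intro m
      induction m with
      | zero => intro z hz; simpa using hz
      | succ m ihm =>
        intro z hz
        have := hs _ a (by simp) (ihm z hz)
        convert this using 2 with k
        push_cast
        split_ifs <;> ring
    convert h2 (c a) _ h1 using 2 with k
    rw [Finset.sum_insert ha]
    by_cases hk : k = a
    · subst hk
      simp [ha]
      ring
    · simp [hk]
      ring

lemma iter_one {n : ℕ} (G : (Fin n → ℤ) → Prop)
    (hs : ∀ z, G z → G (fun k => z k - 1)) (m : ℕ) (z : Fin n → ℤ) (hz : G z) :
    G (fun k => z k - m) := by
  induction m with
  | zero => simpa using hz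
  | succ m ihm =>
    convert hs _ ihm using 2 with k
    push_cast
    ring

/-- The core contradiction: `xstar` cannot lie in `α·𝟙` plus the cone. -/
lemma core {n : ℕ} (f : (Fin (n + 1) → ℤ) → EReal) (hbot : ∀ x, f x ≠ ⊥)
    (hf : IsIntegrallyConvexFn f)
    (hpos : ∀ x, f x ≠ ⊤ → ∀ i, 0 ≤ x i)
    (hbdd : ∃ M : ℤ, ∀ x, f x ≠ ⊤ → ∀ i, x i ≤ M)
    (h0 : f 0 ≠ ⊤)
    (α : ℕ) (hα : 0 < α)
    (hloc : f 0 ≤ f (fun _ => (α : ℤ)))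
    (xstar : Fin (n + 1) → ℤ) (hxdom : f xstar ≠ ⊤)
    (hmin : ∀ w, f xstar ≤ f w)
    (hfminimal : ∀ y : Fin (n + 1) → ℤ,
      (∀ i, 0 ≤ y i) → y ≤ xstar → f y ≤ f xstar → y = xstar)
    (σ : ℤ) (hσ : σ = 1 ∨ σ = -1) (c : Fin (n + 1) → ℕ) (r : ℕ)
    (hx : ∀ k, xstar k = α + (∑ i, (c i : ℤ)) + σ * c k + r) : False := by
  have toReal_le : ∀ x y, f y ≠ ⊤ → f x ≤ f y → (f x).toReal ≤ (f y).toReal := fun x y hy hxy =>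
    EReal.toReal_le_toReal hxy (hbot x) hy
  have hF : (f xstar).toReal ≤ (f 0).toReal := toReal_le _ _ h0 (hmin 0)
  set M : ℝ := (f 0).toReal - (f xstar).toReal + 1 with hMdef
  have hM : 0 < M := by linarith
  obtain ⟨h, hle, hex⟩ := exists_reg f hpos hbdd h0 M
  have hmid := reg_mid f hbot hf M hM.le h hle hex
  -- lower bound
  have hlow : ∀ x, (f x ≠ ⊤ ∧ h x = (f x).toReal) ∨ (f xstar).toReal + M ≤ h x := by
    intro x
    obtain ⟨w, hw, he⟩ := hex x
    by_cases hxw : x = w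
    · left
      subst hxw
      exact ⟨hw, by rw [he, dist1_self]; ring⟩
    · right
      have h1 := one_le_dist1 x w hxw
      have h2 := toReal_le _ _ hw (hmin w)
      have h3 := mul_le_mul_of_nonneg_left h1 hM.le
      rw [he]
      linarith
  have hx0 : h xstar ≤ (f xstar).toReal := by
    have := hle xstar xstar hxdom
    rwa [dist1_self, mul_zero, add_zero] at this
  have h00 : h 0 ≤ (f 0).toReal := by
    have := hle 0 0 h0
    rwa [dist1_self, mul_zero, add_zero] at this
  let G : (Fin (n + 1) → ℤ) → Prop := fun z => h z < h (fun k => z k - 1)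
  have G0 : G xstar := by
    rcases hlow (fun k => xstar k - 1) with ⟨hd, he⟩ | hl
    · show h xstar < h (fun k => xstar k - 1)
      rw [he]
      refine lt_of_le_of_lt hx0 ?_
      by_contra hcon
      push Not at hcon
      have h4 : f (fun k => xstar k - 1) ≤ f xstar := by
        rw [← EReal.coe_toReal hd (hbot _), ← EReal.coe_toReal hxdom (hbot _)]
        exact_mod_cast hcon
      have h5 := hfminimal _ (hpos _ hd) (fun k => by simp) h4
      have := congrFun h5 0
      simp at this
    · show h xstar < h (fun k => xstar k - 1)
      linarith
  have G1 : ∀ z, G z → G (fun k => z k - 1) := by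
    intro z hz
    have := hmid z (fun k => z k - 1 - 1) (fun k => z k - 1) (fun k => z k - 1)
      (fun k => by ring) 0 (fun _ _ => rfl) (Or.inl rfl)
    simp only [G] at hz ⊢
    linarith
  have G2 : ∀ z, ∀ i ∈ (Finset.univ : Finset (Fin (n + 1))), G z →
      G (fun k => z k - 1 - if k = i then σ else 0) := by
    intro z i _ hz
    simp only [G] at hz ⊢
    rcases hσ with rfl | rfl
    · have := hmid z (fun k => z k - 1 - (if k = i then 1 else 0) - 1)
        (fun k => z k - 1 - (if k = i then 1 else 0)) (fun k => z k - 1)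
        (fun k => by ring) i (fun k hk => by simp [hk]) (Or.inr (by simp))
      linarith
    · have := hmid z (fun k => z k - 1 - (if k = i then -1 else 0) - 1)
        (fun k => z k - 1) (fun k => z k - 1 - (if k = i then -1 else 0))
        (fun k => by ring) i (fun k hk => by simp [hk]) (Or.inr (by simp))
      linarith
  have G3 : G (fun _ => (α : ℤ)) := by
    have := iter_one G G1 r _ (cone_iter G σ Finset.univ c G2 xstar G0)
    convert this using 2 with k
    rw [hx k]
    simp
    ring
  have G4 : ∀ m : ℕ, m ≤ α → h (fun _ => (α : ℤ)) ≤ h (fun _ => (α : ℤ) - m) ∧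
      (0 < m → h (fun _ => (α : ℤ)) < h (fun _ => (α : ℤ) - m)) := by
    intro m
    induction m with
    | zero => intro _; simp
    | succ m ih =>
      intro hm
      have h1 := (ih (by omega)).1
      have h2 : h (fun _ => (α : ℤ) - m) < h (fun _ => (α : ℤ) - m - 1) := iter_one G G1 m _ G3
      have e : (fun _ : Fin (n + 1) => (α : ℤ) - ((m + 1 : ℕ) : ℤ)) = fun _ => (α : ℤ) - m - 1 := by
        funext _
        push_cast
        ring
      rw [e]
      exact ⟨by linarith, fun _ => by linarith⟩
  have G5 := (G4 α le_rfl).2 hα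
  have e : (fun _ : Fin (n + 1) => (α : ℤ) - (α : ℤ)) = 0 := by
    funext _
    simp
  rw [e] at G5
  rcases hlow (fun _ => (α : ℤ)) with ⟨hd, he⟩ | hl
  · have := toReal_le _ _ hd hloc
    linarith
  · linarith

/-- Inequalities satisfied by a sorted f-minimal global minimizer
(Lemma on differences and sums). -/
theorem fminimal_minimizer_inequalities {n : ℕ}
    (f : (Fin (n + 1) → ℤ) → EReal) (hbot : ∀ x, f x ≠ ⊥)
    (hf : IsIntegrallyConvexFn f)
    (hpos : ∀ x, f x ≠ ⊤ → ∀ i, 0 ≤ x i)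
    (hbdd : ∃ M : ℤ, ∀ x, f x ≠ ⊤ → ∀ i, x i ≤ M)
    (h0 : f 0 ≠ ⊤)
    (α : ℕ) (hα : 0 < α)
    (hloc : ∀ A : Finset (Fin (n + 1)),
      f 0 ≤ f (fun i => if i ∈ A then (α : ℤ) else 0))
    (xstar : Fin (n + 1) → ℤ) (hxdom : f xstar ≠ ⊤)
    (hmin : ∀ w, f xstar ≤ f w)
    (hfminimal : ∀ y : Fin (n + 1) → ℤ,
      (∀ i, 0 ≤ y i) → y ≤ xstar → f y ≤ f xstar → y = xstar)
    (hsorted : ∀ i j : Fin (n + 1), i ≤ j → xstar j ≤ xstar i) :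
    (xstar (Fin.last n) - (α : ℤ) + 1 ≤
        ∑ i ∈ Finset.univ.erase (Fin.last n), (xstar i - xstar (Fin.last n))) ∧
    (xstar 0 - (α : ℤ) + 1 ≤
        ∑ i ∈ Finset.univ.erase 0, (xstar 0 - xstar i)) ∧
    ((xstar (Fin.last n) : ℝ) ≤
        ((n : ℝ) / ((n : ℝ) + 2)) * (xstar 0 : ℝ) +
          2 * ((α : ℝ) - 1) / ((n : ℝ) + 2)) := by
  have hloc' : f 0 ≤ f (fun _ => (α : ℤ)) := by simpa using hloc Finset.univ
  have hcore := core f hbot hf hpos hbdd h0 α hα hloc' xstar hxdom hmin hfminimal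
  have e1 : ∑ i ∈ Finset.univ.erase (Fin.last n), (xstar i - xstar (Fin.last n)) =
      ∑ i, (xstar i - xstar (Fin.last n)) := Finset.sum_erase _ (by simp)
  have e2 : ∑ i ∈ Finset.univ.erase 0, (xstar 0 - xstar i) =
      ∑ i, (xstar 0 - xstar i) := Finset.sum_erase _ (by simp)
  have c1 : xstar (Fin.last n) - (α : ℤ) + 1 ≤ ∑ i, (xstar i - xstar (Fin.last n)) := by
    by_contra hcon
    have hc : ∀ i, (((xstar i - xstar (Fin.last n)).toNat : ℕ) : ℤ) =
        xstar i - xstar (Fin.last n) := fun i =>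
      Int.toNat_of_nonneg (sub_nonneg.2 (hsorted i _ (Fin.le_last i)))
    apply hcore 1 (Or.inl rfl) (fun i => (xstar i - xstar (Fin.last n)).toNat)
      (xstar (Fin.last n) - α - ∑ i, (xstar i - xstar (Fin.last n))).toNat
    intro k
    simp only [hc]
    rw [Int.toNat_of_nonneg (by omega)]
    ring
  have c2 : xstar 0 - (α : ℤ) + 1 ≤ ∑ i, (xstar 0 - xstar i) := by
    by_contra hcon
    have hc : ∀ i, (((xstar 0 - xstar i).toNat : ℕ) : ℤ) = xstar 0 - xstar i := fun i =>
      Int.toNat_of_nonneg (sub_nonneg.2 (hsorted 0 i (Fin.zero_le i)))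
    apply hcore (-1) (Or.inr rfl) (fun i => (xstar 0 - xstar i).toNat)
      (xstar 0 - α - ∑ i, (xstar 0 - xstar i)).toNat
    intro k
    simp only [hc]
    rw [Int.toNat_of_nonneg (by omega)]
    ring
  refine ⟨by rw [e1]; exact c1, by rw [e2]; exact c2, ?_⟩
  have c3 := add_le_add c1 c2
  rw [← Finset.sum_add_distrib] at c3
  have e3 : ∑ i : Fin (n + 1), ((xstar i - xstar (Fin.last n)) + (xstar 0 - xstar i)) =
      ((n : ℤ) + 1) * (xstar 0 - xstar (Fin.last n)) := by
    have : ∀ i : Fin (n + 1), (xstar i - xstar (Fin.last n)) + (xstar 0 - xstar i) =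
      xstar 0 - xstar (Fin.last n) := fun i => by ring
    simp [this]
    ring
  rw [e3] at c3
  have c4 : ((xstar (Fin.last n) : ℝ) - α + 1) + ((xstar 0 : ℝ) - α + 1) ≤
      ((n : ℝ) + 1) * (xstar 0 - xstar (Fin.last n)) := by exact_mod_cast c3
  have hn : (0 : ℝ) < (n : ℝ) + 2 := by positivity
  rw [div_mul_eq_mul_div, ← add_div, le_div_iff₀ hn]
  linarith
end
end
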